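/- arXiv:1609.04498 — 3 statements merged into one kernel-verified Lean document; each statement's English description precedes it below -/
import Mathlib

section
/- Let A ⊂ ℝ² be the Sierpiński gasket, i.e., the attractor of the iterated function system f_i(x) = (x + v_i)/2, i = 1,2,3, with v₁ = (0,0), v₂ = (1,0), v₃ = (1/2, √3/2), and let δ > 1/(4√3). Then for every s ∈ ℂ with Re s > log 3/log 2, ∫_{A_δ} dist(x,A)^{s−2} dx = 6·(√3)^{1−s}·2^{−s}/(s(s−1)(2^s−3)) + 2π·δ^s/s + 3·δ^{s−1}/(s−1), where for x > 0 and z ∈ ℂ, x^z := exp(z log x). -/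
open MeasureTheory Filter Complex Set Metric Topology
open scoped ENNReal

noncomputable section

/-- A point of the Euclidean plane `ℝ²` with coordinates `(x, y)`. -/
def pt (x y : ℝ) : EuclideanSpace ℝ (Fin 2) :=
  (WithLp.equiv 2 (Fin 2 → ℝ)).symm ![x, y]

/-- The open `t`-neighborhood `A_t = {x : dist(x,A) < t}` of a set `A ⊆ ℝ²`. -/
def nbhd2 (A : Set (EuclideanSpace ℝ (Fin 2))) (t : ℝ) : Set (EuclideanSpace ℝ (Fin 2)) :=
  {x | Metric.infDist x A < t}

local notation "E2" => EuclideanSpace ℝ (Fin 2)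

@[simp] lemma pt_apply_zero (x y : ℝ) : pt x y 0 = x := rfl
@[simp] lemma pt_apply_one (x y : ℝ) : pt x y 1 = y := rfl

/-- The similarity `x ↦ (x + v) / 2`. -/
def half (v x : E2) : E2 := (2 : ℝ)⁻¹ • (x + v)

/-- The vertices of the gasket. -/
def vert : Fin 3 → E2 := ![pt 0 0, pt 1 0, pt (1 / 2) (Real.sqrt 3 / 2)]

/-- The outward unit normal of the edge opposite to the `i`-th vertex. -/
def nrm : Fin 3 → E2 :=
  ![pt (Real.sqrt 3 / 2) (1 / 2), pt (-(Real.sqrt 3 / 2)) (1 / 2), pt 0 (-1)]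

/-- The linear functional with gradient `(2 / √3) • nrm i`. -/
def gl : Fin 3 → E2 → ℝ :=
  ![fun x => x 0 + x 1 / Real.sqrt 3, fun x => -x 0 + x 1 / Real.sqrt 3,
    fun x => -(2 * (x 1 / Real.sqrt 3))]

/-- The affine functional which vanishes at the `i`-th vertex and is `1` at the others. -/
def far (i : Fin 3) (x : E2) : ℝ := gl i x + ![0, 1, 1] i

/-- The closed triangle spanned by the vertices. -/
def tri : Set E2 := {x | ∀ i, far i x ≤ 1}

lemma sqrt_three_sq : Real.sqrt 3 * Real.sqrt 3 = 3 := Real.mul_self_sqrt (by norm_num)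

lemma sqrt_three_pos : 0 < Real.sqrt 3 := by positivity

lemma gl_add (i : Fin 3) (x y : E2) : gl i (x + y) = gl i x + gl i y := by
  fin_cases i <;> simp [gl] <;> ring

lemma gl_smul (i : Fin 3) (c : ℝ) (x : E2) : gl i (c • x) = c * gl i x := by
  fin_cases i <;> simp [gl] <;> ring

lemma gl_sub (i : Fin 3) (x y : E2) : gl i (x - y) = gl i x - gl i y := by
  fin_cases i <;> simp [gl] <;> ring

lemma far_sub_far (i : Fin 3) (x y : E2) : far i x - far i y = gl i (x - y) := by
  rw [gl_sub, far, far]; ring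

lemma far_add (i : Fin 3) (x y : E2) : far i (x + y) = far i x + gl i y := by
  rw [far, gl_add, far]; ring

lemma continuous_gl (i : Fin 3) : Continuous (gl i) := by
  fin_cases i <;> simp [gl] <;> fun_prop

lemma continuous_far (i : Fin 3) : Continuous (far i) := (continuous_gl i).add continuous_const

lemma gl_sum (x : E2) : gl 0 x + gl 1 x + gl 2 x = 0 := by
  simp [gl]; ring

lemma far_sum (x : E2) : far 0 x + far 1 x + far 2 x = 2 := by
  simp [far]; linarith [gl_sum x]

lemma gl_nrm_self (i : Fin 3) : gl i (nrm i) = 2 / Real.sqrt 3 := by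
  have h := sqrt_three_sq
  have h0 := sqrt_three_pos
  fin_cases i <;> simp [gl, nrm] <;> field_simp <;> nlinarith

lemma gl_nrm_ne {i j : Fin 3} (hij : j ≠ i) : gl j (nrm i) = -(1 / Real.sqrt 3) := by
  have h := sqrt_three_sq
  have h0 := sqrt_three_pos
  fin_cases i <;> fin_cases j <;> first | exact absurd rfl hij | skip
  all_goals simp [gl, nrm]
  all_goals field_simp
  all_goals nlinarith

lemma far_vert_self (i : Fin 3) : far i (vert i) = 0 := by
  have h := sqrt_three_sq
  have h0 := sqrt_three_pos
  fin_cases i <;> simp [far, gl, vert]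
  field_simp; norm_num

lemma far_vert_ne {i j : Fin 3} (hij : j ≠ i) : far j (vert i) = 1 := by
  have h := sqrt_three_sq
  have h0 := sqrt_three_pos
  fin_cases i <;> fin_cases j <;> first | exact absurd rfl hij | skip
  all_goals simp [far, gl, vert]
  all_goals field_simp
  all_goals norm_num

lemma norm_sq_eq (x : E2) : ‖x‖ ^ 2 = (gl 0 x ^ 2 + gl 1 x ^ 2 + gl 2 x ^ 2) / 2 := by
  rw [EuclideanSpace.norm_sq_eq, Fin.sum_univ_two]
  have h := sqrt_three_sq
  have h0 := sqrt_three_pos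
  have : x 1 = Real.sqrt 3 * (x 1 / Real.sqrt 3) := by field_simp
  simp only [gl, Matrix.cons_val_zero, Matrix.cons_val_one, Matrix.cons_val, Real.norm_eq_abs,
    sq_abs]
  set z := x 1 / Real.sqrt 3
  rw [this]
  linear_combination z ^ 2 * h

lemma far_half (i j : Fin 3) (x : E2) :
    far j (half (vert i) x) = (far j x + far j (vert i)) / 2 := by
  simp only [far, half, gl_smul, gl_add]; ring

lemma far_half_self (i : Fin 3) (x : E2) : far i (half (vert i) x) = far i x / 2 := by
  rw [far_half, far_vert_self, add_zero]

lemma far_half_ne {i j : Fin 3} (hij : j ≠ i) (x : E2) :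
    far j (half (vert i) x) = (far j x + 1) / 2 := by
  rw [far_half, far_vert_ne hij]

lemma half_double (v x : E2) : half v ((2 : ℝ) • x - v) = x := by
  simp [half, smul_smul]

lemma dist_half (v x y : E2) : dist (half v x) (half v y) = dist x y / 2 := by
  rw [half, half, dist_smul₀, dist_add_right]; simp; ring

lemma norm_nrm (i : Fin 3) : ‖nrm i‖ = 1 := by
  have h := sqrt_three_sq
  have h0 := sqrt_three_pos
  have : ‖nrm i‖ ^ 2 = 1 := by
    rw [EuclideanSpace.norm_sq_eq, Fin.sum_univ_two]
    fin_cases i <;> simp [nrm, div_pow] <;> norm_num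
  nlinarith [norm_nonneg (nrm i)]

lemma far_sub_le_dist (i : Fin 3) (x y : E2) :
    Real.sqrt 3 * ((far i x - far i y) / 2) ≤ dist x y := by
  rw [far_sub_far, dist_eq_norm]
  have h := sqrt_three_sq
  have h0 := sqrt_three_pos
  apply le_of_sq_le_sq _ (norm_nonneg _)
  rw [norm_sq_eq, mul_pow, sq (Real.sqrt 3), h]
  have := gl_sum (x - y)
  fin_cases i <;> simp only [Fin.zero_eta, Fin.mk_one, Fin.reduceFinMk]
  · have e : gl 2 (x - y) = - gl 0 (x - y) - gl 1 (x - y) := by linarith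
    rw [e]; nlinarith [sq_nonneg (gl 0 (x-y) + 2 * gl 1 (x-y))]
  · have e : gl 2 (x - y) = - gl 0 (x - y) - gl 1 (x - y) := by linarith
    rw [e]; nlinarith [sq_nonneg (gl 1 (x-y) + 2 * gl 0 (x-y))]
  · have e : gl 0 (x - y) = - gl 2 (x - y) - gl 1 (x - y) := by linarith
    rw [e]; nlinarith [sq_nonneg (gl 2 (x-y) + 2 * gl 1 (x-y))]

lemma isCompact_tri : IsCompact tri := by
  apply Metric.isCompact_of_isClosed_isBounded
  · have : tri = ⋂ i, {x | far i x ≤ 1} := by ext; simp [tri]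
    rw [this]
    exact isClosed_iInter fun i => isClosed_le (continuous_far i) continuous_const
  · refine (Metric.isBounded_closedBall (x := (0 : E2)) (r := 3)).subset fun x hx => ?_
    rw [mem_closedBall_zero_iff]
    apply le_of_sq_le_sq _ (by norm_num)
    rw [norm_sq_eq]
    have h0 := hx 0
    have h1 := hx 1
    have h2 := hx 2
    have := gl_sum x
    simp [far] at h0 h1 h2
    nlinarith

/-- The Sierpiński gasket: a nonempty compact set fixed by the iterated function system. -/
structure IsGasket (A : Set E2) : Prop where
  isCompact : IsCompact A
  nonempty : A.Nonempty
  mem_iff : ∀ x, x ∈ A ↔ ∃ i, ∃ y ∈ A, half (vert i) y = x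

namespace IsGasket

variable {A : Set E2}

lemma half_mem (hA : IsGasket A) (i : Fin 3) {x : E2} (hx : x ∈ A) : half (vert i) x ∈ A :=
  (hA.mem_iff _).2 ⟨i, x, hx, rfl⟩

lemma subset_tri (hA : IsGasket A) : A ⊆ tri := by
  intro x hx i
  obtain ⟨m, hm, hmax⟩ := hA.isCompact.exists_isMaxOn hA.nonempty (continuous_far i).continuousOn
  have hxm : far i x ≤ far i m := hmax hx
  obtain ⟨j, y, hy, rfl⟩ := (hA.mem_iff m).1 hm
  have hym : far i y ≤ far i (half (vert j) y) := hmax hy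
  rcases eq_or_ne i j with rfl | hij
  · rw [far_half_self] at *; linarith
  · rw [far_half_ne hij] at *; linarith

lemma infDist_half_le (hA : IsGasket A) (i : Fin 3) (x : E2) :
    infDist (half (vert i) x) A ≤ infDist x A / 2 := by
  obtain ⟨y, hy, h⟩ := hA.isCompact.exists_infDist_eq_dist hA.nonempty x
  rw [h, ← dist_half (vert i)]
  exact infDist_le_dist_of_mem (hA.half_mem i hy)

lemma boundary_subset (hA : IsGasket A) {x : E2} (hx : x ∈ tri) {i : Fin 3} (hi : far i x = 1) :
    x ∈ A := by
  set K : Set E2 := tri ∩ ⋃ i, {x | far i x = 1} with hK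
  have hKc : IsCompact K := isCompact_tri.inter_right
    (isClosed_iUnion_of_finite fun i => isClosed_eq (continuous_far i) continuous_const)
  have hxK : x ∈ K := ⟨hx, mem_iUnion.2 ⟨i, hi⟩⟩
  obtain ⟨m, hm, hmax⟩ := hKc.exists_isMaxOn ⟨x, hxK⟩ (continuous_infDist_pt A).continuousOn
  have key : ∃ j, (2 : ℝ) • m - vert j ∈ K := by
    obtain ⟨hmT, hmi⟩ := hm
    obtain ⟨k, hk⟩ := mem_iUnion.1 hmi
    have hk : far k m = 1 := hk
    have hs := far_sum m
    have h0 := hmT 0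
    have h1 := hmT 1
    have h2 := hmT 2
    have hfar : ∀ j l, far l ((2 : ℝ) • m - vert j) = 2 * far l m - far l (vert j) := by
      intro j l
      have := far_half j l ((2 : ℝ) • m - vert j)
      rw [half_double] at this; linarith
    have : ∃ j, j ≠ k ∧ far j m ≤ 1 / 2 := by
      fin_cases k
      · by_cases h : far 1 m ≤ 1 / 2
        · exact ⟨1, by decide, h⟩
        · exact ⟨2, by decide, by simp at hk; linarith⟩
      · by_cases h : far 0 m ≤ 1 / 2
        · exact ⟨0, by decide, h⟩
        · exact ⟨2, by decide, by simp at hk; linarith⟩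
      · by_cases h : far 0 m ≤ 1 / 2
        · exact ⟨0, by decide, h⟩
        · exact ⟨1, by decide, by simp at hk; linarith⟩
    obtain ⟨j, hjk, hj⟩ := this
    refine ⟨j, fun l => ?_, mem_iUnion.2 ⟨k, ?_⟩⟩
    · rw [hfar]
      rcases eq_or_ne l j with rfl | hl
      · rw [far_vert_self]; linarith
      · rw [far_vert_ne hl]; linarith [hmT l]
    · change far k _ = 1
      rw [hfar, far_vert_ne hjk.symm, hk]; norm_num
  obtain ⟨j, hj⟩ := key
  have h1 : infDist ((2 : ℝ) • m - vert j) A ≤ infDist m A := hmax hj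
  have h2 := hA.infDist_half_le j ((2 : ℝ) • m - vert j)
  rw [half_double] at h2
  have h3 : infDist x A ≤ infDist m A := hmax hxK
  have h4 : infDist x A = 0 := le_antisymm (by linarith) infDist_nonneg
  exact (hA.isCompact.isClosed.mem_iff_infDist_zero hA.nonempty).2 h4

lemma vert_mem (hA : IsGasket A) (i : Fin 3) : vert i ∈ A := by
  obtain ⟨j, hj⟩ : ∃ j, j ≠ i := exists_ne i
  refine hA.boundary_subset (fun k => ?_) (far_vert_ne hj)
  rcases eq_or_ne k i with rfl | hk
  · rw [far_vert_self]; norm_num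
  · rw [far_vert_ne hk]

lemma exists_far_le_half (hA : IsGasket A) {x : E2} (hx : x ∈ A) : ∃ i, far i x ≤ 1 / 2 := by
  obtain ⟨i, y, hy, rfl⟩ := (hA.mem_iff x).1 hx
  refine ⟨i, ?_⟩
  rw [far_half_self]
  linarith [hA.subset_tri hy i]

lemma mem_of_far_eq_half (hA : IsGasket A) {x : E2} (hx : x ∈ tri) {i j : Fin 3}
    (hij : j ≠ i) (hi : far i x ≤ 1 / 2) (h : far i x = 1 / 2 ∨ far j x = 1) : x ∈ A := by
  rw [← half_double (vert i) x] at h hi hx ⊢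
  apply hA.half_mem
  have hT : (2 : ℝ) • x - vert i ∈ tri := by
    intro k
    have := hx k
    rcases eq_or_ne k i with rfl | hk
    · rw [far_half_self] at *; linarith
    · rw [far_half_ne hk] at *; linarith
  rcases h with h | h
  · refine hA.boundary_subset (i := i) hT ?_
    rw [far_half_self] at h; linarith
  · refine hA.boundary_subset (i := j) hT ?_
    rw [far_half_ne hij] at h; linarith

lemma infDist_half (hA : IsGasket A) (i : Fin 3) {x : E2} (hx : x ∈ tri) :
    infDist (half (vert i) x) A = infDist x A / 2 := by
  refine le_antisymm (hA.infDist_half_le i x) ?_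
  rw [le_infDist hA.nonempty]
  intro a ha
  obtain ⟨j, b, hb, rfl⟩ := (hA.mem_iff a).1 ha
  rcases eq_or_ne i j with rfl | hij
  · rw [dist_half]
    linarith [infDist_le_dist_of_mem (x := x) hb]
  set y := half (vert i) x with hy
  set z := half (vert j) b with hz
  have hyi : far i y ≤ 1 / 2 := by rw [hy, far_half_self]; linarith [hx i]
  have hzi : 1 / 2 ≤ far i z := by
    rw [hz, far_half_ne hij]
    have hbT := hA.subset_tri hb
    have hs := far_sum b
    have h0 := hbT 0
    have h1 := hbT 1
    have h2 := hbT 2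
    fin_cases i <;> simp <;> linarith
  have hyT : y ∈ tri := by
    intro k
    rcases eq_or_ne k i with rfl | hk
    · linarith
    · rw [hy, far_half_ne hk]; linarith [hx k]
  have hzT : z ∈ tri := hA.subset_tri ha
  obtain ⟨t, ht0, ht1, ht⟩ : ∃ t : ℝ, 0 ≤ t ∧ t ≤ 1 ∧ far i y + t * (far i z - far i y) = 1 / 2 := by
    rcases hzi.eq_or_lt with h | h
    · exact ⟨1, by norm_num, le_rfl, by linarith⟩
    · have hpos : 0 < far i z - far i y := by linarith
      refine ⟨(1 / 2 - far i y) / (far i z - far i y), div_nonneg (by linarith) hpos.le, ?_, ?_⟩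
      · rw [div_le_one hpos]; linarith
      · field_simp; ring
  have hfar : ∀ k, far k (y + t • (z - y)) = far k y + t * (far k z - far k y) := by
    intro k
    rw [far_add, gl_smul, far_sub_far]
  have hpT : y + t • (z - y) ∈ tri := by
    intro k
    rw [hfar]
    nlinarith [mul_nonneg ht0 (sub_nonneg.2 (hzT k)),
      mul_nonneg (sub_nonneg.2 ht1) (sub_nonneg.2 (hyT k))]
  have hpi : far i (y + t • (z - y)) = 1 / 2 := by rw [hfar, ht]
  set p := y + t • (z - y) with hp
  have hqA : (2 : ℝ) • p - vert i ∈ A := by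
    refine hA.boundary_subset (i := i) (fun k => ?_) ?_
    · have := far_half i k ((2 : ℝ) • p - vert i)
      rw [half_double] at this
      rcases eq_or_ne k i with rfl | hk
      · rw [far_vert_self] at this; linarith
      · rw [far_vert_ne hk] at this; linarith [hpT k]
    · have := far_half_self i ((2 : ℝ) • p - vert i)
      rw [half_double] at this; linarith
  calc infDist x A / 2 ≤ dist x ((2 : ℝ) • p - vert i) / 2 := by
        linarith [infDist_le_dist_of_mem (x := x) hqA]
    _ = dist y p := by rw [← dist_half (vert i), half_double]
    _ = t * dist y z := by
        rw [hp, dist_self_add_right, norm_smul, Real.norm_of_nonneg ht0, dist_comm y z,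
          dist_eq_norm]
    _ ≤ dist y z := by nlinarith [dist_nonneg (x := y) (y := z)]

end IsGasket

namespace IsGasket

variable {A : Set E2}

lemma far_foot_self (i : Fin 3) (x : E2) (c : ℝ) :
    far i (x - (Real.sqrt 3 * c) • nrm i) = far i x - 2 * c := by
  have := sqrt_three_pos
  rw [sub_eq_add_neg, ← neg_smul, far_add, gl_smul, gl_nrm_self]
  field_simp
  ring

lemma far_foot_ne {i j : Fin 3} (hij : j ≠ i) (x : E2) (c : ℝ) :
    far j (x - (Real.sqrt 3 * c) • nrm i) = far j x + c := by
  have := sqrt_three_pos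
  rw [sub_eq_add_neg, ← neg_smul, far_add, gl_smul, gl_nrm_ne hij]
  field_simp

lemma infDist_le_of_foot_mem {i : Fin 3} {x : E2} {c : ℝ} (hc : 0 ≤ c)
    (h : x - (Real.sqrt 3 * c) • nrm i ∈ A) : infDist x A ≤ Real.sqrt 3 * c := by
  refine (infDist_le_dist_of_mem h).trans_eq ?_
  rw [dist_self_sub_right, norm_smul, norm_nrm, mul_one, Real.norm_of_nonneg]
  positivity

lemma infDist_middle_le (hA : IsGasket A) (i : Fin 3) {x : E2} (hx : ∀ j, 1 / 2 ≤ far j x) :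
    infDist x A ≤ Real.sqrt 3 * ((far i x - 1 / 2) / 2) := by
  refine infDist_le_of_foot_mem (i := i) (by linarith [hx i]) ?_
  obtain ⟨j, hj⟩ : ∃ j, j ≠ i := exists_ne i
  have hi : far i (x - (Real.sqrt 3 * ((far i x - 1 / 2) / 2)) • nrm i) = 1 / 2 := by
    rw [far_foot_self]; ring
  refine hA.mem_of_far_eq_half (i := i) (fun k => ?_) hj hi.le (Or.inl hi)
  rcases eq_or_ne k i with rfl | hk
  · rw [hi]; norm_num
  · rw [far_foot_ne hk]
    have hs := far_sum x
    have h0 := hx 0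
    have h1 := hx 1
    have h2 := hx 2
    fin_cases i <;> fin_cases k <;> first | exact absurd rfl hk | (simp at *; linarith)

lemma infDist_middle (hA : IsGasket A) {i : Fin 3} {x : E2} (hi : 1 / 2 ≤ far i x)
    (hx : ∀ j, far i x ≤ far j x) :
    infDist x A = Real.sqrt 3 * ((far i x - 1 / 2) / 2) := by
  refine le_antisymm (hA.infDist_middle_le i fun j => hi.trans (hx j)) ?_
  rw [le_infDist hA.nonempty]
  intro a ha
  obtain ⟨k, hk⟩ := hA.exists_far_le_half ha
  refine le_trans ?_ (far_sub_le_dist k x a)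
  have := hx k
  have := sqrt_three_pos
  gcongr

lemma infDist_strip (hA : IsGasket A) {i : Fin 3} {x : E2} (hi : 1 ≤ far i x)
    (hx : ∀ j, j ≠ i → far j x + (far i x - 1) / 2 ≤ 1) :
    infDist x A = Real.sqrt 3 * ((far i x - 1) / 2) := by
  apply le_antisymm
  · refine infDist_le_of_foot_mem (i := i) (by linarith) ?_
    have hi : far i (x - (Real.sqrt 3 * ((far i x - 1) / 2)) • nrm i) = 1 := by
      rw [far_foot_self]; ring
    refine hA.boundary_subset (i := i) (fun k => ?_) hi
    rcases eq_or_ne k i with rfl | hk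
    · exact hi.le
    · rw [far_foot_ne hk]
      exact hx k hk
  · rw [le_infDist hA.nonempty]
    intro a ha
    refine le_trans ?_ (far_sub_le_dist i x a)
    have := hA.subset_tri ha i
    have := sqrt_three_pos
    gcongr

lemma infDist_cone (hA : IsGasket A) {i : Fin 3} {x : E2}
    (hx : ∀ j, j ≠ i → gl i (x - vert i) ≤ gl j (x - vert i)) :
    infDist x A = ‖x - vert i‖ := by
  apply le_antisymm
  · rw [← dist_eq_norm]
    exact infDist_le_dist_of_mem (hA.vert_mem i)
  · rw [le_infDist hA.nonempty]
    intro a ha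
    rw [dist_eq_norm]
    have hxa : x - a = (x - vert i) - (a - vert i) := by abel
    have hT : ∀ j, j ≠ i → gl j (a - vert i) ≤ 0 := by
      intro j hj
      rw [← far_sub_far, far_vert_ne hj]
      linarith [hA.subset_tri ha j]
    rw [hxa]
    apply le_of_sq_le_sq _ (norm_nonneg _)
    rw [norm_sq_eq, norm_sq_eq]
    simp only [gl_sub _ (x - vert i)]
    have hs := gl_sum (a - vert i)
    set g := fun j => gl j (x - vert i)
    set k := fun j => gl j (a - vert i)
    change ∀ j, j ≠ i → g i ≤ g j at hx
    change ∀ j, j ≠ i → k j ≤ 0 at hT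
    change k 0 + k 1 + k 2 = 0 at hs
    change (g 0 ^ 2 + g 1 ^ 2 + g 2 ^ 2) / 2 ≤
      ((g 0 - k 0) ^ 2 + (g 1 - k 1) ^ 2 + (g 2 - k 2) ^ 2) / 2
    have key : ∀ j, j ≠ i → 0 ≤ (g j - g i) * (-k j) := fun j hj =>
      mul_nonneg (sub_nonneg.2 (hx j hj)) (neg_nonneg.2 (hT j hj))
    have hsq := fun j => sq_nonneg (k j)
    fin_cases i
    · have e : k 0 = -k 1 - k 2 := by linarith
      have h1 := key 1 (by decide)
      have h2 := key 2 (by decide)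
      simp only [Fin.zero_eta, e] at *
      nlinarith [hsq 1, hsq 2, sq_nonneg (k 1 + k 2)]
    · have e : k 1 = -k 0 - k 2 := by linarith
      have h1 := key 0 (by decide)
      have h2 := key 2 (by decide)
      simp only [Fin.mk_one, e] at *
      nlinarith [hsq 0, hsq 2, sq_nonneg (k 0 + k 2)]
    · have e : k 2 = -k 0 - k 1 := by linarith
      have h1 := key 0 (by decide)
      have h2 := key 1 (by decide)
      simp only [Fin.reduceFinMk, e] at *
      nlinarith [hsq 0, hsq 1, sq_nonneg (k 0 + k 1)]

lemma exists_half_of_far_le {x : E2} (hx : x ∈ tri) {i : Fin 3} (hi : far i x ≤ 1 / 2) :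
    ∃ y ∈ tri, half (vert i) y = x := by
  refine ⟨(2 : ℝ) • x - vert i, fun k => ?_, half_double _ _⟩
  have := far_half i k ((2 : ℝ) • x - vert i)
  rw [half_double] at this
  rcases eq_or_ne k i with rfl | hk
  · rw [far_vert_self] at this; linarith
  · rw [far_vert_ne hk] at this; linarith [hx k]

lemma infDist_tri_le (hA : IsGasket A) {x : E2} (hx : x ∈ tri) :
    infDist x A ≤ 1 / (4 * Real.sqrt 3) := by
  have hpos := sqrt_three_pos
  obtain ⟨m, hm, hmax⟩ := isCompact_tri.exists_isMaxOn ⟨x, hx⟩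
    (continuous_infDist_pt A).continuousOn
  have hxm : infDist x A ≤ infDist m A := hmax hx
  refine hxm.trans ?_
  by_cases h : ∃ i, far i m ≤ 1 / 2
  · obtain ⟨i, hi⟩ := h
    obtain ⟨y, hy, rfl⟩ := exists_half_of_far_le hm hi
    have h1 : infDist y A ≤ infDist (half (vert i) y) A := hmax hy
    rw [hA.infDist_half i hy] at *
    have : 0 ≤ 1 / (4 * Real.sqrt 3) := by positivity
    linarith
  · push Not at h
    have hM : ∀ j, 1 / 2 ≤ far j m := fun j => (h j).le
    obtain ⟨i, hi⟩ : ∃ i, far i m ≤ 2 / 3 := by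
      by_contra! hcon
      linarith [far_sum m, hcon 0, hcon 1, hcon 2]
    refine (hA.infDist_middle_le i hM).trans ?_
    calc Real.sqrt 3 * ((far i m - 1 / 2) / 2) ≤ Real.sqrt 3 * ((2 / 3 - 1 / 2) / 2) := by gcongr
      _ = 1 / (4 * Real.sqrt 3) := by
        field_simp; rw [sq, sqrt_three_sq]; norm_num

end IsGasket

/-- A unit vector parallel to the edge opposite to the `i`-th vertex. -/
def tng : Fin 3 → E2 :=
  ![pt (-(1 / 2)) (Real.sqrt 3 / 2), pt (1 / 2) (Real.sqrt 3 / 2), pt 1 0]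

/-- The rotation sending the standard basis to `tng i`, `nrm i`. -/
def edgeFrame (i : Fin 3) : E2 →ₗᵢ[ℝ] E2 where
  toFun p := p 0 • tng i + p 1 • nrm i
  map_add' p q := by simp only [PiLp.add_apply, add_smul]; abel
  map_smul' c p := by simp [smul_smul]
  norm_map' p := by
    have h := sqrt_three_sq
    refine (sq_eq_sq₀ (norm_nonneg _) (norm_nonneg _)).1 ?_
    rw [EuclideanSpace.norm_sq_eq, EuclideanSpace.norm_sq_eq, Fin.sum_univ_two, Fin.sum_univ_two]
    simp only [Real.norm_eq_abs, sq_abs]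
    fin_cases i <;> simp [nrm, tng]
    · linear_combination (p 0 ^ 2 / 4 + p 1 ^ 2 / 4) * h
    · linear_combination (p 0 ^ 2 / 4 + p 1 ^ 2 / 4) * h

/-- Coordinates along and orthogonal to the edge opposite to the `i`-th vertex. -/
def edgeCoord (o : E2) (i : Fin 3) (p : ℝ × ℝ) : E2 := o + (p.1 • tng i + p.2 • nrm i)

lemma edgeCoord_eq (o : E2) (i : Fin 3) :
    edgeCoord o i = (fun x => o + x) ∘ ((edgeFrame i).toLinearIsometryEquiv rfl) ∘
      (MeasurableEquiv.toLp 2 (Fin 2 → ℝ)) ∘ (MeasurableEquiv.finTwoArrow (α := ℝ)).symm := by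
  ext p
  rfl

lemma measurePreserving_edgeCoord (o : E2) (i : Fin 3) :
    MeasurePreserving (edgeCoord o i) volume volume := by
  rw [edgeCoord_eq]
  exact (measurePreserving_add_left volume o).comp
    (((edgeFrame i).toLinearIsometryEquiv rfl).measurePreserving.comp
      ((PiLp.volume_preserving_toLp (Fin 2)).comp (volume_preserving_finTwoArrow ℝ).symm))

lemma measurableEmbedding_edgeCoord (o : E2) (i : Fin 3) :
    MeasurableEmbedding (edgeCoord o i) := by
  rw [edgeCoord_eq]
  exact (MeasurableEquiv.addLeft o).measurableEmbedding.comp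
    (((edgeFrame i).toLinearIsometryEquiv rfl).toHomeomorph.measurableEmbedding.comp
      ((MeasurableEquiv.measurableEmbedding _).comp (MeasurableEquiv.measurableEmbedding _)))

lemma gl_tng_self (i : Fin 3) : gl i (tng i) = 0 := by
  have := sqrt_three_pos
  fin_cases i <;> simp [gl, tng] <;> field_simp <;> norm_num

lemma gl_tng (i : Fin 3) : (gl (i + 1) (tng i) = 1 ∧ gl (i + 2) (tng i) = -1) ∨
    (gl (i + 1) (tng i) = -1 ∧ gl (i + 2) (tng i) = 1) := by
  have := sqrt_three_pos
  fin_cases i <;> simp [gl, tng] <;> field_simp <;> norm_num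

lemma integral_subgraph {h : ℝ → ℂ} (hh : Measurable h) {w : ℝ → ℝ} (hw : Measurable w) {β : ℝ}
    (hw0 : ∀ b ∈ Ioo 0 β, 0 ≤ w b)
    (hint : IntegrableOn (fun b => (2 * w b : ℂ) * h b) (Ioo 0 β)) :
    IntegrableOn (fun p : ℝ × ℝ => h p.2) {p | p.2 ∈ Ioo 0 β ∧ |p.1| < w p.2} ∧
    ∫ p in {p : ℝ × ℝ | p.2 ∈ Ioo 0 β ∧ |p.1| < w p.2}, h p.2 =
      ∫ b in Ioo 0 β, (2 * w b : ℂ) * h b := by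
  set D : Set (ℝ × ℝ) := {p | p.2 ∈ Ioo 0 β ∧ |p.1| < w p.2} with hD
  have hDm : MeasurableSet D := by
    refine (measurable_snd measurableSet_Ioo).inter ?_
    exact measurableSet_lt (measurable_fst.abs) (hw.comp measurable_snd)
  set G : ℝ × ℝ → ℂ := D.indicator fun p => h p.2 with hG
  have hGm : Measurable G := (hh.comp measurable_snd).indicator hDm
  have hslice : ∀ b, (fun a => G (a, b)) =
      if b ∈ Ioo 0 β then (Ioo (-w b) (w b)).indicator (fun _ => h b) else 0 := by
    intro b
    split_ifs with hb
    · ext a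
      by_cases ha : |a| < w b
      · have : (a, b) ∈ D := ⟨hb, ha⟩
        simp [hG, this, abs_lt.1 ha]
      · have : (a, b) ∉ D := fun h => ha h.2
        have h2 : ¬ (-w b < a ∧ a < w b) := fun h => ha (abs_lt.2 h)
        rw [hG, indicator_of_notMem this, indicator_of_notMem (by simpa using h2)]
    · ext a
      have : (a, b) ∉ D := fun h => hb h.1
      rw [hG, indicator_of_notMem this]; rfl
  have hsInt : ∀ b, Integrable (fun a => G (a, b)) := by
    intro b
    rw [hslice]
    split_ifs
    · exact (integrable_indicator_iff measurableSet_Ioo).2 (integrableOn_const (by simp))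
    · exact integrable_zero _ _ _
  have hval : ∀ b, ∫ a, G (a, b) = (Ioo 0 β).indicator (fun b => (2 * w b : ℂ) * h b) b := by
    intro b
    rw [hslice]
    split_ifs with hb
    · have := hw0 b hb
      rw [integral_indicator measurableSet_Ioo, setIntegral_const, indicator_of_mem hb,
        Measure.real, Real.volume_Ioo, ENNReal.toReal_ofReal (by linarith)]
      simp; left; ring
    · rw [indicator_of_notMem hb]; simp
  have hnval : ∀ b, ∫ a, ‖G (a, b)‖ =
      ‖(Ioo 0 β).indicator (fun b => (2 * w b : ℂ) * h b) b‖ := by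
    intro b
    have : (fun a => ‖G (a, b)‖) = fun a => ‖(fun a => G (a, b)) a‖ := rfl
    rw [this, hslice]
    split_ifs with hb
    · have := hw0 b hb
      simp_rw [norm_indicator_eq_indicator_norm]
      rw [integral_indicator measurableSet_Ioo, setIntegral_const, indicator_of_mem hb,
        Measure.real, Real.volume_Ioo, ENNReal.toReal_ofReal (by linarith)]
      simp [abs_of_nonneg this]; left; ring
    · rw [indicator_of_notMem hb]; simp
  have hGint : Integrable G (volume.prod volume) := by
    rw [integrable_prod_iff' hGm.aestronglyMeasurable]
    refine ⟨ae_of_all _ hsInt, ?_⟩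
    simp_rw [hnval]
    exact ((integrable_indicator_iff measurableSet_Ioo).2 hint).norm
  refine ⟨(integrable_indicator_iff hDm).1 hGint, ?_⟩
  rw [← integral_indicator hDm, ← integral_indicator measurableSet_Ioo, Measure.volume_eq_prod,
    integral_prod_symm _ hGint]
  exact integral_congr_ae (ae_of_all _ hval)

lemma integral_affine_mul_cpow {s : ℂ} (hs : 1 < s.re) {β : ℝ} (hβ : 0 ≤ β) (w k : ℝ) :
    IntegrableOn (fun b : ℝ => (2 * ((w - k * b : ℝ) : ℂ)) * (b : ℂ) ^ (s - 2)) (Ioo 0 β) ∧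
    ∫ b in Ioo 0 β, (2 * ((w - k * b : ℝ) : ℂ)) * (b : ℂ) ^ (s - 2) =
      2 * w * (β : ℂ) ^ (s - 1) / (s - 1) - 2 * k * (β : ℂ) ^ s / s := by
  have h1 : -1 < (s - 2).re := by simp; linarith
  have h2 : -1 < (s - 1).re := by simp; linarith
  have i1 : IntegrableOn (fun b : ℝ => (b : ℂ) ^ (s - 2)) (Ioo 0 β) :=
    ((intervalIntegrable_iff_integrableOn_Ioc_of_le hβ).1
      (intervalIntegral.intervalIntegrable_cpow' h1)).mono_set Ioo_subset_Ioc_self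
  have i2 : IntegrableOn (fun b : ℝ => (b : ℂ) ^ (s - 1)) (Ioo 0 β) :=
    ((intervalIntegrable_iff_integrableOn_Ioc_of_le hβ).1
      (intervalIntegral.intervalIntegrable_cpow' h2)).mono_set Ioo_subset_Ioc_self
  have e1 : ∫ b : ℝ in Ioo 0 β, (b : ℂ) ^ (s - 2) = (β : ℂ) ^ (s - 1) / (s - 1) := by
    rw [← integral_Ioc_eq_integral_Ioo, ← intervalIntegral.integral_of_le hβ,
      integral_cpow (Or.inl h1), show s - 2 + 1 = s - 1 by ring, ofReal_zero, zero_cpow, sub_zero]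
    intro h
    have := congrArg re h
    simp at this; linarith
  have e2 : ∫ b : ℝ in Ioo 0 β, (b : ℂ) ^ (s - 1) = (β : ℂ) ^ s / s := by
    rw [← integral_Ioc_eq_integral_Ioo, ← intervalIntegral.integral_of_le hβ,
      integral_cpow (Or.inl h2), show s - 1 + 1 = s by ring, ofReal_zero, zero_cpow, sub_zero]
    intro h
    have := congrArg re h
    simp at this; linarith
  have hcongr : EqOn (fun b : ℝ => (2 * ((w - k * b : ℝ) : ℂ)) * (b : ℂ) ^ (s - 2))
      (fun b : ℝ => 2 * w * (b : ℂ) ^ (s - 2) - 2 * k * (b : ℂ) ^ (s - 1)) (Ioo 0 β) := by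
    intro b hb
    have hb0 : (b : ℂ) ≠ 0 := by exact_mod_cast hb.1.ne'
    have : (b : ℂ) ^ (s - 1) = b * (b : ℂ) ^ (s - 2) := by
      rw [show s - 1 = 1 + (s - 2) by ring, cpow_add _ _ hb0, cpow_one]
    simp only [this]
    push_cast; ring
  have j1 : IntegrableOn (fun b : ℝ => 2 * w * (b : ℂ) ^ (s - 2)) (Ioo 0 β) := i1.const_mul _
  have j2 : IntegrableOn (fun b : ℝ => 2 * k * (b : ℂ) ^ (s - 1)) (Ioo 0 β) := i2.const_mul _
  refine ⟨(integrableOn_congr_fun hcongr measurableSet_Ioo).2 (j1.sub j2), ?_⟩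
  rw [setIntegral_congr_fun measurableSet_Ioo hcongr, integral_sub j1 j2, integral_const_mul,
    integral_const_mul, e1, e2]
  ring

lemma integral_pieces {ι : Type*} [Fintype ι] {f : E2 → ℂ} {S : Set E2} {P : ι → Set E2}
    (hm : ∀ i, MeasurableSet (P i)) (hd : Pairwise (Function.onFun Disjoint P))
    (hsub : ∀ i, P i ⊆ S) (hnull : volume (S \ ⋃ i, P i) = 0) :
    (IntegrableOn f S ↔ ∀ i, IntegrableOn f (P i)) ∧
    ((∀ i, IntegrableOn f (P i)) → ∫ x in S, f x = ∑ i, ∫ x in P i, f x) := by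
  have hae : S =ᵐ[volume] ⋃ i, P i :=
    ae_eq_set.2 ⟨hnull, by rw [sdiff_eq_empty.2 (iUnion_subset hsub)]; simp⟩
  refine ⟨by rw [integrableOn_congr_set_ae hae, integrableOn_finite_iUnion], fun hint => ?_⟩
  rw [setIntegral_congr_set hae, integral_iUnion_fintype hm hd hint]

/-- The functional `gl i` as a linear map. -/
def glLin (i : Fin 3) : E2 →ₗ[ℝ] ℝ where
  toFun := gl i
  map_add' := gl_add i
  map_smul' c x := gl_smul i c x

lemma volume_linear_eq {l : E2 →ₗ[ℝ] ℝ} (hl : ∃ x, l x ≠ 0) (c : ℝ) :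
    volume {x | l x = c} = 0 := by
  rcases Set.eq_empty_or_nonempty {x | l x = c} with h | ⟨p, hp⟩
  · rw [h]; simp
  · have : {x | l x = c} = (AffineSubspace.mk' p (LinearMap.ker l) : Set E2) := by
      ext x
      have hp : l p = c := hp
      simp [AffineSubspace.mem_mk', sub_eq_zero, hp]
    rw [this]
    apply Measure.addHaar_affineSubspace
    intro htop
    obtain ⟨x, hx⟩ := hl
    have h1 : x + p ∈ AffineSubspace.mk' p (LinearMap.ker l) := by rw [htop]; trivial
    rw [AffineSubspace.mem_mk'] at h1
    simp at h1
    exact hx h1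

lemma volume_gl_eq (i : Fin 3) (c : ℝ) : volume {x | gl i x = c} = 0 := by
  refine volume_linear_eq (l := glLin i) ⟨nrm i, ?_⟩ c
  change gl i (nrm i) ≠ 0
  rw [gl_nrm_self]
  have := sqrt_three_pos
  positivity

lemma volume_gl_sub_eq {i j : Fin 3} (hij : i ≠ j) (c : ℝ) :
    volume {x | gl i x - gl j x = c} = 0 := by
  refine volume_linear_eq (l := glLin i - glLin j) ⟨nrm i, ?_⟩ c
  change gl i (nrm i) - gl j (nrm i) ≠ 0
  rw [gl_nrm_self, gl_nrm_ne hij.symm]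
  have := sqrt_three_pos
  rw [sub_neg_eq_add]
  positivity

/-- The lines along which the pieces of the plane meet. -/
def seams : Set E2 := (⋃ i, {x | far i x = 1 / 2}) ∪ (⋃ i, {x | far i x = 1}) ∪
  (⋃ i, ⋃ j, ⋃ (_ : i ≠ j), {x | far i x = far j x ∨ far i x = far j x + 1 ∨ gl i x = gl j x})

lemma volume_seams : volume seams = 0 := by
  refine measure_union_null (measure_union_null ?_ ?_) ?_
  · refine measure_iUnion_null fun i => ?_
    convert volume_gl_eq i (1 / 2 - ![0, 1, 1] i) using 3
    ext x; simp [far, eq_sub_iff_add_eq]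
  · refine measure_iUnion_null fun i => ?_
    convert volume_gl_eq i (1 - ![0, 1, 1] i) using 3
    ext x; simp [far, eq_sub_iff_add_eq]
  · refine measure_iUnion_null fun i => measure_iUnion_null fun j => measure_iUnion_null fun h => ?_
    refine measure_mono_null (t := {x | gl i x - gl j x = ![(0 : ℝ), 1, 1] j - ![(0 : ℝ), 1, 1] i} ∪
      ({x | gl i x - gl j x = ![(0 : ℝ), 1, 1] j - ![(0 : ℝ), 1, 1] i + 1} ∪
      {x | gl i x - gl j x = 0})) ?_
      (measure_union_null (volume_gl_sub_eq h _)
        (measure_union_null (volume_gl_sub_eq h _) (volume_gl_sub_eq h _)))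
    rintro x (hx | hx | hx)
    · left; simp only [far, mem_ofPred_eq] at *; linarith
    · right; left; simp only [far, mem_ofPred_eq] at *; linarith
    · right; right; simp only [mem_ofPred_eq] at *; linarith

lemma notMem_seams {x : E2} (hx : x ∉ seams) : (∀ i, far i x ≠ 1 / 2) ∧ (∀ i, far i x ≠ 1) ∧
    ∀ i j, i ≠ j → far i x ≠ far j x ∧ far i x ≠ far j x + 1 ∧ gl i x ≠ gl j x := by
  simpa [seams, and_assoc] using hx

lemma far_edgeCoord_self (o : E2) (i : Fin 3) (p : ℝ × ℝ) :
    far i (edgeCoord o i p) = far i o + 2 * (p.2 / Real.sqrt 3) := by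
  rw [edgeCoord, far_add, gl_add, gl_smul, gl_smul, gl_tng_self, gl_nrm_self]; ring

lemma forall_ne_edgeCoord (o : E2) (i : Fin 3) (p : ℝ × ℝ) (Q : ℝ → Prop) {m : ℝ}
    (ho : ∀ j, j ≠ i → far j o = m) :
    (∀ j, j ≠ i → Q (far j (edgeCoord o i p))) ↔
      Q (m + p.1 - p.2 / Real.sqrt 3) ∧ Q (m - p.1 - p.2 / Real.sqrt 3) := by
  have h1 : i + 1 ≠ i := by fin_cases i <;> decide
  have h2 : i + 2 ≠ i := by fin_cases i <;> decide
  have hsplit : (∀ j, j ≠ i → Q (far j (edgeCoord o i p))) ↔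
      Q (far (i + 1) (edgeCoord o i p)) ∧ Q (far (i + 2) (edgeCoord o i p)) := by
    refine ⟨fun h => ⟨h _ h1, h _ h2⟩, fun h j hj => ?_⟩
    have : j = i + 1 ∨ j = i + 2 := by
      revert hj; fin_cases i <;> fin_cases j <;> simp
    rcases this with rfl | rfl
    · exact h.1
    · exact h.2
  rw [hsplit]
  simp only [edgeCoord, far_add, gl_add, gl_smul, gl_nrm_ne h1, gl_nrm_ne h2, ho _ h1, ho _ h2]
  rcases gl_tng i with ⟨e1, e2⟩ | ⟨e1, e2⟩
  · rw [e1, e2]; ring_nf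
  · rw [e1, e2, and_comm]; ring_nf

lemma integral_edge_piece {A P : Set E2} {s : ℂ} (hs : 1 < s.re) {β w k : ℝ} (hβ : 0 ≤ β)
    (hw : ∀ b ∈ Ioo 0 β, 0 ≤ w - k * b) {o : E2} {i : Fin 3}
    (hP : ∀ p, edgeCoord o i p ∈ P ↔ p.2 ∈ Ioo 0 β ∧ |p.1| < w - k * p.2)
    (hd : ∀ p, edgeCoord o i p ∈ P → infDist (edgeCoord o i p) A = p.2) :
    IntegrableOn (fun x => (infDist x A : ℂ) ^ (s - 2)) P ∧
    ∫ x in P, (infDist x A : ℂ) ^ (s - 2) =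
      2 * w * (β : ℂ) ^ (s - 1) / (s - 1) - 2 * k * (β : ℂ) ^ s / s := by
  have h1 := integral_affine_mul_cpow hs hβ w k
  have h2 := integral_subgraph (h := fun b => (b : ℂ) ^ (s - 2)) (by fun_prop)
    (w := fun b => w - k * b) (by fun_prop) hw h1.1
  have hmp := measurePreserving_edgeCoord o i
  have hme := measurableEmbedding_edgeCoord o i
  have hpre : edgeCoord o i ⁻¹' P = {p | p.2 ∈ Ioo 0 β ∧ |p.1| < w - k * p.2} := by
    ext p; exact hP p
  have hm : MeasurableSet {p : ℝ × ℝ | p.2 ∈ Ioo 0 β ∧ |p.1| < w - k * p.2} :=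
    (measurable_snd measurableSet_Ioo).inter
      (measurableSet_lt measurable_fst.abs (by fun_prop))
  have heq : EqOn (fun p : ℝ × ℝ => (p.2 : ℂ) ^ (s - 2))
      ((fun x => (infDist x A : ℂ) ^ (s - 2)) ∘ edgeCoord o i)
      {p | p.2 ∈ Ioo 0 β ∧ |p.1| < w - k * p.2} := by
    intro p hp
    simp only [Function.comp_apply]
    rw [hd p ((hP p).2 hp)]
  constructor
  · rw [← hmp.integrableOn_comp_preimage hme, hpre, ← integrableOn_congr_fun heq hm]
    exact h2.1
  · rw [← hmp.setIntegral_preimage_emb hme, hpre, ← h1.2, ← h2.2]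
    exact setIntegral_congr_fun hm heq.symm

/-- The part of the central removed triangle which is closest to the edge of index `i`. -/
def middle (i : Fin 3) : Set E2 := {x | 1 / 2 < far i x ∧ ∀ j, j ≠ i → far i x < far j x}

/-- The rectangle of width `δ` erected outside on the edge of index `i`. -/
def strip (δ : ℝ) (i : Fin 3) : Set E2 :=
  {x | 1 < far i x ∧ Real.sqrt 3 * ((far i x - 1) / 2) < δ ∧
    ∀ j, j ≠ i → far j x + (far i x - 1) / 2 < 1}

/-- The normal cone of the triangle at the vertex of index `i`, translated to the origin. -/
def cone (i : Fin 3) : Set E2 := {x | ∀ j, j ≠ i → gl i x < gl j x}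

lemma isOpen_middle (i : Fin 3) : IsOpen (middle i) := by
  simp only [middle, ofPred_and, ofPred_forall]
  exact (isOpen_lt continuous_const (continuous_far i)).inter
    (isOpen_iInter_of_finite fun j => isOpen_iInter_of_finite fun _ =>
      isOpen_lt (continuous_far i) (continuous_far j))

lemma isOpen_strip (δ : ℝ) (i : Fin 3) : IsOpen (strip δ i) := by
  simp only [strip, ofPred_and, ofPred_forall]
  have hc := continuous_far
  exact (isOpen_lt continuous_const (hc i)).inter
    ((isOpen_lt (continuous_const.mul (((hc i).sub continuous_const).div_const 2))
      continuous_const).inter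
    (isOpen_iInter_of_finite fun j => isOpen_iInter_of_finite fun _ =>
      isOpen_lt ((hc j).add (((hc i).sub continuous_const).div_const 2)) continuous_const))

lemma isOpen_cone (i : Fin 3) : IsOpen (cone i) := by
  simp only [cone, ofPred_forall]
  exact isOpen_iInter_of_finite fun j => isOpen_iInter_of_finite fun _ =>
      isOpen_lt (continuous_gl i) (continuous_gl j)

lemma far_edge_midpoint (i : Fin 3) :
    far i (half (vert (i + 1)) (vert (i + 2))) = 1 ∧
      ∀ j, j ≠ i → far j (half (vert (i + 1)) (vert (i + 2))) = 1 / 2 := by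
  constructor
  · rw [far_half, far_vert_ne, far_vert_ne] <;> fin_cases i <;> simp
  · intro j hj
    have : (j = i + 1 ∧ j ≠ i + 2) ∨ (j = i + 2 ∧ j ≠ i + 1) := by
      revert hj; fin_cases i <;> fin_cases j <;> simp
    rcases this with ⟨rfl, h⟩ | ⟨rfl, h⟩
    · rw [far_half_self, far_vert_ne h]
    · rw [far_half_ne h, far_vert_self]; norm_num

namespace IsGasket

variable {A : Set E2}

lemma integral_middle (hA : IsGasket A) (i : Fin 3) {s : ℂ} (hs : 1 < s.re) :
    IntegrableOn (fun x => (infDist x A : ℂ) ^ (s - 2)) (middle i) ∧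
    ∫ x in middle i, (infDist x A : ℂ) ^ (s - 2) =
      2 * ((1 / 4 : ℝ) : ℂ) * ((1 / (4 * Real.sqrt 3) : ℝ) : ℂ) ^ (s - 1) / (s - 1) -
        2 * (Real.sqrt 3 : ℂ) * ((1 / (4 * Real.sqrt 3) : ℝ) : ℂ) ^ s / s := by
  have hpos := sqrt_three_pos
  have hsq := sqrt_three_sq
  set o := half (vert i) (half (vert (i + 1)) (vert (i + 2))) with ho
  have hoi : far i o = 1 / 2 := by rw [ho, far_half_self, (far_edge_midpoint i).1]
  have hoj : ∀ j, j ≠ i → far j o = 3 / 4 := by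
    intro j hj
    rw [ho, far_half_ne hj, (far_edge_midpoint i).2 j hj]; norm_num
  have hmul : ∀ b : ℝ, Real.sqrt 3 * b = 3 * (b / Real.sqrt 3) := by
    intro b; field_simp; rw [sq, hsq, mul_comm]
  have hlt : ∀ b : ℝ, b < 1 / (4 * Real.sqrt 3) ↔ b / Real.sqrt 3 < 1 / 12 := by
    intro b
    have : 1 / (4 * Real.sqrt 3) = 1 / 12 * Real.sqrt 3 := by
      field_simp; rw [sq, hsq]; norm_num
    rw [this, div_lt_iff₀ hpos]
  refine integral_edge_piece (o := o) (i := i) hs (by positivity) ?_ ?_ ?_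
  · intro b hb
    rw [hmul]
    linarith [(hlt b).1 hb.2]
  · intro p
    rw [middle, mem_ofPred_eq, forall_ne_edgeCoord o i p _ hoj, far_edgeCoord_self, hoi, mem_Ioo,
      hlt, hmul, abs_lt]
    have : 0 < p.2 ↔ 0 < p.2 / Real.sqrt 3 := by simp [hpos]
    rw [this]
    constructor
    · rintro ⟨h1, h2, h3⟩
      refine ⟨⟨?_, ?_⟩, ?_, ?_⟩ <;> linarith
    · rintro ⟨⟨h1, h2⟩, h3, h4⟩
      refine ⟨?_, ?_, ?_⟩ <;> linarith
  · intro p hp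
    rw [hA.infDist_middle hp.1.le fun j => ?_, far_edgeCoord_self, hoi]
    · field_simp; ring
    · rcases eq_or_ne j i with rfl | hj
      · exact le_rfl
      · exact (hp.2 j hj).le

lemma integral_strip (hA : IsGasket A) {δ : ℝ} (hδ : 0 < δ) (i : Fin 3) {s : ℂ} (hs : 1 < s.re) :
    IntegrableOn (fun x => (infDist x A : ℂ) ^ (s - 2)) (strip δ i) ∧
    ∫ x in strip δ i, (infDist x A : ℂ) ^ (s - 2) = (δ : ℂ) ^ (s - 1) / (s - 1) := by
  have hpos := sqrt_three_pos
  set o := half (vert (i + 1)) (vert (i + 2)) with ho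
  obtain ⟨hoi, hoj⟩ := far_edge_midpoint i
  rw [← ho] at hoi hoj
  have key := integral_edge_piece (A := A) (P := strip δ i) (o := o) (i := i) (s := s) hs
    (β := δ) (w := 1 / 2) (k := 0) hδ.le (by intros; norm_num) ?_ ?_
  · refine ⟨key.1, key.2.trans ?_⟩
    push_cast; ring
  · intro p
    rw [strip, mem_ofPred_eq, far_edgeCoord_self,
      forall_ne_edgeCoord o i p (fun t => t + (far i o + 2 * (p.2 / Real.sqrt 3) - 1) / 2 < 1) hoj,
      hoi, mem_Ioo, abs_lt]
    have h1 : 0 < p.2 ↔ 0 < p.2 / Real.sqrt 3 := by simp [hpos]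
    have h2 : Real.sqrt 3 * ((1 + 2 * (p.2 / Real.sqrt 3) - 1) / 2) = p.2 := by field_simp; ring
    rw [h1, h2]
    constructor
    · rintro ⟨h1, h2, h3, h4⟩
      refine ⟨⟨?_, ?_⟩, ?_, ?_⟩ <;> linarith
    · rintro ⟨⟨h1, h2⟩, h3, h4⟩
      refine ⟨?_, ?_, ?_, ?_⟩ <;> linarith
  · intro p hp
    rw [hA.infDist_strip hp.1.le fun j hj => (hp.2.2 j hj).le, far_edgeCoord_self, hoi]
    field_simp; ring

end IsGasket

/-- The interior of the triangle spanned by the vertices. -/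
def triOpen : Set E2 := {x | ∀ i, far i x < 1}

lemma isOpen_triOpen : IsOpen triOpen := by
  simp only [triOpen, ofPred_forall]
  exact isOpen_iInter_of_finite fun i => isOpen_lt (continuous_far i) continuous_const

lemma triOpen_subset_tri : triOpen ⊆ tri := fun _ hx i => (hx i).le

lemma continuous_half (v : E2) : Continuous (half v) := by
  unfold half; fun_prop

lemma injective_half (v : E2) : Function.Injective (half v) := by
  intro x y h
  rw [← dist_eq_zero] at h ⊢
  rw [dist_half] at h; linarith

lemma half_image_triOpen (i : Fin 3) :
    half (vert i) '' triOpen = {x | x ∈ triOpen ∧ far i x < 1 / 2} := by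
  ext x
  constructor
  · rintro ⟨y, hy, rfl⟩
    refine ⟨fun j => ?_, ?_⟩
    · have := hy j
      rcases eq_or_ne j i with rfl | hj
      · rw [far_half_self]; linarith
      · rw [far_half_ne hj]; linarith
    · rw [far_half_self]; linarith [hy i]
  · rintro ⟨hx, hi⟩
    refine ⟨(2 : ℝ) • x - vert i, fun k => ?_, half_double _ _⟩
    have := far_half i k ((2 : ℝ) • x - vert i)
    rw [half_double] at this
    rcases eq_or_ne k i with rfl | hk
    · rw [far_vert_self] at this; linarith
    · rw [far_vert_ne hk] at this; linarith [hx k]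

lemma measurableSet_half_image (v : E2) {U : Set E2} (hU : MeasurableSet U) :
    MeasurableSet (half v '' U) :=
  hU.image_of_continuousOn_injOn (continuous_half v).continuousOn (injective_half v).injOn

lemma hasFDerivWithinAt_half (v : E2) (U : Set E2) (x : E2) :
    HasFDerivWithinAt (half v) ((2 : ℝ)⁻¹ • ContinuousLinearMap.id ℝ E2) U x :=
  (((hasFDerivAt_id x).add_const v).const_smul (2 : ℝ)⁻¹).hasFDerivWithinAt

lemma abs_det_half : |((2 : ℝ)⁻¹ • ContinuousLinearMap.id ℝ E2).det| = 1 / 4 := by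
  have : ((2 : ℝ)⁻¹ • ContinuousLinearMap.id ℝ E2).det =
      LinearMap.det ((2 : ℝ)⁻¹ • (LinearMap.id : E2 →ₗ[ℝ] E2)) := rfl
  rw [this, LinearMap.det_smul, LinearMap.det_id]
  simp; norm_num

lemma volume_half_image (v : E2) {U : Set E2} (hU : MeasurableSet U) :
    volume (half v '' U) = ENNReal.ofReal (1 / 4) * volume U := by
  rw [← lintegral_abs_det_fderiv_eq_addHaar_image volume hU
    (fun x _ => hasFDerivWithinAt_half v U x) (injective_half v).injOn, abs_det_half,
    setLIntegral_const]

lemma lintegral_half_image (v : E2) {U : Set E2} (hU : MeasurableSet U) (F : E2 → ℝ≥0∞) :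
    ∫⁻ x in half v '' U, F x = ENNReal.ofReal (1 / 4) * ∫⁻ x in U, F (half v x) := by
  rw [lintegral_image_eq_lintegral_abs_det_fderiv_mul volume hU
    (fun x _ => hasFDerivWithinAt_half v U x) (injective_half v).injOn, abs_det_half,
    lintegral_const_mul' _ _ ENNReal.ofReal_ne_top]

lemma integral_half_image (v : E2) {U : Set E2} (hU : MeasurableSet U) (F : E2 → ℂ) :
    ∫ x in half v '' U, F x = (1 / 4 : ℂ) * ∫ x in U, F (half v x) := by
  rw [integral_image_eq_integral_abs_det_fderiv_smul volume hU
    (fun x _ => hasFDerivWithinAt_half v U x) (injective_half v).injOn, abs_det_half,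
    integral_smul, real_smul]
  push_cast; rfl

/-- The three half-size copies of the open triangle together with the three parts of the
central removed triangle. -/
def triPiece : Fin 3 ⊕ Fin 3 → Set E2 := Sum.elim (fun i => half (vert i) '' triOpen) middle

lemma middle_half_lt {x : E2} {i : Fin 3} (hx : x ∈ middle i) (j : Fin 3) : 1 / 2 < far j x := by
  rcases eq_or_ne j i with rfl | hj
  · exact hx.1
  · exact hx.1.trans (hx.2 j hj)

lemma middle_subset_triOpen (i : Fin 3) : middle i ⊆ triOpen := by
  intro x hx j
  have h := middle_half_lt hx
  have h0 := h 0
  have h1 := h 1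
  have h2 := h 2
  have := far_sum x
  fin_cases j <;> simp <;> linarith

lemma disjoint_triPiece : Pairwise (Function.onFun Disjoint triPiece) := by
  have hsm : ∀ i j, Disjoint (half (vert i) '' triOpen) (middle j) := by
    intro i j
    rw [half_image_triOpen, Set.disjoint_left]
    rintro x ⟨-, hx⟩ hx'
    linarith [middle_half_lt hx' i]
  rintro (i | i) (j | j) hij
  · change Disjoint (half (vert i) '' triOpen) (half (vert j) '' triOpen)
    rw [half_image_triOpen, half_image_triOpen, Set.disjoint_left]
    rintro x ⟨hx, hi⟩ ⟨-, hj⟩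
    have h0 := hx 0
    have h1 := hx 1
    have h2 := hx 2
    have := far_sum x
    have hij : i ≠ j := fun h => hij (by rw [h])
    fin_cases i <;> fin_cases j <;> first | exact hij rfl | (simp at hi hj; linarith)
  · exact hsm i j
  · exact (hsm j i).symm
  · change Disjoint (middle i) (middle j)
    rw [Set.disjoint_left]
    have hij : i ≠ j := fun h => hij (by rw [h])
    intro x hi hj
    exact lt_asymm (hi.2 j hij.symm) (hj.2 i hij)

lemma measurableSet_triPiece (k : Fin 3 ⊕ Fin 3) : MeasurableSet (triPiece k) := by
  rcases k with i | i
  · exact measurableSet_half_image _ isOpen_triOpen.measurableSet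
  · exact (isOpen_middle i).measurableSet

lemma triPiece_subset (k : Fin 3 ⊕ Fin 3) : triPiece k ⊆ triOpen := by
  rcases k with i | i
  · change half (vert i) '' triOpen ⊆ _
    rw [half_image_triOpen]
    exact fun x hx => hx.1
  · exact middle_subset_triOpen i

lemma triOpen_subset_seams_union : triOpen ⊆ seams ∪ ⋃ k, triPiece k := by
  intro x hx
  by_cases hs : x ∈ seams
  · exact Or.inl hs
  right
  rw [mem_iUnion]
  obtain ⟨h1, -, h2⟩ := notMem_seams hs
  by_cases h : ∃ i, far i x < 1 / 2
  · obtain ⟨i, hi⟩ := h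
    refine ⟨Sum.inl i, ?_⟩
    change x ∈ half (vert i) '' triOpen
    rw [half_image_triOpen]
    exact ⟨hx, hi⟩
  · push Not at h
    obtain ⟨i, hi⟩ := Finite.exists_min (fun i => far i x)
    refine ⟨Sum.inr i, lt_of_le_of_ne (h i) (h1 i).symm, fun j hj => ?_⟩
    exact lt_of_le_of_ne (hi j) (h2 i j hj.symm).1

namespace IsGasket

variable {A : Set E2}

lemma volume_eq_zero (hA : IsGasket A) : volume A = 0 := by
  have hm := hA.isCompact.isClosed.measurableSet
  have hfin : volume A ≠ ∞ := hA.isCompact.measure_lt_top.ne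
  have hsub : A ⊆ ⋃ i, half (vert i) '' A := by
    intro x hx
    obtain ⟨i, y, hy, h⟩ := (hA.mem_iff x).1 hx
    exact mem_iUnion.2 ⟨i, y, hy, h⟩
  have h := (measure_mono hsub).trans (measure_iUnion_le (μ := volume) _)
  simp_rw [volume_half_image _ hm] at h
  rw [tsum_fintype, Fin.sum_univ_three] at h
  have h2 := ENNReal.toReal_mono (by finiteness) h
  rw [ENNReal.toReal_add (by finiteness) (by finiteness),
    ENNReal.toReal_add (by finiteness) (by finiteness), ENNReal.toReal_mul,
    ENNReal.toReal_ofReal (by norm_num)] at h2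
  have h3 : (volume A).toReal = 0 :=
    le_antisymm (by linarith) ENNReal.toReal_nonneg
  exact (ENNReal.toReal_eq_zero_iff _).1 h3 |>.resolve_right hfin

lemma cpow_infDist_half (hA : IsGasket A) (i : Fin 3) {x : E2} (hx : x ∈ tri) (z : ℂ) :
    (infDist (half (vert i) x) A : ℂ) ^ z = (2 : ℂ) ^ (-z) * (infDist x A : ℂ) ^ z := by
  rw [hA.infDist_half i hx, div_eq_inv_mul, ofReal_mul,
    mul_cpow_ofReal_nonneg (by norm_num) infDist_nonneg]
  congr 1
  push_cast
  have harg : arg (2 : ℂ) ≠ Real.pi := by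
    rw [show (2 : ℂ) = ((2 : ℝ) : ℂ) by norm_num, arg_ofReal_of_nonneg zero_le_two]
    exact Real.pi_pos.ne
  rw [inv_cpow _ _ harg, cpow_neg]

lemma lintegral_trunc_le (hA : IsGasket A) {s : ℂ} {ε : ℝ} (hε : 0 < ε) :
    ∫⁻ x in triOpen ∩ {x | ε < infDist x A}, ‖(infDist x A : ℂ) ^ (s - 2)‖ₑ ≤
      ENNReal.ofReal (3 * (2 : ℝ) ^ (-s.re)) *
        (∫⁻ x in triOpen ∩ {x | ε < infDist x A}, ‖(infDist x A : ℂ) ^ (s - 2)‖ₑ) +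
      ∑ i, ∫⁻ x in middle i, ‖(infDist x A : ℂ) ^ (s - 2)‖ₑ := by
  set F : E2 → ℝ≥0∞ := fun x => ‖(infDist x A : ℂ) ^ (s - 2)‖ₑ with hF
  set T : ℝ → Set E2 := fun ε => triOpen ∩ {x | ε < infDist x A} with hT
  have hTm : ∀ ε, MeasurableSet (T ε) := fun ε =>
    (isOpen_triOpen.inter (isOpen_lt continuous_const (continuous_infDist_pt A))).measurableSet
  have hsub : T ε ⊆ seams ∪ ((⋃ i, half (vert i) '' T (2 * ε)) ∪ ⋃ i, middle i) := by
    rintro x ⟨hx, hxε⟩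
    rcases triOpen_subset_seams_union hx with h | h
    · exact Or.inl h
    · right
      obtain ⟨k | k, hk⟩ := mem_iUnion.1 h
      · obtain ⟨y, hy, rfl⟩ := hk
        refine Or.inl (mem_iUnion.2 ⟨k, y, ⟨hy, ?_⟩, rfl⟩)
        have hxε : ε < infDist (half (vert k) y) A := hxε
        rw [hA.infDist_half k (triOpen_subset_tri hy)] at hxε
        change 2 * ε < infDist y A
        linarith
      · exact Or.inr (mem_iUnion.2 ⟨k, hk⟩)
  have hhalf : ∀ i, ∫⁻ x in half (vert i) '' T (2 * ε), F x ≤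
      ENNReal.ofReal ((2 : ℝ) ^ (-s.re)) * ∫⁻ x in T ε, F x := by
    intro i
    rw [lintegral_half_image _ (hTm _)]
    have : ∫⁻ x in T (2 * ε), F (half (vert i) x) =
        ∫⁻ x in T (2 * ε), ‖(2 : ℂ) ^ (-(s - 2))‖ₑ * F x := by
      refine setLIntegral_congr_fun (hTm _) fun x hx => ?_
      simp only [hF]
      rw [hA.cpow_infDist_half i (triOpen_subset_tri hx.1), enorm_mul]
    rw [this, lintegral_const_mul' _ _ (by finiteness), ← mul_assoc]
    have hc : ENNReal.ofReal (1 / 4) * ‖(2 : ℂ) ^ (-(s - 2))‖ₑ = ENNReal.ofReal ((2 : ℝ) ^ (-s.re)) := by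
      rw [← ofReal_norm, show (2 : ℂ) = ((2 : ℝ) : ℂ) by norm_num,
        norm_cpow_eq_rpow_re_of_pos (by norm_num), ← ENNReal.ofReal_mul (by norm_num)]
      congr 1
      have : (-(s - ((2 : ℝ) : ℂ))).re = -s.re + 2 := by simp; ring
      rw [this, Real.rpow_add (by norm_num)]
      norm_num; ring
    rw [hc]
    gcongr
    intro x hx
    have h2 : 2 * ε < infDist x A := hx.2
    exact ⟨hx.1, show ε < infDist x A by linarith⟩
  calc ∫⁻ x in T ε, F x
      ≤ ∫⁻ x in seams ∪ ((⋃ i, half (vert i) '' T (2 * ε)) ∪ ⋃ i, middle i), F x :=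
        lintegral_mono_set hsub
    _ ≤ (∫⁻ x in seams, F x) + ((∑ i, ∫⁻ x in half (vert i) '' T (2 * ε), F x) +
          ∑ i, ∫⁻ x in middle i, F x) := by
        refine (lintegral_union_le _ _ _).trans (add_le_add le_rfl ?_)
        refine (lintegral_union_le _ _ _).trans (add_le_add ?_ ?_)
        · exact (lintegral_iUnion_le _ _).trans_eq (tsum_fintype _)
        · exact (lintegral_iUnion_le _ _).trans_eq (tsum_fintype _)
    _ = (∑ i, ∫⁻ x in half (vert i) '' T (2 * ε), F x) + ∑ i, ∫⁻ x in middle i, F x := by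
        rw [setLIntegral_measure_zero _ _ volume_seams, zero_add]
    _ ≤ (∑ _i : Fin 3, ENNReal.ofReal ((2 : ℝ) ^ (-s.re)) * ∫⁻ x in T ε, F x) +
          ∑ i, ∫⁻ x in middle i, F x := by
        gcongr with i; exact hhalf i
    _ = _ := by
        rw [Finset.sum_const, Finset.card_univ, Fintype.card_fin, nsmul_eq_mul,
          ENNReal.ofReal_mul (by norm_num)]
        simp [mul_assoc]
        rfl

lemma three_mul_rpow_lt_one {σ : ℝ} (hσ : Real.log 3 / Real.log 2 < σ) :
    3 * (2 : ℝ) ^ (-σ) < 1 := by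
  have h2 : 0 < Real.log 2 := Real.log_pos (by norm_num)
  rw [div_lt_iff₀ h2] at hσ
  rw [Real.rpow_neg (by norm_num), ← div_eq_mul_inv, div_lt_one (by positivity)]
  rw [← Real.log_lt_log_iff (by norm_num) (by positivity), Real.log_rpow (by norm_num)]
  exact hσ

lemma one_lt_of_log_div_lt {σ : ℝ} (hσ : Real.log 3 / Real.log 2 < σ) : 1 < σ := by
  refine lt_trans ?_ hσ
  rw [one_lt_div (Real.log_pos (by norm_num))]
  exact Real.log_lt_log (by norm_num) (by norm_num)

lemma continuousOn_cpow_infDist (A : Set E2) (z : ℂ) :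
    ContinuousOn (fun x => (infDist x A : ℂ) ^ z) {x | 0 < infDist x A} := by
  refine ContinuousOn.cpow_const ?_ fun x hx => ?_
  · exact (continuous_ofReal.comp (continuous_infDist_pt A)).continuousOn
  · exact Or.inl (by simpa using hx)

lemma measurable_cpow_infDist (A : Set E2) (z : ℂ) :
    Measurable (fun x => (infDist x A : ℂ) ^ z) :=
  ((measurable_ofReal.comp (continuous_infDist_pt A).measurable)).pow_const z

lemma integrableOn_triOpen (hA : IsGasket A) {s : ℂ} (hs : Real.log 3 / Real.log 2 < s.re) :
    IntegrableOn (fun x => (infDist x A : ℂ) ^ (s - 2)) triOpen := by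
  have hs1 := one_lt_of_log_div_lt hs
  have hq := three_mul_rpow_lt_one hs
  set J : ℝ≥0∞ := ∑ i, ∫⁻ x in middle i, ‖(infDist x A : ℂ) ^ (s - 2)‖ₑ with hJ
  have hJfin : J ≠ ∞ := by
    rw [hJ]
    exact ENNReal.sum_ne_top.2 fun i _ => (hA.integral_middle i hs1).1.2.ne
  set q := 3 * (2 : ℝ) ^ (-s.re) with hqdef
  have hq0 : 0 ≤ q := by positivity
  have hbound : ∀ ε > 0, ∫⁻ x in triOpen ∩ {x | ε < infDist x A},
      ‖(infDist x A : ℂ) ^ (s - 2)‖ₑ ≤ ENNReal.ofReal (J.toReal / (1 - q)) := by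
    intro ε hε
    have h := hA.lintegral_trunc_le (s := s) hε
    rw [← hJ, ← hqdef] at h
    set Λ := ∫⁻ x in triOpen ∩ {x | ε < infDist x A}, ‖(infDist x A : ℂ) ^ (s - 2)‖ₑ with hΛ
    have hfin : Λ ≠ ∞ := by
      have hK : IsCompact (tri ∩ {x | ε ≤ infDist x A}) :=
        isCompact_tri.inter_right (isClosed_le continuous_const (continuous_infDist_pt A))
      have hi : IntegrableOn (fun x => (infDist x A : ℂ) ^ (s - 2))
          (tri ∩ {x | ε ≤ infDist x A}) :=
        ((continuousOn_cpow_infDist A (s - 2)).mono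
          fun x hx => lt_of_lt_of_le hε hx.2).integrableOn_compact hK
      have hi' := hi.mono_set (s := triOpen ∩ {x | ε < infDist x A})
        fun x hx => ⟨triOpen_subset_tri hx.1, show ε ≤ infDist x A from le_of_lt hx.2⟩
      exact hi'.2.ne
    have h2 := ENNReal.toReal_mono (by finiteness) h
    rw [ENNReal.toReal_add (by finiteness) hJfin, ENNReal.toReal_mul,
      ENNReal.toReal_ofReal hq0] at h2
    rw [← ENNReal.ofReal_toReal hfin]
    apply ENNReal.ofReal_le_ofReal
    rw [le_div_iff₀ (by linarith)]
    linarith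
  refine ⟨(measurable_cpow_infDist A _).aestronglyMeasurable, ?_⟩
  have hcover : triOpen ⊆ A ∪ ⋃ n : ℕ, triOpen ∩ {x | 1 / ((n : ℝ) + 1) < infDist x A} := by
    intro x hx
    by_cases hxA : x ∈ A
    · exact Or.inl hxA
    · right
      have : 0 < infDist x A :=
        (hA.isCompact.isClosed.notMem_iff_infDist_pos hA.nonempty).1 hxA
      obtain ⟨n, hn⟩ := exists_nat_one_div_lt this
      exact mem_iUnion.2 ⟨n, hx, hn⟩
  have hdir : Directed (· ⊆ ·)
      fun n : ℕ => triOpen ∩ {x | 1 / ((n : ℝ) + 1) < infDist x A} := by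
    apply Monotone.directed_le
    intro m n hmn x hx
    refine ⟨hx.1, show 1 / ((n : ℝ) + 1) < infDist x A from lt_of_le_of_lt ?_ hx.2⟩
    exact Nat.one_div_le_one_div hmn
  calc ∫⁻ x in triOpen, ‖(infDist x A : ℂ) ^ (s - 2)‖ₑ
      ≤ ∫⁻ x in A ∪ ⋃ n : ℕ, triOpen ∩ {x | 1 / ((n : ℝ) + 1) < infDist x A},
          ‖(infDist x A : ℂ) ^ (s - 2)‖ₑ := lintegral_mono_set hcover
    _ ≤ (∫⁻ x in A, ‖(infDist x A : ℂ) ^ (s - 2)‖ₑ) +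
          ∫⁻ x in ⋃ n : ℕ, triOpen ∩ {x | 1 / ((n : ℝ) + 1) < infDist x A},
            ‖(infDist x A : ℂ) ^ (s - 2)‖ₑ := lintegral_union_le _ _ _
    _ = ⨆ n : ℕ, ∫⁻ x in triOpen ∩ {x | 1 / ((n : ℝ) + 1) < infDist x A},
            ‖(infDist x A : ℂ) ^ (s - 2)‖ₑ := by
        rw [setLIntegral_measure_zero _ _ hA.volume_eq_zero, zero_add,
          setLIntegral_iUnion_of_directed _ hdir]
    _ ≤ ENNReal.ofReal (J.toReal / (1 - q)) := iSup_le fun n => hbound _ (by positivity)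
    _ < ∞ := ENNReal.ofReal_lt_top

lemma integral_triOpen_eq (hA : IsGasket A) {s : ℂ} (hs : Real.log 3 / Real.log 2 < s.re) :
    ∫ x in triOpen, (infDist x A : ℂ) ^ (s - 2) =
      3 * (2 : ℂ) ^ (-s) * (∫ x in triOpen, (infDist x A : ℂ) ^ (s - 2)) +
      3 * (2 * ((1 / 4 : ℝ) : ℂ) * ((1 / (4 * Real.sqrt 3) : ℝ) : ℂ) ^ (s - 1) / (s - 1) -
        2 * (Real.sqrt 3 : ℂ) * ((1 / (4 * Real.sqrt 3) : ℝ) : ℂ) ^ s / s) := by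
  have hs1 := one_lt_of_log_div_lt hs
  have hint := hA.integrableOn_triOpen hs
  have hnull : volume (triOpen \ ⋃ k, triPiece k) = 0 :=
    measure_mono_null (sdiff_subset_iff.2 (by rw [union_comm]; exact triOpen_subset_seams_union))
      volume_seams
  have key := (integral_pieces (f := fun x => (infDist x A : ℂ) ^ (s - 2)) measurableSet_triPiece
    disjoint_triPiece triPiece_subset hnull).2 fun k => hint.mono_set (triPiece_subset k)
  rw [Fintype.sum_sum_type] at key
  have hmid : ∀ i, ∫ x in triPiece (Sum.inr i), (infDist x A : ℂ) ^ (s - 2) = _ :=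
    fun i => (hA.integral_middle i hs1).2
  have hsmall : ∀ i, ∫ x in triPiece (Sum.inl i), (infDist x A : ℂ) ^ (s - 2) =
      (2 : ℂ) ^ (-s) * ∫ x in triOpen, (infDist x A : ℂ) ^ (s - 2) := by
    intro i
    change ∫ x in half (vert i) '' triOpen, (infDist x A : ℂ) ^ (s - 2) = _
    rw [integral_half_image _ isOpen_triOpen.measurableSet,
      setIntegral_congr_fun isOpen_triOpen.measurableSet fun x hx =>
        hA.cpow_infDist_half i (triOpen_subset_tri hx) (s - 2), integral_const_mul, ← mul_assoc]
    congr 1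
    rw [show -(s - 2) = -s + 2 by ring, cpow_add _ _ (by norm_num)]
    norm_num
    ring
  simp only [hmid, hsmall] at key
  refine key.trans ?_
  simp only [Finset.sum_const, Finset.card_univ, Fintype.card_fin, nsmul_eq_mul]
  push_cast; ring

end IsGasket

lemma integral_ball_cpow_norm {s : ℂ} (hs : 1 < s.re) {δ : ℝ} (hδ : 0 < δ) :
    IntegrableOn (fun x : E2 => (‖x‖ : ℂ) ^ (s - 2)) (ball 0 δ) ∧
    ∫ x in ball (0 : E2) δ, (‖x‖ : ℂ) ^ (s - 2) = 2 * (Real.pi : ℂ) * (δ : ℂ) ^ s / s := by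
  obtain ⟨hi, he⟩ := integral_affine_mul_cpow hs hδ.le 0 (-(1 / 2))
  have hfun : ∀ b : ℝ, (2 * ((0 - -(1 / 2) * b : ℝ) : ℂ)) * (b : ℂ) ^ (s - 2) =
      b ^ (Module.finrank ℝ E2 - 1) • (b : ℂ) ^ (s - 2) := by
    intro b
    rw [finrank_euclideanSpace_fin, real_smul]
    push_cast; ring
  simp only [hfun] at hi he
  refine ⟨(integrableOn_fun_norm_addHaar volume (f := fun b : ℝ => (b : ℂ) ^ (s - 2))).2 hi, ?_⟩
  have hind : ∀ x : E2, (ball (0 : E2) δ).indicator (fun x => (‖x‖ : ℂ) ^ (s - 2)) x =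
      (Iio δ).indicator (fun b : ℝ => (b : ℂ) ^ (s - 2)) ‖x‖ := by
    intro x
    simp [indicator]
  rw [← integral_indicator measurableSet_ball, integral_congr_ae (.of_forall hind),
    integral_fun_norm_addHaar volume]
  have hIoo : ∫ y in Ioi (0 : ℝ), y ^ (Module.finrank ℝ E2 - 1) •
      (Iio δ).indicator (fun b : ℝ => (b : ℂ) ^ (s - 2)) y =
      ∫ b in Ioo 0 δ, b ^ (Module.finrank ℝ E2 - 1) • (b : ℂ) ^ (s - 2) := by
    rw [← Ioi_inter_Iio, ← setIntegral_indicator measurableSet_Iio]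
    congr 1
    ext y
    by_cases hy : y < δ <;> simp [hy]
  rw [hIoo, he, finrank_euclideanSpace_fin, Measure.real, EuclideanSpace.volume_ball_fin_two]
  simp [ENNReal.toReal_ofReal Real.pi_pos.le]
  ring

lemma disjoint_cone {i j : Fin 3} (hij : i ≠ j) : Disjoint (cone i) (cone j) := by
  rw [Set.disjoint_left]
  exact fun x hi hj => lt_asymm (hi j hij.symm) (hj i hij)

lemma exists_mem_cone {x : E2} (hx : x ∉ seams) : ∃ i, x ∈ cone i := by
  obtain ⟨i, hi⟩ := Finite.exists_min (fun i => gl i x)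
  exact ⟨i, fun j hj => lt_of_le_of_ne (hi j) ((notMem_seams hx).2.2 i j hj.symm).2.2⟩

/-- The points of the normal cone at the `i`-th vertex within distance `δ` of that vertex. -/
def sector (δ : ℝ) (i : Fin 3) : Set E2 := (fun x => x - vert i) ⁻¹' (ball 0 δ ∩ cone i)

lemma isOpen_sector (δ : ℝ) (i : Fin 3) : IsOpen (sector δ i) :=
  (isOpen_ball.inter (isOpen_cone i)).preimage (by fun_prop)

lemma mem_cone_sub_vert {x : E2} {i : Fin 3} :
    x - vert i ∈ cone i ↔ ∀ j, j ≠ i → far i x + 1 < far j x := by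
  refine forall₂_congr fun j hj => ?_
  rw [← far_sub_far, ← far_sub_far, far_vert_self, far_vert_ne hj]
  constructor <;> intro h <;> linarith

/-- The pieces of the `δ`-neighborhood of the gasket: the open triangle, the strips along its
edges and the sectors at its vertices. -/
def nbhdPiece (δ : ℝ) : Unit ⊕ Fin 3 ⊕ Fin 3 → Set E2 :=
  Sum.elim (fun _ => triOpen) (Sum.elim (strip δ) (sector δ))

lemma isOpen_nbhdPiece (δ : ℝ) : ∀ k, IsOpen (nbhdPiece δ k)
  | .inl _ => isOpen_triOpen
  | .inr (.inl i) => isOpen_strip δ i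
  | .inr (.inr i) => isOpen_sector δ i

lemma strip_far_lt {δ : ℝ} {x : E2} {i j : Fin 3} (hx : x ∈ strip δ i) (hj : j ≠ i) :
    far j x < 1 := by
  linarith [hx.1, hx.2.2 j hj]

lemma sector_far {δ : ℝ} {x : E2} {i j : Fin 3} (hx : x ∈ sector δ i) (hj : j ≠ i) :
    far i x + 1 < far j x :=
  mem_cone_sub_vert.1 hx.2 j hj

lemma sector_far_self {δ : ℝ} {x : E2} {i : Fin 3} (hx : x ∈ sector δ i) : far i x < 0 := by
  have h := fun j => sector_far hx (j := j)
  have := far_sum x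
  fin_cases i
  · have h1 := h 1 (by decide); have h2 := h 2 (by decide); simp at *; linarith
  · have h1 := h 0 (by decide); have h2 := h 2 (by decide); simp at *; linarith
  · have h1 := h 0 (by decide); have h2 := h 1 (by decide); simp at *; linarith

lemma disjoint_triOpen_strip (δ : ℝ) (i : Fin 3) : Disjoint triOpen (strip δ i) := by
  rw [Set.disjoint_left]
  exact fun x hx hx' => lt_asymm (hx i) hx'.1

lemma exists_one_lt_far_of_sector {δ : ℝ} {x : E2} {i : Fin 3} (hx : x ∈ sector δ i) :
    ∃ j, 1 < far j x := by
  have h := fun j => sector_far hx (j := j)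
  have h0 := sector_far_self hx
  have hs := far_sum x
  by_contra! hcon
  fin_cases i
  · have h1 := hcon 1
    have h2 := hcon 2
    simp at *; linarith
  · have h1 := hcon 0
    have h2 := hcon 2
    simp at *; linarith
  · have h1 := hcon 0
    have h2 := hcon 1
    simp at *; linarith

lemma disjoint_triOpen_sector (δ : ℝ) (i : Fin 3) : Disjoint triOpen (sector δ i) := by
  rw [Set.disjoint_left]
  intro x hx hx'
  obtain ⟨j, hj⟩ := exists_one_lt_far_of_sector hx'
  exact lt_asymm (hx j) hj

lemma exists_far_add_eq_two {i j : Fin 3} (hij : i ≠ j) (x : E2) :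
    ∃ k, k ≠ i ∧ k ≠ j ∧ far i x + far j x + far k x = 2 := by
  have hs := far_sum x
  obtain ⟨k, hki, hkj⟩ : ∃ k, k ≠ i ∧ k ≠ j := by
    revert i j; decide
  refine ⟨k, hki, hkj, ?_⟩
  fin_cases i <;> fin_cases j <;> fin_cases k <;> first | contradiction | (simp; linarith)

lemma disjoint_strip_sector (δ : ℝ) (i j : Fin 3) : Disjoint (strip δ i) (sector δ j) := by
  rw [Set.disjoint_left]
  intro x hx hx'
  have h0 := sector_far_self hx'
  have hij : i ≠ j := by
    rintro rfl
    linarith [hx.1]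
  obtain ⟨k, hki, hkj, hsum⟩ := exists_far_add_eq_two hij x
  have h1 := sector_far hx' hij
  linarith [hx.2.2 k hki, sector_far hx' hkj]

lemma disjoint_nbhdPiece (δ : ℝ) : Pairwise (Function.onFun Disjoint (nbhdPiece δ)) := by
  rintro (i | i | i) (j | j | j) hij
  · exact absurd rfl hij
  · exact disjoint_triOpen_strip δ j
  · exact disjoint_triOpen_sector δ j
  · exact (disjoint_triOpen_strip δ i).symm
  · change Disjoint (strip δ i) (strip δ j)
    rw [Set.disjoint_left]
    intro x hi hj
    have hij : i ≠ j := fun h => hij (by rw [h])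
    exact lt_asymm hj.1 (strip_far_lt hi hij.symm)
  · exact disjoint_strip_sector δ i j
  · exact (disjoint_triOpen_sector δ i).symm
  · exact (disjoint_strip_sector δ j i).symm
  · have hij : i ≠ j := fun h => hij (by rw [h])
    rw [Function.onFun, Set.disjoint_left]
    intro x hi hj
    exact lt_asymm ((sector_far hi hij.symm).trans' (lt_add_one _))
      ((sector_far hj hij).trans' (lt_add_one _))

namespace IsGasket

variable {A : Set E2}

lemma infDist_sector (hA : IsGasket A) {δ : ℝ} {i : Fin 3} {x : E2} (hx : x ∈ sector δ i) :
    infDist x A = ‖x - vert i‖ :=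
  hA.infDist_cone fun j hj => (hx.2 j hj).le

lemma nbhdPiece_subset (hA : IsGasket A) {δ : ℝ} (hδ : 1 / (4 * Real.sqrt 3) < δ) :
    ∀ k, nbhdPiece δ k ⊆ nbhd2 A δ
  | .inl _ => fun _ hx => (hA.infDist_tri_le (triOpen_subset_tri hx)).trans_lt hδ
  | .inr (.inl _) => fun _ hx =>
      (hA.infDist_strip hx.1.le fun j hj => (hx.2.2 j hj).le).trans_lt hx.2.1
  | .inr (.inr _) => fun _ hx => (hA.infDist_sector hx).trans_lt (mem_ball_zero_iff.1 hx.1)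

lemma nbhd2_subset (hA : IsGasket A) (δ : ℝ) : nbhd2 A δ ⊆ seams ∪ ⋃ k, nbhdPiece δ k := by
  intro x hx
  by_cases hs : x ∈ seams
  · exact Or.inl hs
  right
  obtain ⟨-, h1, h2⟩ := notMem_seams hs
  have hx : infDist x A < δ := hx
  rw [mem_iUnion]
  by_cases hc : ∃ i, ∀ j, j ≠ i → far i x + 1 < far j x
  · obtain ⟨i, hi⟩ := hc
    have hcone : x - vert i ∈ cone i := mem_cone_sub_vert.2 hi
    refine ⟨.inr (.inr i), ?_, hcone⟩
    rwa [mem_ball_zero_iff, ← hA.infDist_cone fun j hj => (hcone j hj).le]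
  · by_cases ht : x ∈ triOpen
    · exact ⟨.inl (), ht⟩
    · simp only [triOpen, mem_ofPred_eq, not_forall, not_lt] at ht
      obtain ⟨i, hi⟩ := ht
      have hi : 1 < far i x := lt_of_le_of_ne hi (h1 i).symm
      have hstrip : ∀ j, j ≠ i → far j x + (far i x - 1) / 2 < 1 := by
        intro j hj
        by_contra! hcon
        obtain ⟨k, hki, hkj, hsum⟩ := exists_far_add_eq_two hj.symm x
        have hjk : far k x + 1 < far j x :=
          lt_of_le_of_ne (by linarith) (h2 j k hkj.symm).2.1.symm
        refine hc ⟨k, fun l hl => ?_⟩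
        have : l = i ∨ l = j := by
          clear * - hj hki hkj hl
          revert hj hki hkj hl; revert i j k l; decide
        rcases this with rfl | rfl
        · linarith
        · exact hjk
      refine ⟨.inr (.inl i), hi, ?_, hstrip⟩
      rwa [← hA.infDist_strip hi.le fun j hj => (hstrip j hj).le]

lemma integral_sector_sum (hA : IsGasket A) {δ : ℝ} (hδ : 0 < δ) {s : ℂ} (hs : 1 < s.re) :
    (∀ i, IntegrableOn (fun x => (infDist x A : ℂ) ^ (s - 2)) (sector δ i)) ∧
    ∑ i, ∫ x in sector δ i, (infDist x A : ℂ) ^ (s - 2) =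
      2 * (Real.pi : ℂ) * (δ : ℂ) ^ s / s := by
  obtain ⟨hi, he⟩ := integral_ball_cpow_norm hs hδ
  set P : Fin 3 → Set E2 := fun i => ball 0 δ ∩ cone i with hP
  have hPm : ∀ i, MeasurableSet (P i) := fun i =>
    (isOpen_ball.inter (isOpen_cone i)).measurableSet
  have hnull : volume (ball (0 : E2) δ \ ⋃ i, P i) = 0 := by
    refine measure_mono_null (fun x hx => ?_) volume_seams
    by_contra hs
    obtain ⟨i, hi⟩ := exists_mem_cone hs
    exact hx.2 (mem_iUnion.2 ⟨i, hx.1, hi⟩)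
  have key := integral_pieces (f := fun x => (‖x‖ : ℂ) ^ (s - 2)) hPm
    (fun i j hij => (disjoint_cone hij).mono inter_subset_right inter_subset_right)
    (fun i => inter_subset_left) hnull
  have hPi := key.1.1 hi
  have hmp : ∀ i, MeasurePreserving (fun x : E2 => x - vert i) volume volume := fun i =>
    measurePreserving_sub_right volume _
  have hme : ∀ i, MeasurableEmbedding (fun x : E2 => x - vert i) := fun i =>
    (MeasurableEquiv.subRight (vert i)).measurableEmbedding
  have hcongr : ∀ i, EqOn (fun x => (infDist x A : ℂ) ^ (s - 2))
      (fun x => (‖x - vert i‖ : ℂ) ^ (s - 2)) (sector δ i) := by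
    intro i x hx
    simp only [hA.infDist_sector hx]
  refine ⟨fun i => ?_, ?_⟩
  · rw [integrableOn_congr_fun (hcongr i) (isOpen_sector δ i).measurableSet]
    exact ((hmp i).integrableOn_comp_preimage (hme i)).2 (hPi i)
  · rw [← he, key.2 hPi]
    refine Finset.sum_congr rfl fun i _ => ?_
    rw [setIntegral_congr_fun (isOpen_sector δ i).measurableSet (hcongr i)]
    exact (hmp i).setIntegral_preimage_emb (hme i) (fun x => (‖x‖ : ℂ) ^ (s - 2)) _

lemma integral_triOpen (hA : IsGasket A) {s : ℂ} (hs : Real.log 3 / Real.log 2 < s.re) :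
    ∫ x in triOpen, (infDist x A : ℂ) ^ (s - 2) =
      6 * ((Real.sqrt 3 : ℝ) : ℂ) ^ (1 - s) * (2 : ℂ) ^ (-s) /
        (s * (s - 1) * ((2 : ℂ) ^ s - 3)) := by
  have h := hA.integral_triOpen_eq hs
  have hre := one_lt_of_log_div_lt hs
  have hs0 : s ≠ 0 := by
    rintro rfl
    simp at hre; linarith
  have hs1 : s - 1 ≠ 0 := by
    intro h
    have := congrArg re h
    simp at this; linarith
  have h3 : (2 : ℂ) ^ s - 3 ≠ 0 := by
    intro h
    have h4 : ‖(2 : ℂ) ^ s‖ = 3 := by rw [sub_eq_zero.1 h]; simp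
    rw [show (2 : ℂ) = ((2 : ℝ) : ℂ) by norm_num,
      norm_cpow_eq_rpow_re_of_pos (by norm_num)] at h4
    have := three_mul_rpow_lt_one hs
    rw [Real.rpow_neg (by norm_num), h4] at this
    norm_num at this
  have hq : ((Real.sqrt 3 : ℝ) : ℂ) ≠ 0 := by exact_mod_cast sqrt_three_pos.ne'
  have hr : ((1 / (4 * Real.sqrt 3) : ℝ) : ℂ) ≠ 0 := by
    have := sqrt_three_pos
    have : 1 / (4 * Real.sqrt 3) ≠ 0 := by positivity
    exact_mod_cast this
  have hT : (2 : ℂ) ^ s ≠ 0 := by simp [cpow_eq_zero_iff]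
  have hu : ((Real.sqrt 3 : ℝ) : ℂ) ^ s ≠ 0 := by
    rw [Ne, cpow_eq_zero_iff]; exact fun h => hq h.1
  have hR : ((1 / (4 * Real.sqrt 3) : ℝ) : ℂ) ^ s =
      1 / ((2 : ℂ) ^ s * (2 : ℂ) ^ s * ((Real.sqrt 3 : ℝ) : ℂ) ^ s) := by
    have hmul : (((1 / (4 * Real.sqrt 3) : ℝ) : ℂ) ^ s) * (((2 : ℝ) : ℂ) ^ s * ((2 : ℝ) : ℂ) ^ s *
        ((Real.sqrt 3 : ℝ) : ℂ) ^ s) = 1 := by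
      rw [← mul_cpow_ofReal_nonneg (by norm_num) (by norm_num), ← ofReal_mul,
        ← mul_cpow_ofReal_nonneg (by norm_num) (by positivity), ← ofReal_mul,
        ← mul_cpow_ofReal_nonneg (by positivity) (by positivity), ← ofReal_mul]
      have : 1 / (4 * Real.sqrt 3) * (2 * 2 * Real.sqrt 3) = 1 := by
        have := sqrt_three_pos
        field_simp; norm_num
      rw [this]; simp
    rw [eq_div_iff (by positivity)]
    exact_mod_cast hmul
  rw [cpow_sub _ _ hr, cpow_one, hR, cpow_neg] at h
  rw [cpow_sub _ _ hq, cpow_one, cpow_neg]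
  set I := ∫ x in triOpen, (infDist x A : ℂ) ^ (s - 2)
  set T := (2 : ℂ) ^ s
  set u := ((Real.sqrt 3 : ℝ) : ℂ) ^ s
  push_cast at h
  set q := ((Real.sqrt 3 : ℝ) : ℂ)
  rw [eq_div_iff (mul_ne_zero (mul_ne_zero hs0 hs1) h3)]
  have h' : I * (T - 3) = 6 * q / (T * u * s * (s - 1)) := by
    have e : I * (T - 3) = T * (I - 3 * T⁻¹ * I) := by field_simp
    rw [e]
    nth_rewrite 1 [h]
    field_simp
    ring
  calc I * (s * (s - 1) * (T - 3)) = (I * (T - 3)) * (s * (s - 1)) := by ring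
    _ = _ := by rw [h']; field_simp

lemma integral_nbhd2 (hA : IsGasket A) {δ : ℝ} (hδ : 1 / (4 * Real.sqrt 3) < δ) {s : ℂ}
    (hs : Real.log 3 / Real.log 2 < s.re) :
    ∫ x in nbhd2 A δ, (infDist x A : ℂ) ^ (s - 2) =
      6 * ((Real.sqrt 3 : ℝ) : ℂ) ^ (1 - s) * (2 : ℂ) ^ (-s) / (s * (s - 1) * ((2 : ℂ) ^ s - 3)) +
        2 * (Real.pi : ℂ) * (δ : ℂ) ^ s / s + 3 * (δ : ℂ) ^ (s - 1) / (s - 1) := by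
  have hδ0 : 0 < δ := lt_trans (by have := sqrt_three_pos; positivity) hδ
  have hs1 := one_lt_of_log_div_lt hs
  obtain ⟨hsec, hsecsum⟩ := hA.integral_sector_sum hδ0 hs1
  have hnull : volume (nbhd2 A δ \ ⋃ k, nbhdPiece δ k) = 0 :=
    measure_mono_null (sdiff_subset_iff.2 (by rw [union_comm]; exact hA.nbhd2_subset δ))
      volume_seams
  have hint : ∀ k, IntegrableOn (fun x => (infDist x A : ℂ) ^ (s - 2)) (nbhdPiece δ k)
    | .inl _ => hA.integrableOn_triOpen hs
    | .inr (.inl i) => (hA.integral_strip hδ0 i hs1).1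
    | .inr (.inr i) => hsec i
  rw [(integral_pieces (fun k => (isOpen_nbhdPiece δ k).measurableSet) (disjoint_nbhdPiece δ)
    (hA.nbhdPiece_subset hδ) hnull).2 hint, Fintype.sum_sum_type, Fintype.sum_sum_type]
  have e1 : ∑ k : Unit, ∫ x in nbhdPiece δ (.inl k), (infDist x A : ℂ) ^ (s - 2) = _ :=
    (Fintype.sum_unique _).trans (hA.integral_triOpen hs)
  have e2 : ∑ i, ∫ x in nbhdPiece δ (.inr (.inl i)), (infDist x A : ℂ) ^ (s - 2) = _ :=
    Finset.sum_congr rfl fun i _ => (hA.integral_strip hδ0 i hs1).2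
  have e3 : ∑ i, ∫ x in nbhdPiece δ (.inr (.inr i)), (infDist x A : ℂ) ^ (s - 2) = _ := hsecsum
  rw [e1, e2, e3, Finset.sum_const, Finset.card_univ, Fintype.card_fin, nsmul_eq_mul]
  push_cast; ring

end IsGasket

/-- Let `A ⊂ ℝ²` be the Sierpiński gasket, i.e., the attractor of the IFS
`f_i(x) = (x + v_i)/2`, `i = 1,2,3`, with `v₁ = (0,0)`, `v₂ = (1,0)`, `v₃ = (1/2, √3/2)`,
and let `δ > 1/(4√3)`.  Then for every `s ∈ ℂ` with `Re s > log 3/log 2`,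
`∫_{A_δ} dist(x,A)^{s−2} dx
  = 6·(√3)^{1−s}·2^{−s}/(s(s−1)(2^s−3)) + 2π·δ^s/s + 3·δ^{s−1}/(s−1)`. -/
theorem statement9
    (A : Set (EuclideanSpace ℝ (Fin 2)))
    (hAcompact : IsCompact A) (hAne : A.Nonempty)
    (hAattractor : A
      = (fun x => (2 : ℝ)⁻¹ • (x + pt 0 0)) '' A
        ∪ (fun x => (2 : ℝ)⁻¹ • (x + pt 1 0)) '' A
        ∪ (fun x => (2 : ℝ)⁻¹ • (x + pt (1 / 2) (Real.sqrt 3 / 2))) '' A)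
    (δ : ℝ) (hδ : 1 / (4 * Real.sqrt 3) < δ) :
    ∀ s : ℂ, Real.log 3 / Real.log 2 < s.re →
      ∫ x in nbhd2 A δ, (Metric.infDist x A : ℂ) ^ (s - 2)
        = 6 * ((Real.sqrt 3 : ℝ) : ℂ) ^ (1 - s) * (2 : ℂ) ^ (-s)
            / (s * (s - 1) * ((2 : ℂ) ^ s - 3))
          + 2 * (Real.pi : ℂ) * (δ : ℂ) ^ s / s
          + 3 * (δ : ℂ) ^ (s - 1) / (s - 1) := by
  have hA : IsGasket A := by
    refine ⟨hAcompact, hAne, fun x => ?_⟩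
    constructor
    · intro hx
      rw [hAattractor] at hx
      rcases hx with (⟨y, hy, h⟩ | ⟨y, hy, h⟩) | ⟨y, hy, h⟩
      · exact ⟨0, y, hy, h⟩
      · exact ⟨1, y, hy, h⟩
      · exact ⟨2, y, hy, h⟩
    · rintro ⟨i, y, hy, h⟩
      rw [hAattractor]
      fin_cases i
      · exact Or.inl (Or.inl ⟨y, hy, h⟩)
      · exact Or.inl (Or.inr ⟨y, hy, h⟩)
      · exact Or.inr ⟨y, hy, h⟩
  exact fun s hs => hA.integral_nbhd2 hδ hs

end
end

section
/- Fix a > 0 and for j ≥ 1 set ℓ_j := j^{−a} − (j+1)^{−a}. Let A_a ⊂ ℝ² be the union over j ≥ 1 of the circles {x ∈ ℝ² : |x| = j^{−a}}, and let Ω := {x ∈ ℝ² : |x| < 1} be the open unit disk. Then for every s ∈ ℂ with Re s > max{1, 2/(a+1)}, the series Σ_{j≥1} j^{−a} ℓ_j^{s−1} and Σ_{j≥1} ℓ_j^{s} converge absolutely and ∫_Ω dist(x,A_a)^{s−2} dx = (2^{3−s}π/(s−1))·Σ_{j≥1} j^{−a} ℓ_j^{s−1} − (2^{2−s}π/(s−1))·Σ_{j≥1}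 ℓ_j^{s}. -/
open MeasureTheory Filter Complex Set Metric Topology
open scoped ENNReal

noncomputable section

lemma infDist_iUnion_sphere_zero {E ι : Type*} [NormedAddCommGroup E] [NormedSpace ℝ E]
    [Nontrivial E] [Nonempty ι] {r : ι → ℝ} (hr : ∀ i, 0 ≤ r i) (x : E) :
    infDist x (⋃ i, sphere (0 : E) (r i)) = infDist ‖x‖ (range r) := by
  obtain ⟨u, hu, hx⟩ : ∃ u : E, ‖u‖ = 1 ∧ x = ‖x‖ • u := by
    rcases eq_or_ne x 0 with rfl | hx
    · obtain ⟨u, hu⟩ := exists_norm_eq E zero_le_one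
      exact ⟨u, hu, by simp⟩
    · have hx' : ‖x‖ ≠ 0 := norm_ne_zero_iff.2 hx
      exact ⟨‖x‖⁻¹ • x, by rw [norm_smul, norm_inv, norm_norm, inv_mul_cancel₀ hx'],
        (smul_inv_smul₀ hx' x).symm⟩
  have hmem (i : ι) : r i • u ∈ ⋃ i, sphere (0 : E) (r i) :=
    mem_iUnion.2 ⟨i, by simp [norm_smul, hu, abs_of_nonneg (hr i)]⟩
  apply le_antisymm
  · rw [le_infDist (range_nonempty r)]
    rintro _ ⟨i, rfl⟩
    refine (infDist_le_dist_of_mem (hmem i)).trans_eq ?_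
    conv_lhs => rw [hx]
    rw [dist_eq_norm, ← sub_smul, norm_smul, hu, mul_one, Real.dist_eq, Real.norm_eq_abs]
  · rw [le_infDist ⟨_, hmem (Classical.arbitrary ι)⟩]
    intro y hy
    obtain ⟨i, hi⟩ := mem_iUnion.1 hy
    rw [mem_sphere_zero_iff_norm] at hi
    refine (infDist_le_dist_of_mem (mem_range_self i)).trans ?_
    rw [← hi, dist_eq_norm x y]
    exact abs_norm_sub_norm_le x y

lemma infDist_range_of_antitone {r : ℕ → ℝ} (hr : Antitone r) {n : ℕ} {t : ℝ}
    (h₁ : r (n + 1) ≤ t) (h₂ : t ≤ r n) :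
    infDist t (range r) = min (r n - t) (t - r (n + 1)) := by
  apply le_antisymm
  · apply le_min
    · refine (infDist_le_dist_of_mem (mem_range_self n)).trans_eq ?_
      rw [Real.dist_eq, abs_sub_comm, abs_of_nonneg (sub_nonneg.2 h₂)]
    · refine (infDist_le_dist_of_mem (mem_range_self (n + 1))).trans_eq ?_
      rw [Real.dist_eq, abs_of_nonneg (sub_nonneg.2 h₁)]
  · rw [le_infDist (range_nonempty r)]
    rintro _ ⟨k, rfl⟩
    rw [Real.dist_eq]
    rcases le_or_gt k n with hk | hk
    · refine (min_le_left _ _).trans ?_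
      rw [abs_sub_comm]
      exact (sub_le_sub_right (hr hk) t).trans (le_abs_self _)
    · exact (min_le_right _ _).trans
        ((sub_le_sub_left (hr (Nat.succ_le_of_lt hk)) t).trans (le_abs_self _))

lemma intervalIntegrable_mul_cpow_min {p q : ℝ} (hpq : p ≤ q) {s : ℂ} (hs : 1 < s.re) :
    IntervalIntegrable (fun t : ℝ => (t : ℂ) * ((min (q - t) (t - p) : ℝ) : ℂ) ^ (s - 2))
        volume p q ∧
      ∫ t in p..q, (t : ℂ) * ((min (q - t) (t - p) : ℝ) : ℂ) ^ (s - 2)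
        = ((p + q : ℝ) : ℂ) * (((q - p) / 2 : ℝ) : ℂ) ^ (s - 1) / (s - 1) := by
  have hre : -1 < (s - 2).re := by simp; linarith
  have hs1 : s - 1 ≠ 0 := fun h => by
    have := congrArg Complex.re h
    simp at this
    linarith
  set m := (p + q) / 2 with hm
  have hc (c d : ℝ) : IntervalIntegrable (fun u : ℝ => (u : ℂ) ^ (s - 2)) volume c d :=
    intervalIntegral.intervalIntegrable_cpow' hre
  have hL : EqOn (fun t : ℝ => (t : ℂ) * ((t - p : ℝ) : ℂ) ^ (s - 2))
      (fun t : ℝ => (t : ℂ) * ((min (q - t) (t - p) : ℝ) : ℂ) ^ (s - 2)) (uIcc p m) := by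
    intro t ht
    rw [uIcc_of_le (by linarith)] at ht
    simp only
    rw [min_eq_right (by linarith [ht.2])]
  have hR : EqOn (fun t : ℝ => (t : ℂ) * ((q - t : ℝ) : ℂ) ^ (s - 2))
      (fun t : ℝ => (t : ℂ) * ((min (q - t) (t - p) : ℝ) : ℂ) ^ (s - 2)) (uIcc m q) := by
    intro t ht
    rw [uIcc_of_le (by linarith)] at ht
    simp only
    rw [min_eq_left (by linarith [ht.1])]
  have hiL : IntervalIntegrable (fun t : ℝ => (t : ℂ) * ((t - p : ℝ) : ℂ) ^ (s - 2))
      volume p m := by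
    refine IntervalIntegrable.continuousOn_mul ?_ (by fun_prop)
    simpa using (hc (p - p) (m - p)).comp_sub_right p
  have hiR : IntervalIntegrable (fun t : ℝ => (t : ℂ) * ((q - t : ℝ) : ℂ) ^ (s - 2))
      volume m q := by
    refine IntervalIntegrable.continuousOn_mul ?_ (by fun_prop)
    simpa using (hc (q - m) (q - q)).comp_sub_left q
  have hiL' := hiL.congr (hL.mono uIoc_subset_uIcc)
  have hiR' := hiR.congr (hR.mono uIoc_subset_uIcc)
  refine ⟨hiL'.trans hiR', ?_⟩
  rw [← intervalIntegral.integral_add_adjacent_intervals hiL' hiR',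
    ← intervalIntegral.integral_congr hL, ← intervalIntegral.integral_congr hR]
  have eL : ∫ t in p..m, (t : ℂ) * ((t - p : ℝ) : ℂ) ^ (s - 2)
      = ∫ u in (0 : ℝ)..(q - p) / 2, ((u + p : ℝ) : ℂ) * (u : ℂ) ^ (s - 2) := by
    have := intervalIntegral.integral_comp_sub_right (a := p) (b := m)
      (fun u : ℝ => ((u + p : ℝ) : ℂ) * (u : ℂ) ^ (s - 2)) p
    rw [sub_self, show m - p = (q - p) / 2 by rw [hm]; ring] at this
    rw [← this]
    simp only [sub_add_cancel]
  have eR : ∫ t in m..q, (t : ℂ) * ((q - t : ℝ) : ℂ) ^ (s - 2)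
      = ∫ u in (0 : ℝ)..(q - p) / 2, ((q - u : ℝ) : ℂ) * (u : ℂ) ^ (s - 2) := by
    have := intervalIntegral.integral_comp_sub_left (a := m) (b := q)
      (fun u : ℝ => ((q - u : ℝ) : ℂ) * (u : ℂ) ^ (s - 2)) q
    rw [sub_self, show q - m = (q - p) / 2 by rw [hm]; ring] at this
    rw [← this]
    simp only [sub_sub_cancel]
  rw [eL, eR, ← intervalIntegral.integral_add
    ((hc _ _).continuousOn_mul (by fun_prop)) ((hc _ _).continuousOn_mul (by fun_prop))]
  have : ∀ u : ℝ, ((u + p : ℝ) : ℂ) * (u : ℂ) ^ (s - 2) + ((q - u : ℝ) : ℂ) * (u : ℂ) ^ (s - 2)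
      = ((p + q : ℝ) : ℂ) * (u : ℂ) ^ (s - 2) := fun u => by push_cast; ring
  simp only [this]
  rw [intervalIntegral.integral_const_mul, integral_cpow (Or.inl hre),
    show s - 2 + 1 = s - 1 by ring, ofReal_zero, zero_cpow hs1, sub_zero, mul_div_assoc]

lemma rpow_neg_sub_rpow_neg_le {a x : ℝ} (ha : 0 < a) (hx : 0 < x) :
    x ^ (-a) - (x + 1) ^ (-a) ≤ a * x ^ (-a - 1) := by
  have hd : ∀ y ∈ Icc x (x + 1), HasDerivAt (fun y : ℝ => y ^ (-a)) (-a * y ^ (-a - 1)) y :=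
    fun y hy => Real.hasDerivAt_rpow_const (Or.inl (hx.trans_le hy.1).ne')
  obtain ⟨c, hc, h⟩ := exists_hasDerivAt_eq_slope (fun y : ℝ => y ^ (-a))
    (fun y => -a * y ^ (-a - 1)) (lt_add_one x)
    (fun y hy => (hd y hy).continuousAt.continuousWithinAt)
    (fun y hy => hd y (Ioo_subset_Icc_self hy))
  have hle : c ^ (-a - 1) ≤ x ^ (-a - 1) :=
    Real.rpow_le_rpow_of_nonpos hx hc.1.le (by linarith)
  rw [add_sub_cancel_left, div_one] at h
  nlinarith

lemma iUnion_Ioc_succ_eq {r : ℕ → ℝ} (hr : Antitone r) (h0 : ∀ n, 0 ≤ r n)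
    (hlim : Tendsto r atTop (𝓝 0)) : ⋃ n, Ioc (r (n + 1)) (r n) = Ioc 0 (r 0) := by
  ext t
  simp only [mem_iUnion, mem_Ioc]
  constructor
  · rintro ⟨n, h₁, h₂⟩
    exact ⟨(h0 _).trans_lt h₁, h₂.trans (hr n.zero_le)⟩
  · rintro ⟨h₁, h₂⟩
    have hex : ∃ n, r n < t := (hlim.eventually_lt_const h₁).exists
    classical
    obtain ⟨n, hn⟩ : ∃ n, Nat.find hex = n + 1 := by
      refine Nat.exists_eq_succ_of_ne_zero fun h => ?_
      have := Nat.find_spec hex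
      rw [h] at this
      linarith
    refine ⟨n, hn ▸ Nat.find_spec hex, not_lt.1 (Nat.find_min hex (by omega))⟩

/-- The radial form of the distance zeta function of a nest of circles. -/
lemma hasSum_integral_mul_infDist_cpow {r : ℕ → ℝ} (hr : Antitone r) (h0 : ∀ n, 0 ≤ r n)
    (hlim : Tendsto r atTop (𝓝 0)) {s : ℂ} (hs : 1 < s.re)
    (hsum : Summable fun n => (r (n + 1) + r n) * ((r n - r (n + 1)) / 2) ^ (s.re - 1)) :
    HasSum (fun n => ((r (n + 1) + r n : ℝ) : ℂ)
        * (((r n - r (n + 1)) / 2 : ℝ) : ℂ) ^ (s - 1) / (s - 1))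
      (∫ t in Ioc 0 (r 0), (t : ℂ) * (infDist t (range r) : ℂ) ^ (s - 2)) := by
  have hle (n : ℕ) : r (n + 1) ≤ r n := hr n.le_succ
  have hcongr (z : ℂ) (n : ℕ) : EqOn
      (fun t : ℝ => (t : ℂ) * ((min (r n - t) (t - r (n + 1)) : ℝ) : ℂ) ^ (z - 2))
      (fun t : ℝ => (t : ℂ) * (infDist t (range r) : ℂ) ^ (z - 2))
      (Ioc (r (n + 1)) (r n)) := fun t ht => by
    simp only
    rw [infDist_range_of_antitone hr ht.1.le ht.2]
  have hint (z : ℂ) (hz : 1 < z.re) (n : ℕ) : IntegrableOn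
      (fun t : ℝ => (t : ℂ) * (infDist t (range r) : ℂ) ^ (z - 2)) (Ioc (r (n + 1)) (r n)) :=
    (((intervalIntegrable_iff_integrableOn_Ioc_of_le (hle n)).1
      (intervalIntegrable_mul_cpow_min (hle n) hz).1)).congr_fun (hcongr z n) measurableSet_Ioc
  have hval (z : ℂ) (hz : 1 < z.re) (n : ℕ) :
      ∫ t in Ioc (r (n + 1)) (r n), (t : ℂ) * (infDist t (range r) : ℂ) ^ (z - 2)
        = ((r (n + 1) + r n : ℝ) : ℂ) * (((r n - r (n + 1)) / 2 : ℝ) : ℂ) ^ (z - 1) / (z - 1) := by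
    rw [← setIntegral_congr_fun measurableSet_Ioc (hcongr z n),
      ← intervalIntegral.integral_of_le (hle n), (intervalIntegrable_mul_cpow_min (hle n) hz).2]
  have hnorm (n : ℕ) :
      ∫ t in Ioc (r (n + 1)) (r n), ‖(t : ℂ) * (infDist t (range r) : ℂ) ^ (s - 2)‖
        = (r (n + 1) + r n) * ((r n - r (n + 1)) / 2) ^ (s.re - 1) / (s.re - 1) := by
    have hv := hval (s.re : ℂ) (by simpa using hs) n
    have heq : ∫ t in Ioc (r (n + 1)) (r n), (t : ℂ) * (infDist t (range r) : ℂ) ^ ((s.re : ℂ) - 2)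
        = ∫ t in Ioc (r (n + 1)) (r n),
          ((‖(t : ℂ) * (infDist t (range r) : ℂ) ^ (s - 2)‖ : ℝ) : ℂ) := by
      rw [integral_Ioc_eq_integral_Ioo, integral_Ioc_eq_integral_Ioo]
      refine setIntegral_congr_fun measurableSet_Ioo fun t ht => ?_
      have hd : 0 < infDist t (range r) := by
        rw [infDist_range_of_antitone hr ht.1.le ht.2.le]
        exact lt_min (sub_pos.2 ht.2) (sub_pos.2 ht.1)
      have ht0 : 0 ≤ t := (h0 _).trans ht.1.le
      rw [norm_mul, norm_cpow_eq_rpow_re_of_pos hd, norm_real, Real.norm_of_nonneg ht0,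
        ofReal_mul, ofReal_cpow hd.le]
      simp
    rw [heq, integral_complex_ofReal] at hv
    apply ofReal_injective
    rw [hv]
    push_cast [ofReal_cpow (div_nonneg (sub_nonneg.2 (hle n)) zero_le_two)]
    rfl
  have hdisj : Pairwise (Function.onFun Disjoint fun n => Ioc (r (n + 1)) (r n)) :=
    hr.pairwise_disjoint_on_Ioc_succ
  have hU := iUnion_Ioc_succ_eq hr h0 hlim
  have hI : IntegrableOn (fun t : ℝ => (t : ℂ) * (infDist t (range r) : ℂ) ^ (s - 2))
      (⋃ n, Ioc (r (n + 1)) (r n)) := by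
    refine integrableOn_iUnion_of_summable_integral_norm (hint s hs) ?_
    simp only [hnorm]
    exact hsum.div_const _
  have := hasSum_integral_iUnion (fun n => measurableSet_Ioc) hdisj hI
  simp only [hval s hs] at this
  rwa [hU] at this

lemma setIntegral_ball_comp_norm (f : ℝ → ℂ) (R : ℝ) :
    ∫ x in ball (0 : EuclideanSpace ℝ (Fin 2)) R, f ‖x‖
      = 2 * Real.pi * ∫ t in Ioc 0 R, (t : ℂ) * f t := by
  have h := integral_fun_norm_addHaar (volume : Measure (EuclideanSpace ℝ (Fin 2)))
    ((Iio R).indicator f)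
  have hball : ∀ x : EuclideanSpace ℝ (Fin 2),
      (Iio R).indicator f ‖x‖ = (ball 0 R).indicator (fun x => f ‖x‖) x := fun x => by
    by_cases hx : ‖x‖ < R <;> simp [hx]
  have hmul : ∀ t : ℝ, t ^ (2 - 1) • (Iio R).indicator f t
      = (Iio R).indicator (fun t : ℝ => (t : ℂ) * f t) t := fun t => by
    by_cases ht : t ∈ Iio R <;> simp [ht]
  simp only [hball, finrank_euclideanSpace, Fintype.card_fin, hmul] at h
  rw [integral_indicator measurableSet_ball, setIntegral_indicator measurableSet_Iio,
    Ioi_inter_Iio, ← integral_Ioc_eq_integral_Ioo, measureReal_def,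
    EuclideanSpace.volume_ball_fin_two] at h
  rw [h]
  simp [Real.pi_pos.le, mul_assoc]

/-- Fix `a > 0` and for `j ≥ 1` set `ℓ_j := j^{−a} − (j+1)^{−a}`.  Let `A_a ⊂ ℝ²` be the
union over `j ≥ 1` of the circles of radius `j^{−a}` centered at the origin, and let
`Ω` be the open unit disk.  Then for every `s ∈ ℂ` with `Re s > max{1, 2/(a+1)}`, the
series `Σ_j j^{−a} ℓ_j^{s−1}` and `Σ_j ℓ_j^s` converge absolutely and
`∫_Ω dist(x,A_a)^{s−2} dx
  = (2^{3−s}π/(s−1))·Σ_j j^{−a} ℓ_j^{s−1} − (2^{2−s}π/(s−1))·Σ_j ℓ_j^s`.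
(Here the index `j : ℕ` records `j + 1 ≥ 1`.) -/
theorem statement10
    (a : ℝ) (ha : 0 < a)
    (ℓ : ℕ → ℝ)
    (hℓ : ∀ j : ℕ, ℓ j = ((j : ℝ) + 1) ^ (-a) - ((j : ℝ) + 2) ^ (-a))
    (A : Set (EuclideanSpace ℝ (Fin 2)))
    (hA : A = ⋃ j : ℕ, Metric.sphere (0 : EuclideanSpace ℝ (Fin 2)) (((j : ℝ) + 1) ^ (-a))) :
    ∀ s : ℂ, max 1 (2 / (a + 1)) < s.re →
      Summable (fun j : ℕ => ((j : ℝ) + 1) ^ (-a) * ℓ j ^ (s.re - 1)) ∧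
      Summable (fun j : ℕ => ℓ j ^ s.re) ∧
      ∫ x in Metric.ball (0 : EuclideanSpace ℝ (Fin 2)) 1,
          (Metric.infDist x A : ℂ) ^ (s - 2)
        = (2 : ℂ) ^ (3 - s) * (Real.pi : ℂ) / (s - 1)
            * (∑' j : ℕ, ((((j : ℝ) + 1) ^ (-a) : ℝ) : ℂ) * (ℓ j : ℂ) ^ (s - 1))
          - (2 : ℂ) ^ (2 - s) * (Real.pi : ℂ) / (s - 1)
            * (∑' j : ℕ, (ℓ j : ℂ) ^ s) := by
  intro s hs
  have hs1 : 1 < s.re := (le_max_left _ _).trans_lt hs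
  have hs2 : 2 < s.re * (a + 1) := (div_lt_iff₀ (by linarith)).1 ((le_max_right _ _).trans_lt hs)
  have hs0 : s - 1 ≠ 0 := fun h => by
    have := congrArg Complex.re h
    simp at this
    linarith
  set r : ℕ → ℝ := fun j => ((j : ℝ) + 1) ^ (-a) with hrdef
  have hpos (j : ℕ) : 0 < r j := Real.rpow_pos_of_pos (by positivity) _
  have hr : StrictAnti r := fun i j hij =>
    Real.rpow_lt_rpow_of_neg (by positivity) (by simpa using hij) (by linarith)
  have hℓr (j : ℕ) : ℓ j = r j - r (j + 1) := by
    rw [hℓ, hrdef]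
    push_cast
    ring_nf
  have hℓpos (j : ℕ) : 0 < ℓ j := hℓr j ▸ sub_pos.2 (hr j.lt_succ_self)
  have hℓle (j : ℕ) : ℓ j ≤ r j := by linarith [hℓr j, hpos (j + 1)]
  have hlim : Tendsto r atTop (𝓝 0) :=
    (tendsto_rpow_neg_atTop ha).comp (tendsto_natCast_atTop_atTop.atTop_add tendsto_const_nhds)
  have hS1 : Summable fun j => r j * ℓ j ^ (s.re - 1) := by
    have hmaj : Summable fun j : ℕ =>
        a ^ (s.re - 1) * ((j : ℝ) + 1) ^ (-a + (-a - 1) * (s.re - 1)) := by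
      refine Summable.mul_left _ ?_
      have := (summable_nat_add_iff 1).2
        (Real.summable_nat_rpow (p := -a + (-a - 1) * (s.re - 1)).2 (by nlinarith))
      simpa using this
    refine hmaj.of_nonneg_of_le
      (fun j => mul_nonneg (hpos j).le (Real.rpow_nonneg (hℓpos j).le _)) fun j => ?_
    have hj : (0 : ℝ) < (j : ℝ) + 1 := by positivity
    have hb : ℓ j ≤ a * ((j : ℝ) + 1) ^ (-a - 1) := by
      have := rpow_neg_sub_rpow_neg_le ha hj
      rwa [add_assoc, one_add_one_eq_two, ← hℓ] at this
    calc r j * ℓ j ^ (s.re - 1)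
        ≤ r j * (a * ((j : ℝ) + 1) ^ (-a - 1)) ^ (s.re - 1) := by
          gcongr
          exact (hℓpos j).le
      _ = a ^ (s.re - 1) * ((j : ℝ) + 1) ^ (-a + (-a - 1) * (s.re - 1)) := by
          rw [Real.mul_rpow ha.le (by positivity), ← Real.rpow_mul hj.le, Real.rpow_add hj]
          ring
  have hS2 : Summable fun j => ℓ j ^ s.re := by
    refine hS1.of_nonneg_of_le (fun j => Real.rpow_nonneg (hℓpos j).le _) fun j => ?_
    rw [Real.rpow_sub_one (hℓpos j).ne', mul_div_left_comm]
    exact le_mul_of_one_le_right (Real.rpow_nonneg (hℓpos j).le _)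
      ((one_le_div (hℓpos j)).2 (hℓle j))
  refine ⟨hS1, hS2, ?_⟩
  have hC1 : Summable fun j => (r j : ℂ) * (ℓ j : ℂ) ^ (s - 1) := by
    refine Summable.of_norm (hS1.congr fun j => ?_)
    rw [norm_mul, norm_cpow_eq_rpow_re_of_pos (hℓpos j), norm_real,
      Real.norm_of_nonneg (hpos j).le]
    simp
  have hC2 : Summable fun j => (ℓ j : ℂ) ^ s :=
    Summable.of_norm (hS2.congr fun j => (norm_cpow_eq_rpow_re_of_pos (hℓpos j) s).symm)
  have hsum : Summable fun n => (r (n + 1) + r n) * ((r n - r (n + 1)) / 2) ^ (s.re - 1) := by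
    refine (hS1.mul_left 2).of_nonneg_of_le (fun n => ?_) fun n => ?_
    · rw [← hℓr]
      exact mul_nonneg (add_pos (hpos _) (hpos _)).le
        (Real.rpow_nonneg (half_pos (hℓpos n)).le _)
    · rw [← hℓr, ← mul_assoc]
      refine mul_le_mul ?_ ?_ (Real.rpow_nonneg (half_pos (hℓpos n)).le _)
        (mul_pos two_pos (hpos n)).le
      · linarith [hr n.lt_succ_self]
      · exact Real.rpow_le_rpow (half_pos (hℓpos n)).le (half_le_self (hℓpos n).le)
          (by linarith)
  have hmain := hasSum_integral_mul_infDist_cpow hr.antitone (fun n => (hpos n).le) hlim hs1 hsum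
  have hr0 : r 0 = 1 := by simp [hrdef]
  rw [hr0] at hmain
  subst hA
  have hdist (x : EuclideanSpace ℝ (Fin 2)) :
      infDist x (⋃ j : ℕ, sphere (0 : EuclideanSpace ℝ (Fin 2)) (((j : ℝ) + 1) ^ (-a)))
        = infDist ‖x‖ (range r) :=
    infDist_iUnion_sphere_zero (fun j => (hpos j).le) x
  simp only [hdist]
  change _ = _ * (∑' j, (r j : ℂ) * (ℓ j : ℂ) ^ (s - 1)) - _
  rw [setIntegral_ball_comp_norm (fun t => (infDist t (range r) : ℂ) ^ (s - 2)) 1,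
    ← hmain.tsum_eq, ← tsum_mul_left, ← tsum_mul_left, ← tsum_mul_left,
    ← (hC1.mul_left _).tsum_sub (hC2.mul_left _)]
  refine tsum_congr fun j => ?_
  have hℓ0 : (ℓ j : ℂ) ≠ 0 := ofReal_ne_zero.2 (hℓpos j).ne'
  have hhalf : (((r j - r (j + 1)) / 2 : ℝ) : ℂ) ^ (s - 1)
      = (ℓ j : ℂ) ^ (s - 1) * 2 ^ (1 - s) := by
    rw [← hℓr, div_eq_mul_inv, ofReal_mul, mul_cpow_ofReal_nonneg (hℓpos j).le (by norm_num),
      ← neg_sub s 1, cpow_neg, ofReal_inv, ofReal_ofNat, inv_cpow]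
    rw [← ofReal_ofNat, arg_ofReal_of_nonneg zero_le_two]
    exact Real.pi_pos.ne
  have h3 : (2 : ℂ) ^ (3 - s) = 4 * 2 ^ (1 - s) := by
    rw [show 3 - s = 1 - s + 2 by ring, cpow_add _ _ two_ne_zero]
    norm_num
    ring
  have h2 : (2 : ℂ) ^ (2 - s) = 2 * 2 ^ (1 - s) := by
    rw [show 2 - s = 1 - s + 1 by ring, cpow_add _ _ two_ne_zero, cpow_one, mul_comm]
  have hsplit : (ℓ j : ℂ) ^ s = (ℓ j : ℂ) ^ (s - 1) * ℓ j := by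
    conv_lhs => rw [← sub_add_cancel s 1, cpow_add _ _ hℓ0, cpow_one]
  have hadd : ((r (j + 1) + r j : ℝ) : ℂ) = 2 * r j - ℓ j := by
    rw [hℓr]
    push_cast
    ring
  rw [hhalf, h3, h2, hsplit, hadd]
  ring

end
end

section
/- Let (A,Ω) be a relative fractal drum in ℝ^N, let D̄ := dim̄_B(A,Ω) be a real number, and fix δ > 0. Suppose U ⊆ ℂ is an open connected set containing the vertical line {s : Re s = D̄}, and F : U → ℂ is holomorphic on U ∖ {D̄}, satisfies F(s) = ζ̃_{A,Ω}(s;δ) for all s ∈ U with Re s > D̄, and has a simple pole at D̄ with residue r, i.e., (s−D̄)F(s) → r ≠ 0 as s → D̄. Then dim_B(A,Ω) exists and equals D̄, (A,Ω) is Minkowski measurable, and M^{D̄}(A,Ω) = r. If instead D̄ < N and F satisfies F(s) = ζ_{A,Ω}(s;δ) for all s ∈ U with Re s > D̄ (with the same simple-pole hypothesis at D̄ with residue r), then dim_B(A,Ω) = D̄, (A,Ω) is Minkowski measurable, and M^{D̄}(A,Ω) = r/(N−D̄). -/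
open MeasureTheory Filter Complex Set Metric Topology Asymptotics
open scoped ENNReal NNReal

noncomputable section

/-- The open `t`-neighborhood `A_t = {x : dist(x,A) < t}` of a set `A ⊆ ℝ^N`. -/
def nbhd (N : ℕ) (A : Set (EuclideanSpace ℝ (Fin N))) (t : ℝ) :
    Set (EuclideanSpace ℝ (Fin N)) :=
  {x | Metric.infDist x A < t}

/-- The volume `|A_t ∩ Ω|` of the `t`-neighborhood of `A` relative to `Ω`. -/
def tubeVol (N : ℕ) (A Ω : Set (EuclideanSpace ℝ (Fin N))) (t : ℝ) : ℝ :=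
  (volume (nbhd N A t ∩ Ω)).toReal

/-- The upper `r`-dimensional Minkowski content of the relative fractal drum `(A,Ω)`. -/
def upperContent (N : ℕ) (A Ω : Set (EuclideanSpace ℝ (Fin N))) (r : ℝ) : ℝ≥0∞ :=
  Filter.limsup
    (fun t : ℝ => volume (nbhd N A t ∩ Ω) / ENNReal.ofReal (t ^ ((N : ℝ) - r)))
    (nhdsWithin 0 (Set.Ioi 0))

/-- The lower `r`-dimensional Minkowski content of the relative fractal drum `(A,Ω)`. -/
def lowerContent (N : ℕ) (A Ω : Set (EuclideanSpace ℝ (Fin N))) (r : ℝ) : ℝ≥0∞ :=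
  Filter.liminf
    (fun t : ℝ => volume (nbhd N A t ∩ Ω) / ENNReal.ofReal (t ^ ((N : ℝ) - r)))
    (nhdsWithin 0 (Set.Ioi 0))

/-- `D` is the (finite) upper box (Minkowski) dimension of `(A,Ω)`:
the greatest lower bound of `{r : M^{*r}(A,Ω) = 0}`. -/
def IsUpperMinkDim (N : ℕ) (A Ω : Set (EuclideanSpace ℝ (Fin N))) (D : ℝ) : Prop :=
  IsGLB {r : ℝ | upperContent N A Ω r = 0} D

/-- `D` is the (finite) lower box (Minkowski) dimension of `(A,Ω)`. -/
def IsLowerMinkDim (N : ℕ) (A Ω : Set (EuclideanSpace ℝ (Fin N))) (D : ℝ) : Prop :=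
  IsGLB {r : ℝ | lowerContent N A Ω r = 0} D

/-- The box (Minkowski) dimension of `(A,Ω)` exists and equals `D`. -/
def IsMinkDim (N : ℕ) (A Ω : Set (EuclideanSpace ℝ (Fin N))) (D : ℝ) : Prop :=
  IsUpperMinkDim N A Ω D ∧ IsLowerMinkDim N A Ω D

/-- `(A,Ω)` is a relative fractal drum in `ℝ^N`. -/
def IsRFD (N : ℕ) (A Ω : Set (EuclideanSpace ℝ (Fin N))) : Prop :=
  A.Nonempty ∧ MeasurableSet Ω ∧ volume Ω < ⊤ ∧ ∃ δ₀ > (0 : ℝ), Ω ⊆ nbhd N A δ₀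

/-- The relative distance zeta function `ζ_{A,Ω}(s) = ∫_Ω d(x,A)^{s-N} dx`. -/
def distZeta (N : ℕ) (A Ω : Set (EuclideanSpace ℝ (Fin N))) (s : ℂ) : ℂ :=
  ∫ x in Ω, (Metric.infDist x A : ℂ) ^ (s - (N : ℂ))

/-- The relative distance zeta function with parameter `δ`:
`ζ_{A,Ω}(s;δ) = ∫_{A_δ ∩ Ω} d(x,A)^{s-N} dx`. -/
def distZetaD (N : ℕ) (A Ω : Set (EuclideanSpace ℝ (Fin N))) (δ : ℝ) (s : ℂ) : ℂ :=
  ∫ x in nbhd N A δ ∩ Ω, (Metric.infDist x A : ℂ) ^ (s - (N : ℂ))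

/-- The relative tube zeta function `ζ̃_{A,Ω}(s;δ) = ∫_0^δ t^{s-N-1}|A_t ∩ Ω| dt`. -/
def tubeZeta (N : ℕ) (A Ω : Set (EuclideanSpace ℝ (Fin N))) (δ : ℝ) (s : ℂ) : ℂ :=
  ∫ t in Set.Ioc (0 : ℝ) δ, (t : ℂ) ^ (s - (N : ℂ) - 1) * ((tubeVol N A Ω t : ℝ) : ℂ)

/-- The Mellin zeta function `ζ^𝔐_{A,Ω}(s) = ∫_0^∞ t^{s-N-1}|A_t ∩ Ω| dt`. -/
def mellinZeta (N : ℕ) (A Ω : Set (EuclideanSpace ℝ (Fin N))) (s : ℂ) : ℂ :=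
  ∫ t in Set.Ioi (0 : ℝ), (t : ℂ) ^ (s - (N : ℂ) - 1) * ((tubeVol N A Ω t : ℝ) : ℂ)

/-- `(A,Ω)` is Minkowski measurable with dimension `D` and Minkowski content `M`. -/
def MinkMeasurable (N : ℕ) (A Ω : Set (EuclideanSpace ℝ (Fin N))) (D M : ℝ) : Prop :=
  0 < M ∧
    Tendsto (fun t : ℝ => tubeVol N A Ω t / t ^ ((N : ℝ) - D))
      (nhdsWithin 0 (Set.Ioi 0)) (nhds M)

/-- `ω` is a pole of `F` (the norm of `F` blows up at `ω`). -/
def IsPoleAt (F : ℂ → ℂ) (ω : ℂ) : Prop :=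
  Tendsto (fun s => ‖F s‖) (nhdsWithin ω {ω}ᶜ) atTop

/-- The languidity conditions **L1**–**L2** for `F` with screen `S`, exponent `κ`,
constants `c`, `C` and two-sided sequence `T`. -/
def LanguidWith (F : ℂ → ℂ) (S : ℝ → ℝ) (κ c C : ℝ) (T : ℤ → ℝ) : Prop :=
  0 < C ∧
  (∀ n : ℤ, 1 ≤ n → T (-n) < 0 ∧ 0 < T n) ∧
  Tendsto (fun n : ℕ => T (n : ℤ)) atTop atTop ∧
  Tendsto (fun n : ℕ => T (-(n : ℤ))) atTop atBot ∧
  (∀ n : ℤ, ∀ σ : ℝ, S (T n) < σ → σ < c →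
    ‖F ((σ : ℂ) + (T n : ℝ) * Complex.I)‖ ≤ C * (|T n| + 1) ^ κ) ∧
  (∀ τ : ℝ, 1 ≤ |τ| → ‖F ((S τ : ℂ) + (τ : ℝ) * Complex.I)‖ ≤ C * |τ| ^ κ)

/-- `S` is a screen (for upper box dimension `D`): a Lipschitz function bounded below,
with `sup S ≤ D`. -/
def IsScreen (S : ℝ → ℝ) (D : ℝ) : Prop :=
  (∃ K : NNReal, LipschitzWith K S) ∧ BddBelow (Set.range S) ∧ ∀ τ : ℝ, S τ ≤ D

/-- The window associated with the screen `S`. -/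
def window (S : ℝ → ℝ) : Set ℂ :=
  {s : ℂ | S s.im ≤ s.re}

/-- The triangle function supported on `[-1, 1]`. -/
def triangle (τ : ℝ) : ℝ := max (1 - |τ|) 0

/-- The Fejér kernel, the Fourier transform of `triangle`. -/
def fejer (u : ℝ) : ℝ := ∫ τ in (0 : ℝ)..1, 2 * (1 - τ) * Real.cos (τ * u)

lemma continuous_triangle : Continuous triangle := by unfold triangle; fun_prop

lemma support_triangle_subset : Function.support triangle ⊆ Ioc (-1) 1 := by
  intro τ hτ
  have h : |τ| < 1 := by
    by_contra! hc
    exact hτ (max_eq_right (by linarith))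
  exact ⟨(abs_lt.mp h).1, (abs_lt.mp h).2.le⟩

lemma fourier_triangle (u : ℝ) :
    ∫ τ : ℝ, (triangle τ : ℂ) * cexp (τ * u * I) = (fejer u : ℂ) := by
  have hc : Continuous fun τ : ℝ => (triangle τ : ℂ) * cexp (τ * u * I) := by
    have := continuous_triangle
    fun_prop
  have hsupp : Function.support (fun τ : ℝ => (triangle τ : ℂ) * cexp (τ * u * I)) ⊆
      Ioc (-1) 1 := by
    intro τ hτ
    refine support_triangle_subset fun h => hτ ?_
    simp [h]
  rw [← intervalIntegral.integral_eq_integral_of_support_subset hsupp,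
    ← intervalIntegral.integral_add_adjacent_intervals (b := 0)
      (hc.intervalIntegrable _ _) (hc.intervalIntegrable _ _)]
  have hneg : ∫ τ in (-1 : ℝ)..0, (triangle τ : ℂ) * cexp (τ * u * I) =
      ∫ τ in (0 : ℝ)..1, (triangle (-τ) : ℂ) * cexp ((-τ : ℝ) * u * I) := by
    rw [intervalIntegral.integral_comp_neg (fun τ : ℝ => (triangle τ : ℂ) * cexp (τ * u * I))]
    simp
  have hc' : Continuous fun τ : ℝ => (triangle (-τ) : ℂ) * cexp ((-τ : ℝ) * u * I) :=
    hc.comp continuous_neg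
  rw [hneg, ← intervalIntegral.integral_add (hc'.intervalIntegrable _ _)
    (hc.intervalIntegrable _ _), fejer, ← intervalIntegral.integral_ofReal]
  refine intervalIntegral.integral_congr fun τ hτ => ?_
  rw [uIcc_of_le zero_le_one] at hτ
  have h1 : triangle τ = 1 - τ := by
    rw [triangle, abs_of_nonneg hτ.1, max_eq_left (by linarith [hτ.2])]
  have h2 : triangle (-τ) = 1 - τ := by
    rw [triangle, abs_neg, abs_of_nonneg hτ.1, max_eq_left (by linarith [hτ.2])]
  simp only [h1, h2]
  push_cast
  rw [Complex.cos]
  ring_nf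

lemma fejer_eq {u : ℝ} (hu : u ≠ 0) : fejer u = 2 * (1 - Real.cos u) / u ^ 2 := by
  have hd : ∀ τ ∈ uIcc (0 : ℝ) 1, HasDerivAt
      (fun τ : ℝ => 2 * ((1 - τ) * Real.sin (τ * u) / u - Real.cos (τ * u) / u ^ 2))
      (2 * (1 - τ) * Real.cos (τ * u)) τ := by
    intro τ _
    have h1 : HasDerivAt (fun τ : ℝ => τ * u) u τ := by simpa using (hasDerivAt_id τ).mul_const u
    have h2 : HasDerivAt (fun τ : ℝ => 1 - τ) (-1) τ := by
      simpa using (hasDerivAt_id τ).const_sub 1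
    have := (((h2.mul h1.sin).div_const u).sub (h1.cos.div_const (u ^ 2))).const_mul 2
    refine this.congr_deriv ?_
    field_simp
    ring
  rw [fejer, intervalIntegral.integral_eq_sub_of_hasDerivAt hd
    ((by fun_prop : Continuous fun τ : ℝ => 2 * (1 - τ) * Real.cos (τ * u)).intervalIntegrable _ _)]
  simp
  field_simp
  ring

lemma fejer_zero : fejer 0 = 1 := by
  have h : fejer 0 = ∫ τ in (0 : ℝ)..1, (2 - 2 * τ) := by
    refine intervalIntegral.integral_congr fun τ _ => ?_
    simp; ring
  rw [h, intervalIntegral.integral_sub (by simp) (Continuous.intervalIntegrable (by fun_prop) _ _),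
    intervalIntegral.integral_const_mul, integral_id]
  norm_num

lemma continuous_fejer : Continuous fejer := by
  unfold fejer
  exact intervalIntegral.continuous_parametric_intervalIntegral_of_continuous' (by fun_prop) _ _

lemma fejer_nonneg (u : ℝ) : 0 ≤ fejer u := by
  rcases eq_or_ne u 0 with rfl | hu
  · simp [fejer_zero]
  · rw [fejer_eq hu]
    have := Real.cos_le_one u
    have : 0 ≤ 1 - Real.cos u := by linarith
    positivity

lemma fejer_le (u : ℝ) : fejer u ≤ 6 * (1 + u ^ 2)⁻¹ := by
  rcases eq_or_ne u 0 with rfl | hu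
  · norm_num [fejer_zero]
  · have hpos : 0 < u ^ 2 := by positivity
    rw [fejer_eq hu, ← div_eq_mul_inv, div_le_div_iff₀ hpos (by positivity)]
    nlinarith [Real.one_sub_sq_div_two_le_cos (x := u), Real.neg_one_le_cos u]

lemma integrable_fejer : Integrable fejer :=
  (integrable_inv_one_add_sq.const_mul 6).mono' continuous_fejer.aestronglyMeasurable
    (ae_of_all _ fun u => by
      rw [Real.norm_of_nonneg (fejer_nonneg u)]
      exact fejer_le u)

lemma integral_fejer_pos : 0 < ∫ u, fejer u := by
  rw [integral_pos_iff_support_of_nonneg fejer_nonneg integrable_fejer]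
  exact continuous_fejer.isOpen_support.measure_pos _ ⟨0, by simp [fejer_zero]⟩

/-- Nonnegative band-limited approximate identities exist. -/
lemma exists_bandlimited_kernel {h η : ℝ} (hh : 0 < h) (hη : 0 < η) :
    ∃ (w : ℝ → ℂ) (k : ℝ → ℝ), Continuous w ∧ HasCompactSupport w ∧
      (∀ u : ℝ, (k u : ℂ) = ∫ τ : ℝ, w τ * cexp (τ * u * I)) ∧ (∀ u, 0 ≤ k u) ∧
      Continuous k ∧ Integrable k ∧ ∫ u, k u = 1 ∧ 1 - η < ∫ u in (-h)..h, k u := by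
  set C : ℝ := ∫ u, fejer u with hC
  have hCpos : 0 < C := integral_fejer_pos
  have hlim : Tendsto (fun l : ℝ => (∫ u in (-(l * h))..(l * h), fejer u) / C) atTop (𝓝 1) := by
    rw [← div_self hCpos.ne']
    refine (intervalIntegral_tendsto_integral integrable_fejer ?_ ?_).div_const C
    · exact tendsto_neg_atTop_atBot.comp (tendsto_id.atTop_mul_const hh)
    · exact tendsto_id.atTop_mul_const hh
  obtain ⟨l, hl, hlpos⟩ := ((hlim.eventually_const_lt (show 1 - η < 1 by linarith)).and
    (eventually_gt_atTop 0)).exists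
  refine ⟨fun τ => (triangle (l⁻¹ * τ) : ℂ) / C, fun u => l * fejer (l * u) / C, ?_, ?_, ?_, ?_,
    ?_, ?_, ?_, ?_⟩
  · have := continuous_triangle
    fun_prop
  · refine HasCompactSupport.of_support_subset_isCompact (isCompact_Icc (a := -l) (b := l)) ?_
    intro τ hτ
    have := support_triangle_subset (show l⁻¹ * τ ∈ Function.support triangle from
      fun h0 => hτ (by simp [h0]))
    constructor
    · have h1 := mul_lt_mul_of_pos_left this.1 hlpos
      rw [mul_inv_cancel_left₀ hlpos.ne'] at h1
      linarith
    · have h1 := mul_le_mul_of_nonneg_left this.2 hlpos.le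
      rw [mul_inv_cancel_left₀ hlpos.ne'] at h1
      linarith
  · intro u
    have := Measure.integral_comp_mul_left
      (fun τ : ℝ => (triangle τ : ℂ) * cexp (τ * (l * u : ℝ) * I)) l⁻¹
    rw [fourier_triangle, inv_inv, abs_of_pos hlpos] at this
    have h2 : ∀ τ : ℝ, (triangle (l⁻¹ * τ) : ℂ) / C * cexp (τ * u * I) =
        ((triangle (l⁻¹ * τ) : ℂ) * cexp ((l⁻¹ * τ : ℝ) * (l * u : ℝ) * I)) / C := by
      intro τ
      have h3 : ((l⁻¹ * τ : ℝ) : ℂ) * (l * u : ℝ) = τ * u := by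
        rw [← ofReal_mul, ← ofReal_mul]
        congr 1
        field_simp
      rw [h3]
      ring
    simp_rw [h2]
    rw [integral_div, this]
    simp
  · exact fun u => div_nonneg (mul_nonneg hlpos.le (fejer_nonneg _)) hCpos.le
  · exact ((continuous_fejer.comp (continuous_const_mul l)).const_mul l).div_const C
  · exact ((integrable_fejer.comp_mul_left' hlpos.ne').const_mul l).div_const C
  · rw [integral_div, integral_const_mul, Measure.integral_comp_mul_left, ← hC, abs_inv,
      abs_of_pos hlpos, smul_eq_mul]
    field_simp
  · rw [intervalIntegral.integral_div, intervalIntegral.integral_const_mul,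
      intervalIntegral.integral_comp_mul_left _ hlpos.ne', smul_eq_mul,
      mul_inv_cancel_left₀ hlpos.ne', mul_neg]
    exact hl

/-- An Abel-type criterion: a nonnegative function whose Laplace integrals have a limit at `0⁺`
is integrable, and its integral is that limit. -/
lemma integrableOn_and_integral_eq_of_tendsto_laplace {φ : ℝ → ℝ} {L : ℝ} (hm : Measurable φ)
    (h0 : ∀ x ∈ Ioi (0 : ℝ), 0 ≤ φ x)
    (hint : ∀ σ > (0 : ℝ), IntegrableOn (fun x => φ x * Real.exp (-σ * x)) (Ioi 0))
    (hlim : Tendsto (fun σ : ℝ => ∫ x in Ioi (0 : ℝ), φ x * Real.exp (-σ * x)) (𝓝[>] 0) (𝓝 L)) :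
    IntegrableOn φ (Ioi 0) ∧ ∫ x in Ioi (0 : ℝ), φ x = L := by
  have hpt : ∀ x, Tendsto (fun σ : ℝ => φ x * Real.exp (-σ * x)) (𝓝[>] 0) (𝓝 (φ x)) := by
    intro x
    have : Continuous fun σ : ℝ => φ x * Real.exp (-σ * x) := by fun_prop
    simpa using (this.tendsto 0).mono_left nhdsWithin_le_nhds
  have hI : IntegrableOn φ (Ioi 0) := by
    refine ⟨hm.aestronglyMeasurable, ?_⟩
    rw [hasFiniteIntegral_iff_ofReal (ae_restrict_of_forall_mem measurableSet_Ioi h0)]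
    have hF := lintegral_liminf_le (μ := volume.restrict (Ioi (0 : ℝ))) (u := 𝓝[>] (0 : ℝ))
      (f := fun σ x => ENNReal.ofReal (φ x * Real.exp (-σ * x))) (fun σ => by fun_prop)
    have h1 : ∀ x, liminf (fun σ : ℝ => ENNReal.ofReal (φ x * Real.exp (-σ * x))) (𝓝[>] 0) =
        ENNReal.ofReal (φ x) := fun x => (ENNReal.tendsto_ofReal (hpt x)).liminf_eq
    have h2 : liminf (fun σ : ℝ => ∫⁻ x in Ioi (0 : ℝ), ENNReal.ofReal (φ x * Real.exp (-σ * x)))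
        (𝓝[>] 0) = ENNReal.ofReal L := by
      refine Tendsto.liminf_eq ((ENNReal.tendsto_ofReal hlim).congr' ?_)
      filter_upwards [self_mem_nhdsWithin] with σ hσ
      exact ofReal_integral_eq_lintegral_ofReal (hint σ hσ)
        (ae_restrict_of_forall_mem measurableSet_Ioi fun x hx =>
          mul_nonneg (h0 x hx) (Real.exp_pos _).le)
    simp only [h1, h2] at hF
    exact hF.trans_lt ENNReal.ofReal_lt_top
  refine ⟨hI, tendsto_nhds_unique ?_ hlim⟩
  refine tendsto_integral_filter_of_dominated_convergence φ
    (Eventually.of_forall fun σ => by fun_prop) ?_ hI (ae_of_all _ hpt)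
  filter_upwards [self_mem_nhdsWithin] with σ hσ
  refine ae_restrict_of_forall_mem measurableSet_Ioi fun x hx => ?_
  rw [Real.norm_of_nonneg (mul_nonneg (h0 x hx) (Real.exp_pos _).le)]
  refine mul_le_of_le_one_right (h0 x hx) (Real.exp_le_one_iff.mpr ?_)
  have : 0 < σ * x := mul_pos hσ hx
  linarith

/-- The Riemann–Lebesgue lemma with the kernel `e^{iτy}`. -/
lemma tendsto_integral_mul_cexp_atTop (φ : ℝ → ℂ) :
    Tendsto (fun y : ℝ => ∫ τ : ℝ, φ τ * cexp (τ * y * I)) atTop (𝓝 0) := by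
  have h := Real.tendsto_integral_exp_smul_cocompact φ
  have h2 : Tendsto (fun y : ℝ => -y / (2 * Real.pi)) atTop (cocompact ℝ) := by
    rw [cocompact_eq_atBot_atTop]
    refine Tendsto.mono_right ?_ le_sup_left
    exact tendsto_neg_atTop_atBot.atBot_div_const (by positivity)
  refine (h.comp h2).congr fun y => ?_
  refine integral_congr_ae (ae_of_all _ fun τ => ?_)
  simp only [Circle.smul_def, Real.fourierChar_apply, smul_eq_mul]
  rw [mul_comm]
  congr 2
  push_cast
  have : (Real.pi : ℂ) ≠ 0 := by exact_mod_cast Real.pi_ne_zero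
  field_simp

/-- Parseval's identity for the Laplace transform of `g` and a band-limited kernel. -/
lemma integral_mul_kernel_eq {g : ℝ → ℝ} {w : ℝ → ℂ} {k : ℝ → ℝ} {σ : ℝ} (y : ℝ)
    (hg : IntegrableOn (fun x => g x * Real.exp (-σ * x)) (Ioi 0))
    (hw : Continuous w) (hws : HasCompactSupport w)
    (hk : ∀ u : ℝ, (k u : ℂ) = ∫ τ : ℝ, w τ * cexp (τ * u * I)) :
    ((∫ x in Ioi (0 : ℝ), g x * Real.exp (-σ * x) * k (y - x) : ℝ) : ℂ) =
      ∫ τ : ℝ, w τ * cexp (τ * y * I) *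
        ∫ x in Ioi (0 : ℝ), (g x : ℂ) * cexp (-(σ + τ * I) * x) := by
  have hprod : Integrable (Function.uncurry fun (x τ : ℝ) =>
      ((g x * Real.exp (-σ * x) : ℝ) : ℂ) * (w τ * cexp (τ * (y - x : ℝ) * I)))
      ((volume.restrict (Ioi (0 : ℝ))).prod volume) := by
    have h1 := (hg.ofReal (𝕜 := ℂ)).mul_prod (hw.integrable_of_hasCompactSupport hws)
      (ν := (volume : Measure ℝ))
    have h2 := h1.mul_bdd (c := 1) (g := fun p : ℝ × ℝ => cexp (p.2 * (y - p.1 : ℝ) * I))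
      (Continuous.aestronglyMeasurable (by fun_prop)) (ae_of_all _ fun p => by
        rw [← ofReal_mul, norm_exp_ofReal_mul_I])
    refine h2.congr (ae_of_all _ fun p => ?_)
    simp [Function.uncurry, mul_assoc]
  calc ((∫ x in Ioi (0 : ℝ), g x * Real.exp (-σ * x) * k (y - x) : ℝ) : ℂ)
      = ∫ x in Ioi (0 : ℝ), ∫ τ : ℝ,
          ((g x * Real.exp (-σ * x) : ℝ) : ℂ) * (w τ * cexp (τ * (y - x : ℝ) * I)) := by
        rw [← integral_complex_ofReal]
        refine integral_congr_ae (ae_of_all _ fun x => ?_)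
        simp only [integral_const_mul, ← hk]
        push_cast
        rfl
    _ = ∫ τ : ℝ, ∫ x in Ioi (0 : ℝ),
          ((g x * Real.exp (-σ * x) : ℝ) : ℂ) * (w τ * cexp (τ * (y - x : ℝ) * I)) :=
        integral_integral_swap hprod
    _ = _ := by
        refine integral_congr_ae (ae_of_all _ fun τ => ?_)
        simp only [← integral_const_mul]
        refine integral_congr_ae (ae_of_all _ fun x => ?_)
        have : cexp (τ * (y - x : ℝ) * I) * cexp (-σ * x) =
            cexp (τ * y * I) * cexp (-(σ + τ * I) * x) := by
          rw [← Complex.exp_add, ← Complex.exp_add]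
          congr 1
          push_cast
          ring
        push_cast at this ⊢
        linear_combination (g x : ℂ) * w τ * this

lemma tendsto_integral_mul_near_imaginary_axis {w : ℝ → ℂ} {U : Set ℂ} {H : ℂ → ℂ}
    (hw : Continuous w) (hws : HasCompactSupport w) (hU : IsOpen U)
    (hUl : ∀ z : ℂ, z.re = 0 → z ∈ U) (hH : ContinuousOn H U) :
    (∀ᶠ σ : ℝ in 𝓝[>] 0, ∀ τ : ℝ, w τ ≠ 0 → (σ + τ * I : ℂ) ∈ U) ∧
    Tendsto (fun σ : ℝ => ∫ τ : ℝ, w τ * H (σ + τ * I)) (𝓝[>] 0)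
      (𝓝 (∫ τ : ℝ, w τ * H (τ * I))) := by
  set K : Set ℂ := (fun τ : ℝ => (τ * I : ℂ)) '' tsupport w with hK
  have hKc : IsCompact K := hws.isCompact.image (by fun_prop)
  have hKU : K ⊆ U := by
    rintro _ ⟨τ, -, rfl⟩
    exact hUl _ (by simp)
  obtain ⟨ε, hε, hεU⟩ := hKc.exists_cthickening_subset_open hU hKU
  have hmem : ∀ σ : ℝ, 0 ≤ σ → σ < ε → ∀ τ : ℝ, w τ ≠ 0 →
      (σ + τ * I : ℂ) ∈ cthickening ε K := by
    intro σ h0 h1 τ hτ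
    refine mem_cthickening_of_dist_le _ (τ * I : ℂ) ε K ⟨τ, subset_tsupport _ hτ, rfl⟩ ?_
    simp [dist_eq_norm, abs_of_nonneg h0, h1.le]
  have hev : ∀ᶠ σ in 𝓝[>] (0 : ℝ), 0 < σ ∧ σ < ε := by
    filter_upwards [Ioo_mem_nhdsGT hε] with σ hσ using hσ
  obtain ⟨B, hB⟩ := (hKc.cthickening (r := ε)).exists_bound_of_continuousOn (hH.mono hεU)
  refine ⟨hev.mono fun σ hσ τ hτ => hεU (hmem σ hσ.1.le hσ.2 τ hτ), ?_⟩
  have hmeas : ∀ σ : ℝ, 0 ≤ σ → σ < ε →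
      AEStronglyMeasurable (fun τ : ℝ => w τ * H (σ + τ * I)) volume := by
    intro σ h0 h1
    have hc : ContinuousOn (fun τ : ℝ => w τ * H (σ + τ * I)) (tsupport w) := by
      refine hw.continuousOn.mul (hH.comp (by fun_prop) ?_)
      intro τ hτ
      refine hεU (mem_cthickening_of_dist_le _ (τ * I : ℂ) ε K ⟨τ, hτ, rfl⟩ ?_)
      simp [dist_eq_norm, abs_of_nonneg h0, h1.le]
    have h2 := hc.aestronglyMeasurable (μ := volume) (isClosed_tsupport w).measurableSet
    rw [← aestronglyMeasurable_indicator_iff (isClosed_tsupport w).measurableSet] at h2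
    refine h2.congr (ae_of_all _ fun τ => ?_)
    by_cases hτ : τ ∈ tsupport w
    · simp [hτ]
    · simp [hτ, image_eq_zero_of_notMem_tsupport hτ]
  refine tendsto_integral_filter_of_dominated_convergence (fun τ => ‖w τ‖ * B)
    (hev.mono fun σ hσ => hmeas σ hσ.1.le hσ.2) (hev.mono fun σ hσ => ae_of_all _ fun τ => ?_)
    ((hw.integrable_of_hasCompactSupport hws).norm.mul_const B) (ae_of_all _ fun τ => ?_)
  · rw [norm_mul]
    by_cases hτ : w τ = 0
    · simp [hτ]
    · exact mul_le_mul_of_nonneg_left (hB _ (hmem σ hσ.1.le hσ.2 τ hτ)) (norm_nonneg _)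
  · refine Tendsto.const_mul _ ?_
    have h1 : ContinuousAt H (((0 : ℝ) : ℂ) + τ * I) :=
      hH.continuousAt (hU.mem_nhds (hUl _ (by simp)))
    have h2 : ContinuousAt (fun σ : ℝ => H ((σ : ℂ) + τ * I)) 0 :=
      ContinuousAt.comp (f := fun σ : ℝ => (σ : ℂ) + τ * I) h1 (by fun_prop)
    simpa using h2.tendsto.mono_left nhdsWithin_le_nhds

/-- If the Laplace transform of `f ≥ 0` minus `R / z` extends continuously across the imaginary
axis, then averages of `f` against a band-limited kernel `k` converge to `R ∫ k`. -/
lemma tendsto_integral_mul_kernel {f : ℝ → ℝ} {R : ℝ} {U : Set ℂ} {H : ℂ → ℂ}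
    {w : ℝ → ℂ} {k : ℝ → ℝ} (hm : Measurable f) (h0 : ∀ x ∈ Ioi (0 : ℝ), 0 ≤ f x)
    (hint : ∀ σ > (0 : ℝ), IntegrableOn (fun x => f x * Real.exp (-σ * x)) (Ioi 0))
    (hU : IsOpen U) (hUl : ∀ z : ℂ, z.re = 0 → z ∈ U) (hH : ContinuousOn H U)
    (hHf : ∀ z ∈ U, 0 < z.re → H z = (∫ x in Ioi (0 : ℝ), (f x : ℂ) * cexp (-z * x)) - R / z)
    (hw : Continuous w) (hws : HasCompactSupport w)
    (hk : ∀ u : ℝ, (k u : ℂ) = ∫ τ : ℝ, w τ * cexp (τ * u * I)) (hk0 : ∀ u, 0 ≤ k u)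
    (hkc : Continuous k) (hki : Integrable k) :
    (∀ y, IntegrableOn (fun x => f x * k (y - x)) (Ioi 0)) ∧
    Tendsto (fun y => ∫ x in Ioi (0 : ℝ), f x * k (y - x)) atTop (𝓝 (R * ∫ u, k u)) := by
  have hexp : ∀ σ > (0 : ℝ), IntegrableOn (fun x => Real.exp (-σ * x)) (Ioi 0) :=
    fun σ hσ => exp_neg_integrableOn_Ioi 0 hσ
  obtain ⟨M, hM⟩ : ∃ M, ∀ u, ‖k u‖ ≤ M := by
    refine ⟨∫ τ, ‖w τ‖, fun u => ?_⟩
    rw [← norm_real, hk]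
    refine (norm_integral_le_integral_norm _).trans (le_of_eq ?_)
    refine integral_congr_ae (ae_of_all _ fun τ => ?_)
    simp only [norm_mul]
    rw [← ofReal_mul, norm_exp_ofReal_mul_I, mul_one]
  have hmulk : ∀ (φ : ℝ → ℝ) (y : ℝ), IntegrableOn φ (Ioi 0) →
      IntegrableOn (fun x => φ x * k (y - x)) (Ioi 0) := fun φ y hφ =>
    Integrable.mul_bdd hφ (c := M)
      (Continuous.aestronglyMeasurable (by fun_prop)) (ae_of_all _ fun x => hM _)
  set J : ℝ → ℂ := fun y => ∫ τ : ℝ, w τ * cexp (τ * y * I) * H (τ * I) with hJ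
  have hlim : ∀ y, Tendsto (fun σ : ℝ => ∫ x in Ioi (0 : ℝ), f x * k (y - x) * Real.exp (-σ * x))
      (𝓝[>] 0) (𝓝 ((J y).re + R * ∫ x in Ioi (0 : ℝ), k (y - x))) := by
    intro y
    obtain ⟨hUev, hJlim⟩ := tendsto_integral_mul_near_imaginary_axis
      (w := fun τ : ℝ => w τ * cexp (τ * y * I)) (by fun_prop) hws.mul_right hU hUl hH
    have h1 : Tendsto (fun σ : ℝ => ∫ x in Ioi (0 : ℝ), k (y - x) * Real.exp (-σ * x)) (𝓝[>] 0)
        (𝓝 (∫ x in Ioi (0 : ℝ), k (y - x))) := by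
      refine tendsto_integral_filter_of_dominated_convergence (fun x => k (y - x))
        (Eventually.of_forall fun σ => Continuous.aestronglyMeasurable (by fun_prop)) ?_
        (hki.comp_sub_left y).integrableOn (ae_of_all _ fun x => ?_)
      · filter_upwards [self_mem_nhdsWithin] with σ hσ
        refine ae_restrict_of_forall_mem measurableSet_Ioi fun x hx => ?_
        rw [Real.norm_of_nonneg (mul_nonneg (hk0 _) (Real.exp_pos _).le)]
        refine mul_le_of_le_one_right (hk0 _) (Real.exp_le_one_iff.mpr ?_)
        have : 0 < σ * x := mul_pos hσ hx
        linarith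
      · have : Continuous fun σ : ℝ => k (y - x) * Real.exp (-σ * x) := by fun_prop
        simpa using (this.tendsto 0).mono_left nhdsWithin_le_nhds
    refine (((continuous_re.tendsto _).comp hJlim).add (h1.const_mul R)).congr' ?_
    filter_upwards [hUev, self_mem_nhdsWithin] with σ hσU hσ
    have hg : IntegrableOn (fun x => (f x - R) * Real.exp (-σ * x)) (Ioi 0) := by
      simp only [sub_mul]
      exact (hint σ hσ).sub ((hexp σ hσ).const_mul R)
    have hP := integral_mul_kernel_eq y hg hw hws hk
    have hHg : ∀ τ : ℝ, w τ * cexp (τ * y * I) *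
        (∫ x in Ioi (0 : ℝ), ((f x - R : ℝ) : ℂ) * cexp (-(σ + τ * I) * x)) =
        w τ * cexp (τ * y * I) * H (σ + τ * I) := by
      intro τ
      by_cases hτ : w τ * cexp (τ * y * I) = 0
      · simp [hτ]
      have hre : (0 : ℝ) < (σ + τ * I : ℂ).re := by simpa using hσ
      rw [hHf _ (hσU τ hτ) hre]
      congr 1
      have hre' : (-(σ + τ * I) : ℂ).re < 0 := by simpa using hσ
      have hi1 : IntegrableOn (fun x : ℝ => (f x : ℂ) * cexp (-(σ + τ * I) * x)) (Ioi 0) := by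
        have h2 := (hint σ hσ).ofReal (𝕜 := ℂ)
        have h3 := h2.mul_bdd (c := 1) (g := fun x : ℝ => cexp ((-(τ * x) : ℝ) * I))
          (Continuous.aestronglyMeasurable (by fun_prop)) (ae_of_all _ fun x => by
            rw [norm_exp_ofReal_mul_I])
        refine h3.congr (ae_of_all _ fun x => ?_)
        simp only [coe_algebraMap]
        push_cast
        rw [mul_assoc, ← Complex.exp_add]
        ring_nf
      have hi2 : IntegrableOn (fun x : ℝ => (R : ℂ) * cexp (-(σ + τ * I) * x)) (Ioi 0) :=
        (integrableOn_exp_mul_complex_Ioi hre' 0).const_mul _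
      simp only [ofReal_sub, sub_mul]
      rw [integral_sub hi1 hi2, integral_const_mul, integral_exp_mul_complex_Ioi hre']
      simp only [ofReal_zero, mul_zero, Complex.exp_zero]
      rw [neg_div_neg_eq, mul_one_div]
    simp only [hHg] at hP
    simp only [Function.comp_apply]
    rw [← hP, ofReal_re, ← integral_const_mul, ← integral_add (hmulk _ y hg)]
    · refine integral_congr_ae (ae_of_all _ fun x => ?_)
      simp only
      ring
    · refine Integrable.const_mul ?_ R
      refine (hmulk _ y (hexp σ hσ)).congr (ae_of_all _ fun x => ?_)
      simp only
      ring
  have hmain : ∀ y, IntegrableOn (fun x => f x * k (y - x)) (Ioi 0) ∧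
      ∫ x in Ioi (0 : ℝ), f x * k (y - x) = (J y).re + R * ∫ x in Ioi (0 : ℝ), k (y - x) := by
    intro y
    refine integrableOn_and_integral_eq_of_tendsto_laplace (by fun_prop)
      (fun x hx => mul_nonneg (h0 x hx) (hk0 _)) (fun σ hσ => ?_) (hlim y)
    refine (hmulk _ y (hint σ hσ)).congr (ae_of_all _ fun x => ?_)
    simp only
    ring
  refine ⟨fun y => (hmain y).1, ?_⟩
  simp only [fun y => (hmain y).2]
  have hJ0 : Tendsto J atTop (𝓝 0) := by
    refine (tendsto_integral_mul_cexp_atTop fun τ => w τ * H (τ * I)).congr fun y => ?_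
    refine integral_congr_ae (ae_of_all _ fun τ => ?_)
    simp only
    ring
  have hk1 : ∀ y, ∫ x in Ioi (0 : ℝ), k (y - x) = ∫ u in Iio y, k u := by
    intro y
    rw [← integral_indicator measurableSet_Ioi, ← integral_indicator measurableSet_Iio,
      ← integral_sub_left_eq_self _ volume y]
    refine integral_congr_ae (ae_of_all _ fun u => ?_)
    simp [indicator]
  have hk2 : Tendsto (fun y => ∫ u in Iio y, k u) atTop (𝓝 (∫ u, k u)) :=
    (aecover_Iio tendsto_id).integral_tendsto_of_countably_generated hki
  simp only [hk1]
  simpa using ((continuous_re.tendsto _).comp hJ0).add (hk2.const_mul R)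

lemma integral_Ioc_comp_sub_eq (k : ℝ → ℝ) (y h : ℝ) (hh : 0 < h) :
    ∫ x in Ioc (y - h) (y + h), k (y - x) = ∫ u in (-h)..h, k u := by
  rw [← intervalIntegral.integral_of_le (by linarith),
    intervalIntegral.integral_comp_sub_left (fun u => k u)]
  congr 1 <;> ring

/-- A Wiener–Ikehara theorem: if `f ≥ 0`, `x ↦ e^{-cx} f x` is nonincreasing, and the Laplace
transform of `f` minus `R / z` extends continuously across the imaginary axis, then `f → R`. -/
theorem tendsto_of_laplace_sub_pole {f : ℝ → ℝ} {c R : ℝ} {U : Set ℂ} {H : ℂ → ℂ}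
    (hc : 0 ≤ c) (hm : Measurable f) (h0 : ∀ x, 0 ≤ f x)
    (hmono : ∀ x y, x ≤ y → f y ≤ Real.exp (c * (y - x)) * f x)
    (hint : ∀ σ > (0 : ℝ), IntegrableOn (fun x => f x * Real.exp (-σ * x)) (Ioi 0))
    (hU : IsOpen U) (hUl : ∀ z : ℂ, z.re = 0 → z ∈ U) (hH : ContinuousOn H U)
    (hHf : ∀ z ∈ U, 0 < z.re → H z = (∫ x in Ioi (0 : ℝ), (f x : ℂ) * cexp (-z * x)) - R / z) :
    Tendsto f atTop (𝓝 R) := by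
  have hclose : ∀ h x y, 0 < h → x ≤ y → y ≤ x + 2 * h →
      f y ≤ Real.exp (2 * c * h) * f x := fun h x y hh hxy hyx =>
    (hmono x y hxy).trans (mul_le_mul_of_nonneg_right
      (Real.exp_le_exp.mpr (by nlinarith)) (h0 x))
  have hupper : ∀ h η : ℝ, 0 < h → 0 < η → η < 1 → ∃ S : ℝ → ℝ, Tendsto S atTop (𝓝 R) ∧
      ∀ᶠ y in atTop, f y ≤ Real.exp (2 * c * h) * S y / (1 - η) := by
    intro h η hh hη hη1
    obtain ⟨w, k, hw, hws, hk, hk0, hkc, hki, hk1, hkη⟩ := exists_bandlimited_kernel hh hη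
    obtain ⟨hfk, hlim⟩ := tendsto_integral_mul_kernel hm (fun x _ => h0 x) hint hU hUl hH hHf
      hw hws hk hk0 hkc hki
    rw [hk1, mul_one] at hlim
    refine ⟨_, hlim.comp (tendsto_atTop_add_const_right _ (-h) tendsto_id), ?_⟩
    filter_upwards [eventually_gt_atTop (2 * h)] with y hy
    simp only [Function.comp_apply, id]
    set y' := y + -h with hy'
    have hsub : Ioc (y' - h) (y' + h) ⊆ Ioi (0 : ℝ) := fun x hx => by
      have := hx.1
      simp only [mem_Ioi]
      linarith
    have h1 : ∫ x in Ioc (y' - h) (y' + h), f x * k (y' - x) ≤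
        ∫ x in Ioi (0 : ℝ), f x * k (y' - x) :=
      setIntegral_mono_set (hfk y') (ae_of_all _ fun x => mul_nonneg (h0 x) (hk0 _))
        hsub.eventuallyLE
    have h2 : ∫ x in Ioc (y' - h) (y' + h), f y * k (y' - x) ≤
        ∫ x in Ioc (y' - h) (y' + h), Real.exp (2 * c * h) * (f x * k (y' - x)) := by
      refine setIntegral_mono_on ((hki.comp_sub_left y').integrableOn.const_mul _)
        (((hfk y').mono_set hsub).const_mul _) measurableSet_Ioc fun x hx => ?_
      rw [← mul_assoc]
      exact mul_le_mul_of_nonneg_right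
        (hclose h x y hh (by linarith [hx.2]) (by linarith [hx.1])) (hk0 _)
    rw [integral_const_mul, integral_const_mul, integral_Ioc_comp_sub_eq k y' h hh] at h2
    rw [le_div_iff₀ (by linarith)]
    calc f y * (1 - η) ≤ f y * ∫ u in (-h)..h, k u :=
          mul_le_mul_of_nonneg_left hkη.le (h0 y)
      _ ≤ _ := h2.trans (mul_le_mul_of_nonneg_left h1 (Real.exp_pos _).le)
  obtain ⟨B, hB⟩ : ∃ B, ∀ x ∈ Ioi (0 : ℝ), f x ≤ B := by
    obtain ⟨S, hS, hfS⟩ := hupper 1 (1 / 2) one_pos (by norm_num) (by norm_num)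
    have hS1 := (hS.eventually_lt_const (lt_add_one R)).and hfS
    obtain ⟨Y, hY⟩ := eventually_atTop.mp hS1
    refine ⟨max (Real.exp (2 * c * 1) * (R + 1) / (1 - 1 / 2)) (Real.exp (c * Y) * f 0),
      fun x hx => ?_⟩
    rcases le_total Y x with hYx | hYx
    · refine le_max_of_le_left ((hY x hYx).2.trans ?_)
      have := (hY x hYx).1.le
      gcongr
    · refine le_max_of_le_right ((hmono 0 x (le_of_lt hx)).trans ?_)
      have := h0 0
      gcongr
      linarith
  have hB0 : 0 ≤ B := (h0 1).trans (hB 1 (mem_Ioi.mpr one_pos))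
  have hlower : ∀ h η : ℝ, 0 < h → 0 < η → ∃ S : ℝ → ℝ, Tendsto S atTop (𝓝 R) ∧
      ∀ᶠ y in atTop, S y - B * η ≤ Real.exp (2 * c * h) * f y := by
    intro h η hh hη
    obtain ⟨w, k, hw, hws, hk, hk0, hkc, hki, hk1, hkη⟩ := exists_bandlimited_kernel hh hη
    obtain ⟨hfk, hlim⟩ := tendsto_integral_mul_kernel hm (fun x _ => h0 x) hint hU hUl hH hHf
      hw hws hk hk0 hkc hki
    rw [hk1, mul_one] at hlim
    refine ⟨_, hlim.comp (tendsto_atTop_add_const_right _ h tendsto_id), ?_⟩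
    filter_upwards [eventually_gt_atTop 0] with y hy
    simp only [Function.comp_apply, id]
    set y' := y + h with hy'
    have hki' : Integrable fun x => k (y' - x) := hki.comp_sub_left y'
    have hkind : Integrable ((Ioc (y' - h) (y' + h))ᶜ.indicator fun x => k (y' - x)) :=
      hki'.indicator measurableSet_Ioc.compl
    set G : ℝ → ℝ := fun x => Real.exp (2 * c * h) * f y * k (y' - x) +
      B * (Ioc (y' - h) (y' + h))ᶜ.indicator (fun x => k (y' - x)) x with hG
    have hGi : Integrable G := (hki'.const_mul _).add (hkind.const_mul _)
    have hA : 0 ≤ Real.exp (2 * c * h) * f y := mul_nonneg (Real.exp_pos _).le (h0 y)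
    have hG0 : ∀ x, 0 ≤ G x := fun x => add_nonneg (mul_nonneg hA (hk0 _))
      (mul_nonneg hB0 (indicator_nonneg (fun _ _ => hk0 _) _))
    have h1 : ∫ x in Ioi (0 : ℝ), f x * k (y' - x) ≤ ∫ x in Ioi (0 : ℝ), G x := by
      refine setIntegral_mono_on (hfk y') hGi.integrableOn measurableSet_Ioi fun x hx => ?_
      by_cases hxm : x ∈ Ioc (y' - h) (y' + h)
      · simp only [hG, indicator_of_notMem (notMem_compl_iff.mpr hxm), mul_zero, add_zero]
        exact mul_le_mul_of_nonneg_right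
          (hclose h y x hh (by linarith [hxm.1]) (by linarith [hxm.2])) (hk0 _)
      · simp only [hG, indicator_of_mem (mem_compl hxm)]
        have := mul_le_mul_of_nonneg_right (hB x hx) (hk0 (y' - x))
        have := mul_nonneg hA (hk0 (y' - x))
        linarith
    have h2 : ∫ x in Ioi (0 : ℝ), G x ≤ ∫ x, G x :=
      setIntegral_le_integral hGi (ae_of_all _ hG0)
    have h3 : ∫ x, k (y' - x) = 1 := by rw [integral_sub_left_eq_self _ volume y', hk1]
    have h4 : ∫ x, G x = Real.exp (2 * c * h) * f y + B * (1 - ∫ u in (-h)..h, k u) := by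
      rw [hG, integral_add (hki'.const_mul _) (hkind.const_mul _), integral_const_mul,
        integral_const_mul, integral_indicator measurableSet_Ioc.compl, h3, mul_one,
        setIntegral_compl measurableSet_Ioc hki', h3, integral_Ioc_comp_sub_eq k y' h hh]
    have h5 : B * (1 - ∫ u in (-h)..h, k u) ≤ B * η :=
      mul_le_mul_of_nonneg_left (by linarith) hB0
    linarith
  refine tendsto_order.mpr ⟨fun a ha => ?_, fun a ha => ?_⟩
  · have hcont : Tendsto (fun h : ℝ => Real.exp (2 * c * h) * a + B * h) (𝓝[>] 0) (𝓝 a) := by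
      have : Continuous fun h : ℝ => Real.exp (2 * c * h) * a + B * h := by fun_prop
      simpa using (this.tendsto 0).mono_left nhdsWithin_le_nhds
    obtain ⟨h, hha, hh⟩ := ((hcont.eventually_lt_const ha).and self_mem_nhdsWithin).exists
    obtain ⟨S, hS, hfS⟩ := hlower h h hh hh
    filter_upwards [hS.eventually_const_lt hha, hfS] with y h1 h2
    exact lt_of_mul_lt_mul_left (by linarith) (Real.exp_pos (2 * c * h)).le
  · have hcont : Tendsto (fun h : ℝ => Real.exp (2 * c * h) * R / (1 - h)) (𝓝[>] 0) (𝓝 R) := by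
      have : ContinuousAt (fun h : ℝ => Real.exp (2 * c * h) * R / (1 - h)) 0 := by
        refine ContinuousAt.div (by fun_prop) (by fun_prop) (by norm_num)
      simpa using this.tendsto.mono_left nhdsWithin_le_nhds
    obtain ⟨h, hha, hh⟩ := ((hcont.eventually_lt_const ha).and (Ioo_mem_nhdsGT one_pos)).exists
    obtain ⟨S, hS, hfS⟩ := hupper h h hh.1 hh.1 hh.2
    have hS' : Tendsto (fun y => Real.exp (2 * c * h) * S y / (1 - h)) atTop
        (𝓝 (Real.exp (2 * c * h) * R / (1 - h))) := (hS.const_mul _).div_const _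
    filter_upwards [hS'.eventually_lt_const hha, hfS] with y h1 h2
    exact h2.trans_lt h1

section RelativeFractalDrum

variable {N : ℕ} {A Ω : Set (EuclideanSpace ℝ (Fin N))} {Dbar δ : ℝ}

lemma measurableSet_nbhd (t : ℝ) : MeasurableSet (nbhd N A t) :=
  (isOpen_lt (continuous_infDist_pt A) continuous_const).measurableSet

lemma volume_nbhd_inter_lt_top (hΩ : volume Ω < ⊤) (t : ℝ) : volume (nbhd N A t ∩ Ω) < ⊤ :=
  (measure_mono inter_subset_right).trans_lt hΩ

lemma tubeVol_nonneg (t : ℝ) : 0 ≤ tubeVol N A Ω t := ENNReal.toReal_nonneg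

lemma monotone_tubeVol (hΩ : volume Ω < ⊤) : Monotone (tubeVol N A Ω) := fun _ t hst =>
  ENNReal.toReal_mono (volume_nbhd_inter_lt_top hΩ t).ne
    (measure_mono (inter_subset_inter_left _ fun _ hx => lt_of_lt_of_le hx hst))

lemma tubeVol_le (hΩ : volume Ω < ⊤) (t : ℝ) : tubeVol N A Ω t ≤ (volume Ω).toReal :=
  ENNReal.toReal_mono hΩ.ne (measure_mono inter_subset_right)

lemma volume_div_eq_ofReal (hΩ : volume Ω < ⊤) {t : ℝ} (ht : 0 < t) (p : ℝ) :
    volume (nbhd N A t ∩ Ω) / ENNReal.ofReal (t ^ p) =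
      ENNReal.ofReal (tubeVol N A Ω t / t ^ p) := by
  rw [ENNReal.ofReal_div_of_pos (Real.rpow_pos_of_pos ht p), tubeVol,
    ENNReal.ofReal_toReal (volume_nbhd_inter_lt_top hΩ t).ne]

lemma tendsto_rpow_nhdsGT_zero {p : ℝ} (hp : 0 < p) :
    Tendsto (fun t : ℝ => t ^ p) (𝓝[>] 0) (𝓝 0) := by
  have := (Real.continuousAt_rpow_const 0 p (Or.inr hp.le)).tendsto
  rw [Real.zero_rpow hp.ne'] at this
  exact this.mono_left nhdsWithin_le_nhds

lemma IsUpperMinkDim.le_ambient (hΩ : volume Ω < ⊤) (hD : IsUpperMinkDim N A Ω Dbar) :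
    Dbar ≤ N := by
  refine le_of_forall_gt_imp_ge_of_dense fun r hr => hD.1 ?_
  have h1 : Tendsto (fun t : ℝ => (volume Ω).toReal * t ^ (r - N)) (𝓝[>] 0) (𝓝 0) := by
    simpa using (tendsto_rpow_nhdsGT_zero (sub_pos.mpr hr)).const_mul (volume Ω).toReal
  have h2 : Tendsto (fun t : ℝ => tubeVol N A Ω t / t ^ ((N : ℝ) - r)) (𝓝[>] 0) (𝓝 0) := by
    refine tendsto_of_tendsto_of_tendsto_of_le_of_le' tendsto_const_nhds h1 ?_ ?_ <;>
      filter_upwards [self_mem_nhdsWithin] with t ht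
    · exact div_nonneg (tubeVol_nonneg t) (Real.rpow_nonneg (le_of_lt ht) _)
    · rw [div_eq_mul_inv, ← Real.rpow_neg (le_of_lt ht), neg_sub]
      exact mul_le_mul_of_nonneg_right (tubeVol_le hΩ t) (Real.rpow_nonneg (le_of_lt ht) _)
  have h3 := ENNReal.tendsto_ofReal h2
  rw [ENNReal.ofReal_zero] at h3
  refine (h3.congr' ?_).limsup_eq
  filter_upwards [self_mem_nhdsWithin] with t ht
  exact (volume_div_eq_ofReal hΩ ht _).symm

lemma IsUpperMinkDim.exists_tubeVol_le (hΩ : volume Ω < ⊤) (hD : IsUpperMinkDim N A Ω Dbar)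
    (hδ : 0 < δ) {r : ℝ} (hr : Dbar < r) :
    ∃ q < r, ∃ C : ℝ, 0 ≤ C ∧ ∀ t ∈ Ioc 0 δ, tubeVol N A Ω t ≤ C * t ^ ((N : ℝ) - q) := by
  obtain ⟨q, hq, -, hqr⟩ := hD.exists_between hr
  refine ⟨q, hqr, ?_⟩
  set p : ℝ := (N : ℝ) - q
  have h1 : ∀ᶠ t in 𝓝[>] (0 : ℝ), volume (nbhd N A t ∩ Ω) / ENNReal.ofReal (t ^ p) < 1 := by
    refine eventually_lt_of_limsup_lt ?_
    change upperContent N A Ω q < 1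
    rw [show upperContent N A Ω q = 0 from hq]
    exact one_pos
  obtain ⟨t₀, ht₀, h2⟩ := (mem_nhdsGT_iff_exists_Ioo_subset).mp h1
  have ht₀' : (0 : ℝ) < t₀ := ht₀
  have hV := tubeVol_nonneg (N := N) (A := A) (Ω := Ω) δ
  have ha : 0 < t₀ ^ p := Real.rpow_pos_of_pos ht₀' p
  have hb : 0 < δ ^ p := Real.rpow_pos_of_pos hδ p
  refine ⟨1 + tubeVol N A Ω δ / t₀ ^ p + tubeVol N A Ω δ / δ ^ p, by positivity, fun t ht => ?_⟩
  have htp : 0 < t ^ p := Real.rpow_pos_of_pos ht.1 p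
  have e1 : 0 ≤ tubeVol N A Ω δ / t₀ ^ p * t ^ p := by positivity
  have e2 : 0 ≤ tubeVol N A Ω δ / δ ^ p * t ^ p := by positivity
  rw [add_mul, add_mul, one_mul]
  rcases lt_or_ge t t₀ with h | h
  · have h3 : volume (nbhd N A t ∩ Ω) / ENNReal.ofReal (t ^ p) < 1 := h2 ⟨ht.1, h⟩
    rw [volume_div_eq_ofReal hΩ ht.1, ENNReal.ofReal_lt_one, div_lt_one htp] at h3
    linarith
  · have h4 := monotone_tubeVol (N := N) (A := A) hΩ ht.2
    have h5 : ∀ a : ℝ, 0 < a → a ≤ t ^ p → tubeVol N A Ω δ ≤ tubeVol N A Ω δ / a * t ^ p := by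
      intro a ha hat
      rw [div_mul_eq_mul_div, le_div_iff₀ ha]
      exact mul_le_mul_of_nonneg_left hat hV
    rcases le_total 0 p with hp | hp
    · have := h5 _ ha (Real.rpow_le_rpow ht₀'.le h hp)
      linarith
    · have := h5 _ hb (Real.rpow_le_rpow_of_nonpos ht.1 ht.2 hp)
      linarith

/-- A Minkowski content in `(0, ∞)` at the upper dimension determines the box dimension. -/
lemma MinkMeasurable.isMinkDim {M : ℝ} (hΩ : volume Ω < ⊤) (hD : IsUpperMinkDim N A Ω Dbar)
    (hM : MinkMeasurable N A Ω Dbar M) : IsMinkDim N A Ω Dbar := by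
  refine ⟨hD, fun r hr => ?_, fun b hb => hD.2 fun r hr => hb ?_⟩
  · by_contra! hlt
    have h1 : Tendsto (fun t : ℝ => tubeVol N A Ω t / t ^ ((N : ℝ) - r)) (𝓝[>] 0) atTop := by
      have h2 : Tendsto (fun t : ℝ => (t ^ (Dbar - r))⁻¹) (𝓝[>] 0) atTop := by
        refine (tendsto_nhdsWithin_iff.mpr
          ⟨tendsto_rpow_nhdsGT_zero (sub_pos.mpr hlt), ?_⟩).inv_tendsto_nhdsGT_zero
        filter_upwards [self_mem_nhdsWithin] with t ht using Real.rpow_pos_of_pos ht _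
      have h5 := (tendsto_id.comp h2).atTop_mul_pos hM.1 hM.2
      refine h5.congr' ?_
      filter_upwards [self_mem_nhdsWithin] with t ht
      have e : t ^ ((N : ℝ) - r) = t ^ (Dbar - r) * t ^ ((N : ℝ) - Dbar) := by
        rw [← Real.rpow_add ht]
        congr 1
        ring
      rw [e, div_mul_eq_div_div_swap]
      simp only [Function.comp_apply, id]
      ring
    have h3 := ENNReal.tendsto_ofReal_nhds_top.mpr h1
    have h4 : lowerContent N A Ω r = ⊤ := by
      refine (h3.congr' ?_).liminf_eq
      filter_upwards [self_mem_nhdsWithin] with t ht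
      exact (volume_div_eq_ofReal hΩ ht _).symm
    rw [mem_ofPred_eq, h4] at hr
    exact ENNReal.top_ne_zero hr
  · exact le_antisymm ((liminf_le_limsup).trans_eq hr) zero_le

lemma ofReal_cpow_eq_cexp {t : ℝ} (ht : 0 < t) (a : ℂ) : (t : ℂ) ^ a = cexp (Real.log t * a) := by
  rw [cpow_def_of_ne_zero (ofReal_ne_zero.mpr ht.ne'), ofReal_log ht.le]

/-- The tube function in logarithmic scale, normalized at dimension `Dbar`. -/
def logTube (N : ℕ) (A Ω : Set (EuclideanSpace ℝ (Fin N))) (Dbar δ x : ℝ) : ℝ :=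
  tubeVol N A Ω (δ * Real.exp (-x)) * Real.exp ((N - Dbar) * x)

lemma logTube_nonneg (x : ℝ) : 0 ≤ logTube N A Ω Dbar δ x :=
  mul_nonneg (tubeVol_nonneg _) (Real.exp_pos _).le

lemma measurable_logTube (hΩ : volume Ω < ⊤) : Measurable (logTube N A Ω Dbar δ) := by
  have := (monotone_tubeVol (N := N) (A := A) hΩ).measurable
  unfold logTube
  fun_prop

lemma logTube_le (hΩ : volume Ω < ⊤) (hδ : 0 < δ) {x y : ℝ} (hxy : x ≤ y) :
    logTube N A Ω Dbar δ y ≤ Real.exp ((N - Dbar) * (y - x)) * logTube N A Ω Dbar δ x := by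
  have h1 : tubeVol N A Ω (δ * Real.exp (-y)) ≤ tubeVol N A Ω (δ * Real.exp (-x)) := by
    apply monotone_tubeVol hΩ
    gcongr
  have h2 : Real.exp ((N - Dbar) * y) =
      Real.exp ((N - Dbar) * (y - x)) * Real.exp ((N - Dbar) * x) := by
    rw [← Real.exp_add]
    congr 1
    ring
  unfold logTube
  rw [h2]
  have := mul_le_mul_of_nonneg_right h1
    (mul_pos (Real.exp_pos ((N - Dbar) * (y - x))) (Real.exp_pos ((N - Dbar) * x))).le
  linarith

lemma integrableOn_logTube_mul_exp (hΩ : volume Ω < ⊤) (hD : IsUpperMinkDim N A Ω Dbar)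
    (hδ : 0 < δ) {σ : ℝ} (hσ : 0 < σ) :
    IntegrableOn (fun x => logTube N A Ω Dbar δ x * Real.exp (-σ * x)) (Ioi 0) := by
  obtain ⟨q, hq, C, hC, hV⟩ := hD.exists_tubeVol_le hΩ hδ (lt_add_of_pos_right Dbar hσ)
  have hb : 0 < σ + Dbar - q := by linarith
  have hm := measurable_logTube (N := N) (A := A) (Ω := Ω) (Dbar := Dbar) (δ := δ) hΩ
  refine Integrable.mono' ((exp_neg_integrableOn_Ioi 0 hb).const_mul (C * δ ^ ((N : ℝ) - q)))
    (Measurable.aestronglyMeasurable (by fun_prop))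
    (ae_restrict_of_forall_mem measurableSet_Ioi fun x hx => ?_)
  have hx' : (0 : ℝ) < x := hx
  rw [Real.norm_of_nonneg (mul_nonneg (logTube_nonneg x) (Real.exp_pos _).le)]
  have h1 := hV (δ * Real.exp (-x)) ⟨by positivity,
    mul_le_of_le_one_right hδ.le (Real.exp_le_one_iff.mpr (by linarith))⟩
  rw [Real.mul_rpow hδ.le (Real.exp_pos _).le, ← Real.exp_mul] at h1
  calc logTube N A Ω Dbar δ x * Real.exp (-σ * x)
      ≤ C * (δ ^ ((N : ℝ) - q) * Real.exp (-x * (N - q))) * Real.exp ((N - Dbar) * x) *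
          Real.exp (-σ * x) := by
        unfold logTube
        gcongr
    _ = C * δ ^ ((N : ℝ) - q) *
          (Real.exp (-x * (N - q)) * Real.exp ((N - Dbar) * x) * Real.exp (-σ * x)) := by ring
    _ = C * δ ^ ((N : ℝ) - q) * Real.exp (-(σ + Dbar - q) * x) := by
        rw [← Real.exp_add, ← Real.exp_add]
        congr 2
        ring

lemma image_mul_exp_neg_Ioi (hδ : 0 < δ) :
    (fun x : ℝ => δ * Real.exp (-x)) '' Ioi 0 = Ioo 0 δ := by
  ext t
  constructor
  · rintro ⟨x, hx, rfl⟩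
    have hx' : (0 : ℝ) < x := hx
    exact ⟨by positivity, mul_lt_of_lt_one_right hδ (Real.exp_lt_one_iff.mpr (by linarith))⟩
  · rintro ⟨h0, h1⟩
    refine ⟨Real.log (δ / t), Real.log_pos ((one_lt_div h0).mpr h1), ?_⟩
    simp only
    rw [← Real.log_inv, Real.exp_log (by positivity)]
    field_simp

/-- The tube zeta function is, up to an exponential factor, the Laplace transform of the
logarithmic tube function. -/
lemma tubeZeta_eq (hδ : 0 < δ) (s : ℂ) :
    tubeZeta N A Ω δ s = cexp (Real.log δ * (s - N)) *
      ∫ x in Ioi (0 : ℝ), (logTube N A Ω Dbar δ x : ℂ) * cexp (-(s - Dbar) * x) := by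
  have hd : ∀ x ∈ Ioi (0 : ℝ), HasDerivWithinAt (fun x : ℝ => δ * Real.exp (-x))
      (-(δ * Real.exp (-x))) (Ioi 0) x := by
    intro x _
    have := ((hasDerivAt_neg x).exp.const_mul δ).hasDerivWithinAt (s := Ioi 0)
    exact this.congr_deriv (by ring)
  have hinj : InjOn (fun x : ℝ => δ * Real.exp (-x)) (Ioi 0) := by
    intro x _ y _ hxy
    have := Real.exp_injective (mul_left_cancel₀ hδ.ne' hxy)
    linarith
  rw [tubeZeta, integral_Ioc_eq_integral_Ioo, ← image_mul_exp_neg_Ioi hδ,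
    integral_image_eq_integral_abs_deriv_smul measurableSet_Ioi hd hinj, ← integral_const_mul]
  refine integral_congr_ae (ae_of_all _ fun x => ?_)
  have hpos : 0 < δ * Real.exp (-x) := by positivity
  simp only [logTube]
  rw [abs_neg, abs_of_pos hpos, real_smul, ofReal_cpow_eq_cexp hpos,
    Real.log_mul hδ.ne' (Real.exp_pos _).ne', Real.log_exp]
  have h1 : ((δ * Real.exp (-x) : ℝ) : ℂ) = cexp (Real.log δ - x) := by
    rw [← ofReal_sub, ← ofReal_exp, Real.exp_sub, Real.exp_log hδ, Real.exp_neg]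
    congr 1
  have h2 : cexp (Real.log δ - x) * cexp ((Real.log δ + -x : ℝ) * (s - N - 1)) =
      cexp (Real.log δ * (s - N)) * (cexp ((N - Dbar) * x) * cexp (-(s - Dbar) * x)) := by
    rw [← Complex.exp_add, ← Complex.exp_add, ← Complex.exp_add]
    congr 1
    push_cast
    ring
  rw [ofReal_mul (tubeVol N A Ω (δ * Real.exp (-x))), ofReal_exp ((N - Dbar) * x), h1]
  push_cast at h2 ⊢
  linear_combination (tubeVol N A Ω (δ * Real.exp (-x)) : ℂ) * h2

lemma tubeZeta_ofReal_eq (hδ : 0 < δ) (σ : ℝ) :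
    tubeZeta N A Ω δ ((Dbar : ℂ) + σ) = ((Real.exp (Real.log δ * (Dbar + σ - N)) *
      ∫ x in Ioi (0 : ℝ), logTube N A Ω Dbar δ x * Real.exp (-σ * x) : ℝ) : ℂ) := by
  rw [tubeZeta_eq (Dbar := Dbar) hδ, ofReal_mul, ← integral_complex_ofReal]
  push_cast
  congr 1
  refine integral_congr_ae (ae_of_all _ fun x => ?_)
  simp only
  congr 2
  ring

/-- If the logarithmic tube function converges, `(A, Ω)` is Minkowski measurable. -/
lemma tendsto_tubeVol_div_of_logTube {M : ℝ} (hδ : 0 < δ)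
    (h : Tendsto (logTube N A Ω Dbar δ) atTop (𝓝 (M * δ ^ ((N : ℝ) - Dbar)))) :
    Tendsto (fun t : ℝ => tubeVol N A Ω t / t ^ ((N : ℝ) - Dbar)) (𝓝[>] 0) (𝓝 M) := by
  have hδp : 0 < δ ^ ((N : ℝ) - Dbar) := Real.rpow_pos_of_pos hδ _
  have h1 : Tendsto (fun t : ℝ => Real.log δ + -Real.log t) (𝓝[>] 0) atTop :=
    tendsto_atTop_add_const_left _ _ (tendsto_neg_atBot_atTop.comp Real.tendsto_log_nhdsGT_zero)
  have h2 := (h.comp h1).div_const (δ ^ ((N : ℝ) - Dbar))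
  rw [mul_div_cancel_right₀ _ hδp.ne'] at h2
  refine h2.congr' ?_
  filter_upwards [self_mem_nhdsWithin] with t ht
  have ht' : (0 : ℝ) < t := ht
  have e1 : δ * Real.exp (-(Real.log δ + -Real.log t)) = t := by
    rw [neg_add, neg_neg, Real.exp_add, Real.exp_neg, Real.exp_log hδ, Real.exp_log ht']
    field_simp
  have e2 : Real.exp ((N - Dbar) * (Real.log δ + -Real.log t)) =
      δ ^ ((N : ℝ) - Dbar) / t ^ ((N : ℝ) - Dbar) := by
    rw [Real.rpow_def_of_pos hδ, Real.rpow_def_of_pos ht', ← Real.exp_sub]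
    congr 1
    ring
  simp only [Function.comp_apply, logTube, e1, e2]
  field_simp

/-- Minkowski measurability from a simple pole of the tube zeta function which is its only
singularity on the critical line. -/
lemma minkMeasurable_of_tubeZeta_pole (hΩ : volume Ω < ⊤) (hD : IsUpperMinkDim N A Ω Dbar)
    (hδ : 0 < δ) {U : Set ℂ} {F : ℂ → ℂ} {r : ℂ} (hU : IsOpen U)
    (hUl : {s : ℂ | s.re = Dbar} ⊆ U) (hF : DifferentiableOn ℂ F (U \ {(Dbar : ℂ)}))
    (hFeq : ∀ s ∈ U, Dbar < s.re → F s = tubeZeta N A Ω δ s) (hr : r ≠ 0)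
    (hres : Tendsto (fun s : ℂ => (s - (Dbar : ℂ)) * F s) (𝓝[≠] (Dbar : ℂ)) (𝓝 r)) :
    ∃ M : ℝ, (M : ℂ) = r ∧ MinkMeasurable N A Ω Dbar M := by
  have hDU : (Dbar : ℂ) ∈ U := hUl (ofReal_re Dbar)
  have hUnhds : U ∈ 𝓝 (Dbar : ℂ) := hU.mem_nhds hDU
  obtain ⟨M, hM0, rfl⟩ : ∃ M : ℝ, 0 ≤ M ∧ (M : ℂ) = r := by
    have hpath : Tendsto (fun σ : ℝ => (Dbar : ℂ) + σ) (𝓝[>] 0) (𝓝[≠] (Dbar : ℂ)) := by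
      refine tendsto_nhdsWithin_iff.mpr ⟨?_, ?_⟩
      · have : Continuous fun σ : ℝ => (Dbar : ℂ) + σ := by fun_prop
        simpa using (this.tendsto 0).mono_left nhdsWithin_le_nhds
      · filter_upwards [self_mem_nhdsWithin] with σ hσ
        simpa using (ne_of_gt hσ : σ ≠ 0)
    have hlim := hres.comp hpath
    have hreal : ∀ᶠ σ : ℝ in 𝓝[>] 0, ∃ v : ℝ, 0 ≤ v ∧
        (((Dbar : ℂ) + σ) - Dbar) * F ((Dbar : ℂ) + σ) = (v : ℂ) := by
      filter_upwards [hpath.eventually (nhdsWithin_le_nhds hUnhds), self_mem_nhdsWithin]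
        with σ hσU hσ
      rw [hFeq _ hσU (by simpa using hσ), tubeZeta_ofReal_eq hδ, add_sub_cancel_left, ← ofReal_mul]
      exact ⟨_, mul_nonneg (le_of_lt hσ) (mul_nonneg (Real.exp_pos _).le
        (integral_nonneg fun x => mul_nonneg (logTube_nonneg x) (Real.exp_pos _).le)), rfl⟩
    refine ⟨r.re, ge_of_tendsto ((continuous_re.tendsto _).comp hlim) ?_, ?_⟩
    · filter_upwards [hreal] with σ ⟨v, hv, hσ⟩
      rw [Function.comp_apply, Function.comp_apply, hσ, ofReal_re]
      exact hv
    · refine Complex.ext (ofReal_re _) ?_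
      rw [ofReal_im]
      refine tendsto_nhds_unique (tendsto_const_nhds.congr' ?_)
        ((continuous_im.tendsto _).comp hlim)
      filter_upwards [hreal] with σ ⟨v, hv, hσ⟩
      rw [Function.comp_apply, Function.comp_apply, hσ, ofReal_im]
  have hMpos : 0 < M := lt_of_le_of_ne hM0 fun h => hr (by simp [← h])
  refine ⟨M, rfl, hMpos, tendsto_tubeVol_div_of_logTube hδ ?_⟩
  set R : ℝ := M * δ ^ ((N : ℝ) - Dbar) with hR
  set e : ℂ → ℂ := fun s => cexp (-(Real.log δ * (s - N))) with he
  have heD : (M : ℂ) * e Dbar = (R : ℂ) := by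
    rw [hR, Real.rpow_def_of_pos hδ, he]
    push_cast
    congr 2
    ring
  set φ : ℂ → ℂ := Function.update (fun s => (s - Dbar) * F s * e s) Dbar R with hφ
  have hφne : ∀ s : ℂ, s ≠ Dbar → φ s = (s - Dbar) * F s * e s := fun s hs =>
    Function.update_of_ne hs _ _
  have hφD : φ Dbar = R := Function.update_self _ _ _
  have hed : Differentiable ℂ e := by fun_prop
  have hφd : DifferentiableOn ℂ φ U := by
    refine (Complex.differentiableOn_compl_singleton_and_continuousAt_iff hUnhds).mp ⟨?_, ?_⟩
    · have h1 : DifferentiableOn ℂ (fun s => (s - Dbar) * F s * e s) (U \ {(Dbar : ℂ)}) :=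
        ((differentiableOn_id.sub_const _).mul hF).mul hed.differentiableOn
      exact h1.congr fun s hs => hφne s hs.2
    · rw [continuousAt_update_same, ← heD]
      exact hres.mul ((hed.continuous.tendsto _).mono_left nhdsWithin_le_nhds)
  have hdsl : DifferentiableOn ℂ (dslope φ Dbar) U :=
    (Complex.differentiableOn_dslope hUnhds).mpr hφd
  refine tendsto_of_laplace_sub_pole (c := N - Dbar) (U := (fun z : ℂ => z + Dbar) ⁻¹' U)
    (H := fun z => dslope φ Dbar (z + Dbar)) (sub_nonneg.mpr (hD.le_ambient hΩ))
    (measurable_logTube hΩ) logTube_nonneg (fun x y hxy => logTube_le hΩ hδ hxy)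
    (fun σ hσ => integrableOn_logTube_mul_exp hΩ hD hδ hσ) (hU.preimage (by fun_prop))
    (fun z hz => hUl (by simp [hz]))
    (hdsl.continuousOn.comp (by fun_prop) fun z hz => hz) fun z hz hzre => ?_
  have hz0 : z ≠ 0 := by
    rintro rfl
    simp at hzre
  have hzD : z + Dbar ≠ (Dbar : ℂ) := by simpa using hz0
  rw [dslope_of_ne _ hzD, slope_def_field, hφD, hφne _ hzD, hFeq _ hz (by simpa using hzre),
    tubeZeta_eq (Dbar := Dbar) hδ, add_sub_cancel_right, he]
  simp only
  rw [Complex.exp_neg]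
  have := Complex.exp_ne_zero (Real.log δ * (z + Dbar - N))
  field_simp

lemma IsUpperMinkDim.ae_infDist_pos (hΩ : volume Ω < ⊤) (hD : IsUpperMinkDim N A Ω Dbar)
    (hDN : Dbar < N) : ∀ᵐ x ∂volume.restrict Ω, 0 < infDist x A := by
  obtain ⟨q, hq, C, -, hV⟩ := hD.exists_tubeVol_le hΩ one_pos hDN
  have hm : MeasurableSet {x | infDist x A ≤ 0} :=
    (isClosed_le (continuous_infDist_pt A) continuous_const).measurableSet
  have hlim : Tendsto (fun t : ℝ => C * t ^ ((N : ℝ) - q)) (𝓝[>] 0) (𝓝 0) := by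
    simpa using (tendsto_rpow_nhdsGT_zero (sub_pos.mpr hq)).const_mul C
  have hle : (volume ({x | infDist x A ≤ 0} ∩ Ω)).toReal ≤ 0 := by
    refine ge_of_tendsto hlim ?_
    filter_upwards [Ioc_mem_nhdsGT one_pos] with t ht
    refine le_trans (ENNReal.toReal_mono (volume_nbhd_inter_lt_top hΩ t).ne
      (measure_mono (inter_subset_inter_left _ fun x hx => ?_))) (hV t ht)
    exact lt_of_le_of_lt hx ht.1
  have hfin : volume ({x | infDist x A ≤ 0} ∩ Ω) ≠ ⊤ :=
    ((measure_mono inter_subset_right).trans_lt hΩ).ne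
  have h0 : volume ({x | infDist x A ≤ 0} ∩ Ω) = 0 :=
    ((ENNReal.toReal_eq_zero_iff _).mp (le_antisymm hle ENNReal.toReal_nonneg)).resolve_right hfin
  rw [ae_iff]
  simp only [not_lt]
  rwa [Measure.restrict_apply hm]

lemma integral_Ioc_indicator_Ioi_cpow {d : ℝ} {a : ℂ} (hd : 0 < d) (hdδ : d < δ) (ha : a ≠ 0) :
    ∫ t in Ioc 0 δ, (Ioi d).indicator (fun t : ℝ => (t : ℂ) ^ (a - 1)) t =
      ((δ : ℂ) ^ a - (d : ℂ) ^ a) / a := by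
  rw [setIntegral_indicator measurableSet_Ioi,
    show Ioc 0 δ ∩ Ioi d = Ioc d δ by
      ext t
      simp only [mem_inter_iff, mem_Ioc, mem_Ioi]
      constructor
      · rintro ⟨⟨-, h2⟩, h3⟩
        exact ⟨h3, h2⟩
      · rintro ⟨h1, h2⟩
        exact ⟨⟨hd.trans h1, h2⟩, h1⟩,
    ← intervalIntegral.integral_of_le hdδ.le, integral_cpow, sub_add_cancel]
  refine Or.inr ⟨fun h => ha ?_, ?_⟩
  · linear_combination h
  · rw [uIcc_of_le hdδ.le]
    exact fun h => absurd h.1 (not_le.mpr hd)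

/-- The functional equation connecting the distance and the tube zeta functions. -/
lemma distZetaD_eq (hΩ : volume Ω < ⊤) (hΩm : MeasurableSet Ω) (hD : IsUpperMinkDim N A Ω Dbar)
    (hδ : 0 < δ) (hDN : Dbar < N) {s : ℂ} (hs : Dbar < s.re) (hsN : s ≠ N) :
    distZetaD N A Ω δ s =
      (δ : ℂ) ^ (s - N) * tubeVol N A Ω δ + (N - s) * tubeZeta N A Ω δ s := by
  set S := nbhd N A δ ∩ Ω with hS
  have hSm : MeasurableSet S := (measurableSet_nbhd δ).inter hΩm
  have : IsFiniteMeasure (volume.restrict S) := ⟨by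
    simpa using volume_nbhd_inter_lt_top (A := A) hΩ δ⟩
  set g : EuclideanSpace ℝ (Fin N) → ℝ → ℂ := fun x =>
    (Ioi (infDist x A)).indicator fun t : ℝ => (t : ℂ) ^ (s - N - 1) with hg
  have hgx : ∀ t : ℝ, (fun x => g x t) =
      (nbhd N A t).indicator fun _ => (t : ℂ) ^ (s - N - 1) := fun t => by
    ext x
    by_cases h : infDist x A < t <;> simp [hg, nbhd, h]
  have hSt : ∀ t ∈ Ioc 0 δ, (volume.restrict S).real (nbhd N A t) = tubeVol N A Ω t := by
    intro t ht
    rw [measureReal_restrict_apply (measurableSet_nbhd t), hS, ← inter_assoc, inter_eq_left.mpr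
      (show nbhd N A t ⊆ nbhd N A δ from fun x hx => lt_of_lt_of_le hx ht.2)]
    rfl
  have hgm : Measurable (Function.uncurry g) := by
    have h1 : Function.uncurry g =
        {p : EuclideanSpace ℝ (Fin N) × ℝ | infDist p.1 A < p.2}.indicator fun p => (p.2 : ℂ) ^ (s - N - 1) := by
      ext p
      by_cases h : infDist p.1 A < p.2 <;> simp [hg, Function.uncurry, h]
    rw [h1]
    refine Measurable.indicator (by fun_prop) (isOpen_lt ?_ continuous_snd).measurableSet
    exact (continuous_infDist_pt A).comp continuous_fst
  have hgint : Integrable (Function.uncurry g)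
      ((volume.restrict S).prod (volume.restrict (Ioc 0 δ))) := by
    obtain ⟨q, hq, C, hC, hV⟩ := hD.exists_tubeVol_le hΩ hδ hs
    rw [integrable_prod_iff' hgm.aestronglyMeasurable]
    constructor
    · refine ae_of_all _ fun t => ?_
      change Integrable (fun x => g x t) _
      rw [hgx]
      exact (integrable_const _).indicator (measurableSet_nbhd t)
    · have hb : IntegrableOn (fun t : ℝ => C * t ^ (s.re - q - 1)) (Ioc 0 δ) := by
        refine Integrable.const_mul ?_ C
        rw [← IntegrableOn, ← intervalIntegrable_iff_integrableOn_Ioc_of_le hδ.le]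
        exact intervalIntegral.intervalIntegrable_rpow' (by linarith)
      refine Integrable.mono' hb
        hgm.aestronglyMeasurable.prod_swap.norm.integral_prod_right' ?_
      refine ae_restrict_of_forall_mem measurableSet_Ioc fun t ht => ?_
      rw [Real.norm_of_nonneg (integral_nonneg fun _ => norm_nonneg _)]
      have h1 : ∀ x, ‖Function.uncurry g (x, t)‖ =
          (nbhd N A t).indicator (fun _ => t ^ (s.re - N - 1)) x := by
        intro x
        change ‖(fun x => g x t) x‖ = _
        rw [hgx, norm_indicator_eq_indicator_norm]
        simp [norm_cpow_eq_rpow_re_of_pos ht.1]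
      simp only [h1]
      rw [integral_indicator_const _ (measurableSet_nbhd t), hSt t ht, smul_eq_mul]
      calc tubeVol N A Ω t * t ^ (s.re - N - 1)
          ≤ C * t ^ ((N : ℝ) - q) * t ^ (s.re - N - 1) :=
            mul_le_mul_of_nonneg_right (hV t ht) (Real.rpow_nonneg ht.1.le _)
        _ = C * t ^ (s.re - q - 1) := by
            rw [mul_assoc, ← Real.rpow_add ht.1]
            congr 2
            ring
  have hpt : ∀ᵐ x ∂volume.restrict S, (infDist x A : ℂ) ^ (s - N) =
      (δ : ℂ) ^ (s - N) + (N - s) * ∫ t in Ioc 0 δ, g x t := by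
    filter_upwards [ae_restrict_mem hSm,
      ae_mono (Measure.restrict_mono inter_subset_right le_rfl) (hD.ae_infDist_pos hΩ hDN)]
      with x hx hx0
    rw [hg, integral_Ioc_indicator_Ioi_cpow hx0 hx.1 (sub_ne_zero.mpr hsN)]
    have := sub_ne_zero.mpr hsN
    field_simp
    ring
  have hgl : Integrable (fun x => ∫ t in Ioc 0 δ, g x t) (volume.restrict S) :=
    hgint.integral_prod_left
  rw [distZetaD, integral_congr_ae hpt, integral_add (integrable_const _)
    (hgl.const_mul _), integral_const_mul, integral_integral_swap hgint]
  congr 1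
  · rw [integral_const, measureReal_restrict_apply_univ, real_smul, mul_comm]
    rfl
  · congr 1
    refine setIntegral_congr_fun measurableSet_Ioc fun t ht => ?_
    rw [hgx, integral_indicator_const _ (measurableSet_nbhd t), hSt t ht, real_smul, mul_comm]

/-- Minkowski measurability from a simple pole of the distance zeta function which is its only
singularity on the critical line. -/
lemma minkMeasurable_of_distZetaD_pole (hΩ : volume Ω < ⊤) (hΩm : MeasurableSet Ω)
    (hD : IsUpperMinkDim N A Ω Dbar) (hδ : 0 < δ) (hDN : Dbar < N) {U : Set ℂ} {F : ℂ → ℂ} {r : ℂ}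
    (hU : IsOpen U) (hUl : {s : ℂ | s.re = Dbar} ⊆ U)
    (hF : DifferentiableOn ℂ F (U \ {(Dbar : ℂ)}))
    (hFeq : ∀ s ∈ U, Dbar < s.re → F s = distZetaD N A Ω δ s) (hr : r ≠ 0)
    (hres : Tendsto (fun s : ℂ => (s - (Dbar : ℂ)) * F s) (𝓝[≠] (Dbar : ℂ)) (𝓝 r)) :
    ∃ M : ℝ, (M : ℂ) = r ∧ MinkMeasurable N A Ω Dbar (M / (N - Dbar)) := by
  have hND : (N : ℂ) - Dbar ≠ 0 := by
    exact_mod_cast (sub_pos.mpr hDN).ne'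
  have hδ0 : (δ : ℂ) ≠ 0 := ofReal_ne_zero.mpr hδ.ne'
  set E : ℂ → ℂ := fun s => (δ : ℂ) ^ (s - N) * tubeVol N A Ω δ with hE
  have hEd : Differentiable ℂ E := fun s =>
    ((differentiableAt_id.sub_const _).const_cpow (Or.inl hδ0)).mul_const _
  obtain ⟨M, hM, hMm⟩ := minkMeasurable_of_tubeZeta_pole (U := U \ {(N : ℂ)})
    (F := fun s => (F s - E s) / (N - s)) (r := r / (N - Dbar)) hΩ hD hδ
    (hU.sdiff isClosed_singleton)
    (fun s hs => ⟨hUl hs, fun h => by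
      rw [mem_singleton_iff] at h
      rw [mem_ofPred_eq, h, natCast_re] at hs
      exact hDN.ne' hs⟩)
    (((hF.mono fun s hs => ⟨hs.1.1, hs.2⟩).sub hEd.differentiableOn).div
      ((differentiableOn_const _).sub differentiableOn_id)
      fun s hs => sub_ne_zero.mpr (Ne.symm hs.1.2))
    (fun s hs hre => by
      have hsN : (N : ℂ) - s ≠ 0 := sub_ne_zero.mpr (Ne.symm hs.2)
      rw [hFeq s hs.1 hre, distZetaD_eq hΩ hΩm hD hδ hDN hre hs.2, hE]
      field_simp
      ring)
    (div_ne_zero hr hND)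
    (by
      have h1 : Tendsto (fun s : ℂ => (s - Dbar) * E s) (𝓝[≠] (Dbar : ℂ)) (𝓝 0) := by
        have : Continuous fun s : ℂ => (s - Dbar) * E s := by
          have := hEd.continuous
          fun_prop
        simpa using (this.tendsto (Dbar : ℂ)).mono_left nhdsWithin_le_nhds
      have h2 : Tendsto (fun s : ℂ => (N : ℂ) - s) (𝓝[≠] (Dbar : ℂ)) (𝓝 (N - Dbar)) :=
        ((continuous_const.sub continuous_id).tendsto _).mono_left nhdsWithin_le_nhds
      have h3 := (hres.sub h1).div h2 hND
      rw [sub_zero] at h3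
      refine h3.congr fun s => ?_
      simp only [Pi.div_apply]
      ring)
  have hND' : (N : ℝ) - Dbar ≠ 0 := (sub_pos.mpr hDN).ne'
  refine ⟨M * (N - Dbar), ?_, by rwa [mul_div_cancel_right₀ _ hND']⟩
  push_cast
  rw [hM, div_mul_cancel₀ _ hND]

end RelativeFractalDrum

/-- sufficient condition for Minkowski measurability.
Let `(A,Ω)` be an RFD in `ℝ^N` with `D̄ := dim̄_B(A,Ω) ∈ ℝ` and fix `δ > 0`.
If `U` is an open connected set containing the critical line `{Re s = D̄}` and
`F : U → ℂ` is holomorphic on `U ∖ {D̄}`, agrees with `ζ̃_{A,Ω}(·;δ)` on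
`{s ∈ U : Re s > D̄}`, and has a simple pole at `D̄` with residue `r ≠ 0`, then
`dim_B(A,Ω)` exists and equals `D̄`, `(A,Ω)` is Minkowski measurable and
`M^{D̄}(A,Ω) = r`.  If instead `D̄ < N` and `F` agrees with `ζ_{A,Ω}(·;δ)` there
(same simple-pole hypothesis), then `(A,Ω)` is Minkowski measurable with
`M^{D̄}(A,Ω) = r/(N−D̄)`. -/
theorem statement11
    (N : ℕ) (A Ω : Set (EuclideanSpace ℝ (Fin N))) (Dbar δ : ℝ)
    (hRFD : IsRFD N A Ω) (hD : IsUpperMinkDim N A Ω Dbar) (hδ : 0 < δ) :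
    (∀ (U : Set ℂ) (F : ℂ → ℂ) (r : ℂ),
      IsOpen U → IsPreconnected U → {s : ℂ | s.re = Dbar} ⊆ U →
      DifferentiableOn ℂ F (U \ {(Dbar : ℂ)}) →
      (∀ s ∈ U, Dbar < s.re → F s = tubeZeta N A Ω δ s) →
      r ≠ 0 →
      Tendsto (fun s : ℂ => (s - (Dbar : ℂ)) * F s)
        (nhdsWithin (Dbar : ℂ) {(Dbar : ℂ)}ᶜ) (nhds r) →
      IsMinkDim N A Ω Dbar ∧
        ∃ M : ℝ, (M : ℂ) = r ∧ MinkMeasurable N A Ω Dbar M) ∧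
    (Dbar < N →
      ∀ (U : Set ℂ) (F : ℂ → ℂ) (r : ℂ),
        IsOpen U → IsPreconnected U → {s : ℂ | s.re = Dbar} ⊆ U →
        DifferentiableOn ℂ F (U \ {(Dbar : ℂ)}) →
        (∀ s ∈ U, Dbar < s.re → F s = distZetaD N A Ω δ s) →
        r ≠ 0 →
        Tendsto (fun s : ℂ => (s - (Dbar : ℂ)) * F s)
          (nhdsWithin (Dbar : ℂ) {(Dbar : ℂ)}ᶜ) (nhds r) →
        IsMinkDim N A Ω Dbar ∧
          ∃ M : ℝ, (M : ℂ) = r ∧ MinkMeasurable N A Ω Dbar (M / ((N : ℝ) - Dbar))) := by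
  obtain ⟨-, hΩm, hΩ, -⟩ := hRFD
  refine ⟨fun U F r hU _ hUl hF hFeq hr hres => ?_, fun hDN U F r hU _ hUl hF hFeq hr hres => ?_⟩
  · obtain ⟨M, hM, hMm⟩ := minkMeasurable_of_tubeZeta_pole hΩ hD hδ hU hUl hF hFeq hr hres
    exact ⟨hMm.isMinkDim hΩ hD, M, hM, hMm⟩
  · obtain ⟨M, hM, hMm⟩ :=
      minkMeasurable_of_distZetaD_pole hΩ hΩm hD hδ hDN hU hUl hF hFeq hr hres
    exact ⟨hMm.isMinkDim hΩ hD, M, hM, hMm⟩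

end
end
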